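/- There exists a set of 9 points in the plane in general position that contains no 5-hole and, for every ℓ ≥ 8, no empty ℓ-pseudo-triangle. Consequently, since every set of 10 points in general position contains a 5-hole, E(5,ℓ) = 10 for all ℓ ≥ 8. -/

import Mathlib

open Set

noncomputable section

/-- Points of the plane. -/
abbrev Pt : Type := ℝ × ℝ

/-- Two-dimensional cross product. -/
def cross2 (u w : Pt) : ℝ := u.1 * w.2 - u.2 * w.1

/-- A set of points is in general position if no three of its points are collinear. -/
def GenPos (S : Set Pt) : Prop :=
  ∀ p ∈ S, ∀ q ∈ S, ∀ r ∈ S, p ≠ q → p ≠ r → q ≠ r →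
    ¬ Collinear ℝ ({p, q, r} : Set Pt)

/-- `v : ZMod n → Pt` lists the vertices (in cyclic order) of a simple polygon:
vertices are pairwise distinct, non-adjacent edges are disjoint, and adjacent
edges meet exactly in their common vertex. -/
structure IsSimplePolygon (n : ℕ) (v : ZMod n → Pt) : Prop where
  three_le : 3 ≤ n
  inj : Function.Injective v
  nonadj : ∀ i j : ZMod n, i ≠ j → i ≠ j + 1 → j ≠ i + 1 →
    segment ℝ (v i) (v (i + 1)) ∩ segment ℝ (v j) (v (j + 1)) = ∅
  adj : ∀ i : ZMod n,
    segment ℝ (v i) (v (i + 1)) ∩ segment ℝ (v (i + 1)) (v (i + 2)) = {v (i + 1)}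

/-- Twice the signed area of a polygon. -/
def signedArea (n : ℕ) (v : ZMod n → Pt) : ℝ :=
  if h : n = 0 then 0 else
    haveI : NeZero n := ⟨h⟩
    ∑ i : ZMod n, cross2 (v i) (v (i + 1))

/-- The turning cross product at vertex `i`. -/
def vtxCross (n : ℕ) (v : ZMod n → Pt) (i : ZMod n) : ℝ :=
  cross2 (v i - v (i - 1)) (v (i + 1) - v i)

/-- Vertex `i` of a simple polygon is convex (interior angle `< π`) iff the turn
at `i` has the same (strict) sign as the orientation of the polygon. -/
def IsConvexVtx (n : ℕ) (v : ZMod n → Pt) (i : ZMod n) : Prop :=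
  0 < vtxCross n v i * signedArea n v

/-- A pseudo-triangle: a simple polygon in which every vertex is strictly convex or
strictly reflex, with exactly three convex vertices. -/
def IsPseudoTriangle (n : ℕ) (v : ZMod n → Pt) : Prop :=
  IsSimplePolygon n v ∧ (∀ i : ZMod n, vtxCross n v i ≠ 0) ∧
    {i : ZMod n | IsConvexVtx n v i}.ncard = 3

/-- A standard pseudo-triangle: each of the three side chains has at least two
edges, i.e. no two convex vertices are cyclically adjacent. -/
def IsStandardPseudoTriangle (n : ℕ) (v : ZMod n → Pt) : Prop :=
  IsPseudoTriangle n v ∧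
    ∀ i : ZMod n, IsConvexVtx n v i → ¬ IsConvexVtx n v (i + 1)

/-- A mountain: a pseudo-triangle in which exactly one side chain consists of a
single edge (i.e. exactly one cyclically adjacent pair of convex vertices);
a 3-mountain is a triangle. -/
def IsMountain (n : ℕ) (v : ZMod n → Pt) : Prop :=
  IsPseudoTriangle n v ∧
    (n = 3 ∨ {i : ZMod n | IsConvexVtx n v i ∧ IsConvexVtx n v (i + 1)}.ncard = 1)

/-- The boundary of a polygon: the union of its edges. -/
def polyBoundary (n : ℕ) (v : ZMod n → Pt) : Set Pt :=
  ⋃ i : ZMod n, segment ℝ (v i) (v (i + 1))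

/-- The interior of a simple polygon: the union of the bounded connected
components of the complement of its boundary. -/
def polyInterior (n : ℕ) (v : ZMod n → Pt) : Set Pt :=
  {x : Pt | x ∉ polyBoundary n v ∧
    Bornology.IsBounded (connectedComponentIn (polyBoundary n v)ᶜ x)}

/-- A polygon is empty in `S` if its interior contains no point of `S`. -/
def EmptyIn (n : ℕ) (v : ZMod n → Pt) (S : Set Pt) : Prop :=
  polyInterior n v ∩ S = ∅

/-- `S` contains an empty `ℓ`-pseudo-triangle. -/
def HasEmptyPseudoTriangle (ℓ : ℕ) (S : Set Pt) : Prop :=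
  ∃ v : ZMod ℓ → Pt, Set.range v ⊆ S ∧ IsPseudoTriangle ℓ v ∧ EmptyIn ℓ v S

/-- A set of points is in convex position if each of them is a vertex of their
convex hull. -/
def ConvexPos (H : Set Pt) : Prop := ∀ p ∈ H, p ∉ convexHull ℝ (H \ {p})

/-- `H` is a `k`-hole in `S`: `k` points of `S` in convex position whose convex
hull contains no other point of `S` in its interior. -/
def IsHole (k : ℕ) (S H : Set Pt) : Prop :=
  H ⊆ S ∧ H.ncard = k ∧ ConvexPos H ∧
    ∀ p ∈ S, p ∈ interior (convexHull ℝ H) → p ∈ H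

/-- `S` contains a `k`-hole. -/
def HasHole (k : ℕ) (S : Set Pt) : Prop := ∃ H : Set Pt, IsHole k S H

/-- The points of `S` that are vertices of the convex hull of `S`. -/
def hullVertices (S : Set Pt) : Set Pt := {p ∈ S | p ∉ convexHull ℝ (S \ {p})}

/-- The points of `S` lying in the interior of the convex hull of `S`. -/
def interiorPts (S : Set Pt) : Set Pt := {p ∈ S | p ∈ interior (convexHull ℝ S)}

/-- `S` is `λ`-convex: every triangle with vertices in `S` contains at most `λ`
points of `S` in its interior. -/
def LambdaConvex (lam : ℕ) (S : Set Pt) : Prop :=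
  ∀ p ∈ S, ∀ q ∈ S, ∀ r ∈ S,
    (S ∩ interior (convexHull ℝ ({p, q, r} : Set Pt))).ncard ≤ lam

/-! ### A small verified RUP checker -/

namespace Hb

/-- Binary trees used as random access tables. -/
inductive Tab where
  | leaf : Tab
  | node : ℕ → Tab → Tab → Tab

/-- Table lookup: index `0` is the root, odd indices go left, even ones right. -/
def Tab.get : Tab → ℕ → ℕ
  | .leaf, _ => 0
  | .node c l r, i =>
    cond (Nat.beq i 0) c
      (cond (Nat.beq (Nat.mod i 2) 1) (l.get (Nat.div i 2)) (r.get (Nat.sub (Nat.div i 2) 1)))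

/-- Digits in base `4096`. -/
def unpack : ℕ → ℕ → List ℕ
  | 0, _ => []
  | n + 1, c => cond (Nat.beq c 0) [] (Nat.mod c 4096 :: unpack n (Nat.div c 4096))

/-- Scan a clause under the set `A` of false literals.  `0`: all literals false;
`1`: at least two literals are not known to be false; else: the only candidate. -/
def scan (A : ℕ) : List ℕ → ℕ → ℕ
  | [], u => u
  | l :: ls, u =>
    cond (Nat.beq (Nat.land 1 (Nat.shiftRight A l)) 1) (scan A ls u)
      (cond (Nat.beq u 0) (scan A ls l) 1)

def setAll : List ℕ → ℕ → ℕ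
  | [], A => A
  | l :: ls, A => setAll ls (Nat.lor A (Nat.shiftLeft 1 l))

def rup (db : Tab) (i : ℕ) : List ℕ → ℕ → Bool
  | [], _ => false
  | h :: hs, A =>
    cond (Nat.ble i h) false
      ((fun r => cond (Nat.beq r 0) true
        (cond (Nat.beq r 1) false
          (rup db i hs (Nat.lor A (Nat.shiftLeft 1 (Nat.xor r 1))))))
       (scan A (unpack 64 (db.get h)) 0))

def checkAll (db : Tab) (A0 : ℕ) : List ℕ → ℕ → Bool
  | [], _ => true
  | h :: hs, i =>
    cond (rup db i (unpack 200 h) (setAll (unpack 64 (db.get i)) A0)) (checkAll db A0 hs (Nat.succ i)) false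

def eqL : List ℕ → List ℕ → Bool
  | [], [] => true
  | x :: xs, y :: ys => cond (Nat.beq x y) (eqL xs ys) false
  | [], _ :: _ => false
  | _ :: _, [] => false

theorem eqL_spec (xs : List ℕ) : ∀ ys, eqL xs ys = true → xs = ys := by
  induction xs with
  | nil => intro ys h; cases ys with
    | nil => rfl
    | cons y ys => simp [eqL] at h
  | cons x xs ih => intro ys h; cases ys with
    | nil => simp [eqL] at h
    | cons y ys =>
      unfold eqL at h
      cases hb : Nat.beq x y with
      | false => simp [hb] at h
      | true =>
        rw [hb] at h
        rw [Nat.eq_of_beq_eq_true hb, ih ys (by simpa using h)]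

def checkInputs (db : Tab) : List (List ℕ) → ℕ → Bool
  | [], _ => true
  | c :: cs, i => cond (eqL (unpack 64 (db.get i)) c) (checkInputs db cs (Nat.succ i)) false

/-- Truth of a literal code: `2 v + 2` is the variable `v`, `2 v + 3` its negation. -/
def LitTrue (V : ℕ → Prop) (l : ℕ) : Prop :=
  l ≠ 0 ∧ (if l % 2 = 0 then V (l / 2 - 1) else ¬ V (l / 2 - 1))

def SatL (V : ℕ → Prop) (ls : List ℕ) : Prop := ∃ l ∈ ls, LitTrue V l

def AInv (V : ℕ → Prop) (A : ℕ) : Prop := ∀ k, A.testBit k = true → ¬ LitTrue V k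

theorem test_iff (A l : ℕ) : Nat.beq (Nat.land 1 (Nat.shiftRight A l)) 1 = A.testBit l := by
  have h : Nat.land 1 (Nat.shiftRight A l) = 1 &&& (A >>> l) := rfl
  rw [h, Nat.testBit]
  have := Nat.one_and_eq_mod_two (A >>> l)
  rw [this]
  rcases Nat.mod_two_eq_zero_or_one (A >>> l) with h | h <;> rw [h] <;> rfl

theorem ainv_set {V : ℕ → Prop} {A l : ℕ} (hA : AInv V A) (hl : ¬ LitTrue V l) :
    AInv V (Nat.lor A (Nat.shiftLeft 1 l)) := by
  intro k hk
  have h : Nat.lor A (Nat.shiftLeft 1 l) = A ||| (1 <<< l) := rfl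
  rw [h, Nat.testBit_or, Bool.or_eq_true] at hk
  rcases hk with hk | hk
  · exact hA k hk
  · rw [Nat.one_shiftLeft, Nat.testBit_two_pow] at hk
    have : l = k := by simpa using hk
    exact this ▸ hl

theorem litTrue_xor {V : ℕ → Prop} {r : ℕ} (h : LitTrue V r) :
    ¬ LitTrue V (Nat.xor r 1) := by
  have hx : Nat.xor r 1 = r ^^^ 1 := rfl
  rw [hx]
  have h2 : (r ^^^ 1) / 2 = r / 2 := by
    have := Nat.xor_div_two_pow (a := r) (b := 1) (n := 1)
    simpa using this
  have h3 : (r ^^^ 1) % 2 = (r + 1) % 2 := by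
    simp
  unfold LitTrue at *
  rw [h2, h3]
  rcases Nat.mod_two_eq_zero_or_one r with h0 | h0
  · have : (r + 1) % 2 = 1 := by omega
    simp [h0] at h
    simp [this, h]
  · have : (r + 1) % 2 = 0 := by omega
    simp [h0] at h
    simp [this, h]

theorem scan_spec {V : ℕ → Prop} {A : ℕ} (hA : AInv V A) (ls : List ℕ) :
    ∀ u, (SatL V ls ∨ LitTrue V u) → scan A ls u ≠ 0 ∧
      (scan A ls u = 1 ∨ LitTrue V (scan A ls u)) := by
  induction ls with
  | nil =>
    intro u h
    rcases h with ⟨l, hl, _⟩ | h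
    · simp at hl
    · exact ⟨h.1, Or.inr h⟩
  | cons l ls ih =>
    intro u h
    unfold scan
    rw [test_iff]
    cases ht : A.testBit l with
    | true =>
      have hl := hA l ht
      have := ih u (by
        rcases h with ⟨m, hm, hmt⟩ | h
        · rcases List.mem_cons.1 hm with rfl | hm
          · exact absurd hmt hl
          · exact Or.inl ⟨m, hm, hmt⟩
        · exact Or.inr h)
      simpa using this
    | false =>
      by_cases hu : u = 0
      · subst hu
        have := ih l (by
          rcases h with ⟨m, hm, hmt⟩ | h
          · rcases List.mem_cons.1 hm with rfl | hm
            · exact Or.inr hmt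
            · exact Or.inl ⟨m, hm, hmt⟩
          · exact absurd rfl h.1)
        simpa using this
      · have : Nat.beq u 0 = false := by
          cases u with
          | zero => exact absurd rfl hu
          | succ n => rfl
        simp [this]

theorem setAll_spec {V : ℕ → Prop} (ls : List ℕ) : ∀ A, AInv V A → ¬ SatL V ls →
    AInv V (setAll ls A) := by
  induction ls with
  | nil => intro A hA _; exact hA
  | cons l ls ih =>
    intro A hA h
    unfold setAll
    apply ih
    · exact ainv_set hA (fun h' => h ⟨l, by simp, h'⟩)
    · rintro ⟨m, hm, h'⟩
      exact h ⟨m, by simp [hm], h'⟩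

theorem rup_spec {V : ℕ → Prop} {db : Tab} {i : ℕ}
    (hdb : ∀ j < i, SatL V (unpack 64 (db.get j))) (hs : List ℕ) :
    ∀ A, AInv V A → rup db i hs A = true → False := by
  induction hs with
  | nil => intro A _ h; simp [rup] at h
  | cons h hs ih =>
    intro A hA hr
    unfold rup at hr
    cases hb : Nat.ble i h with
    | true => simp [hb] at hr
    | false =>
      have hlt : h < i := by
        by_contra hc
        have := Nat.ble_eq_true_of_le (not_lt.1 hc)
        simp [this] at hb
      have hsc := scan_spec hA (unpack 64 (db.get h)) 0 (Or.inl (hdb h hlt))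
      rw [hb] at hr
      simp only [cond_false] at hr
      generalize scan A (unpack 64 (db.get h)) 0 = r at hr hsc
      obtain ⟨h0, h1⟩ := hsc
      have e0 : Nat.beq r 0 = false := by
        cases r with
        | zero => exact absurd rfl h0
        | succ n => rfl
      rw [e0] at hr
      cases e1 : Nat.beq r 1 with
      | true => simp [e1] at hr
      | false =>
        rw [e1] at hr
        simp only [cond_false] at hr
        rcases h1 with h1 | h1
        · subst h1; simp at e1
        · exact ih _ (ainv_set hA (litTrue_xor h1)) hr

theorem checkAll_spec {V : ℕ → Prop} {db : Tab} {A0 : ℕ} (hA : AInv V A0) (hs : List ℕ) :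
    ∀ i, (∀ j < i, SatL V (unpack 64 (db.get j))) → checkAll db A0 hs i = true →
      ∀ j < i + hs.length, SatL V (unpack 64 (db.get j)) := by
  induction hs with
  | nil => intro i h _; exact h
  | cons h hs ih =>
    intro i hi hc
    unfold checkAll at hc
    cases hr : rup db i (unpack 200 h) (setAll (unpack 64 (db.get i)) A0) with
    | false => simp [hr] at hc
    | true =>
      rw [hr] at hc
      simp only [cond_true] at hc
      have hnew : SatL V (unpack 64 (db.get i)) := by
        by_contra hn
        exact rup_spec hi _ _ (setAll_spec _ _ hA hn) hr
      have := ih (i + 1) (by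
        intro j hj
        rcases Nat.lt_succ_iff_lt_or_eq.1 hj with hj | rfl
        · exact hi j hj
        · exact hnew) hc
      intro j hj
      apply this
      simp only [List.length_cons] at hj
      omega

theorem checkInputs_spec {V : ℕ → Prop} {db : Tab} (cs : List (List ℕ)) :
    ∀ i, (∀ j < i, SatL V (unpack 64 (db.get j))) → (∀ c ∈ cs, SatL V c) →
      checkInputs db cs i = true → ∀ j < i + cs.length, SatL V (unpack 64 (db.get j)) := by
  induction cs with
  | nil => intro i h _ _; exact h
  | cons c cs ih =>
    intro i hi hsat hc
    unfold checkInputs at hc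
    cases hr : eqL (unpack 64 (db.get i)) c with
    | false => simp [hr] at hc
    | true =>
      rw [hr] at hc
      simp only [cond_true] at hc
      have he : unpack 64 (db.get i) = c := eqL_spec _ _ hr
      have := ih (i + 1) (by
        intro j hj
        rcases Nat.lt_succ_iff_lt_or_eq.1 hj with hj | rfl
        · exact hi j hj
        · rw [he]; exact hsat c (by simp)) (fun c' hc' => hsat c' (by simp [hc'])) hc
      intro j hj
      apply this
      simp only [List.length_cons] at hj
      omega

end Hb
/-! ### The propositional encoding -/

namespace Hb

inductive Var where
  | chi (a b c : ℕ)
  | nn (a b c : ℕ)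
  | j1 (a b c d : ℕ)
  | j2 (a b c d : ℕ)

def r3 (a b c : ℕ) : ℕ := c * (c - 1) * (c - 2) / 6 + b * (b - 1) / 2 + a
def r4 (a b c d : ℕ) : ℕ := d * (d - 1) * (d - 2) * (d - 3) / 24 + r3 a b c

def Var.idx : Var → ℕ
  | .chi a b c => r3 a b c
  | .nn a b c => 120 + r3 a b c
  | .j1 a b c d => 240 + r4 a b c d
  | .j2 a b c d => 450 + r4 a b c d

/-- Lists built from increasing triples, quadruples and quintuples below ten. -/
def for2 {α : Type} (c : ℕ) (f : ℕ → ℕ → List α) : List α :=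
  (List.range c).flatMap fun b => (List.range b).flatMap fun a => f a b
def for3 {α : Type} (d : ℕ) (f : ℕ → ℕ → ℕ → List α) : List α :=
  (List.range d).flatMap fun c => for2 c fun a b => f a b c
def for4 {α : Type} (e : ℕ) (f : ℕ → ℕ → ℕ → ℕ → List α) : List α :=
  (List.range e).flatMap fun d => for3 d fun a b c => f a b c d
def for5 {α : Type} (n : ℕ) (f : ℕ → ℕ → ℕ → ℕ → ℕ → List α) : List α :=
  (List.range n).flatMap fun e => for4 e fun a b c d => f a b c d e

theorem mem_for2 {α : Type} {n : ℕ} {f : ℕ → ℕ → List α} {x : α} :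
    x ∈ for2 n f ↔ ∃ a b, a < b ∧ b < n ∧ x ∈ f a b := by
  simp only [for2, List.mem_flatMap, List.mem_range]
  constructor
  · rintro ⟨b, hb, a, ha, h⟩; exact ⟨a, b, ha, hb, h⟩
  · rintro ⟨a, b, ha, hb, h⟩; exact ⟨b, hb, a, ha, h⟩

theorem mem_for3 {α : Type} {n : ℕ} {f : ℕ → ℕ → ℕ → List α} {x : α} :
    x ∈ for3 n f ↔ ∃ a b c, a < b ∧ b < c ∧ c < n ∧ x ∈ f a b c := by
  simp only [for3, List.mem_flatMap, List.mem_range, mem_for2]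
  constructor
  · rintro ⟨c, hc, a, b, ha, hb, h⟩; exact ⟨a, b, c, ha, hb, hc, h⟩
  · rintro ⟨a, b, c, ha, hb, hc, h⟩; exact ⟨c, hc, a, b, ha, hb, h⟩

theorem mem_for4 {α : Type} {n : ℕ} {f : ℕ → ℕ → ℕ → ℕ → List α} {x : α} :
    x ∈ for4 n f ↔ ∃ a b c d, a < b ∧ b < c ∧ c < d ∧ d < n ∧ x ∈ f a b c d := by
  simp only [for4, List.mem_flatMap, List.mem_range, mem_for3]
  constructor
  · rintro ⟨d, hd, a, b, c, ha, hb, hc, h⟩; exact ⟨a, b, c, d, ha, hb, hc, hd, h⟩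
  · rintro ⟨a, b, c, d, ha, hb, hc, hd, h⟩; exact ⟨d, hd, a, b, c, ha, hb, hc, h⟩

theorem mem_for5 {α : Type} {n : ℕ} {f : ℕ → ℕ → ℕ → ℕ → ℕ → List α} {x : α} :
    x ∈ for5 n f ↔ ∃ a b c d e, a < b ∧ b < c ∧ c < d ∧ d < e ∧ e < n ∧ x ∈ f a b c d e := by
  simp only [for5, List.mem_flatMap, List.mem_range, mem_for4]
  constructor
  · rintro ⟨e, he, a, b, c, d, ha, hb, hc, hd, h⟩; exact ⟨a, b, c, d, e, ha, hb, hc, hd, he, h⟩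
  · rintro ⟨a, b, c, d, e, ha, hb, hc, hd, he, h⟩; exact ⟨e, he, a, b, c, d, ha, hb, hc, hd, h⟩

def vars : List Var :=
  for3 10 (fun a b c => [Var.chi a b c]) ++ (for3 10 (fun a b c => [Var.nn a b c]) ++
    (for4 10 (fun a b c d => [Var.j1 a b c d]) ++ for4 10 (fun a b c d => [Var.j2 a b c d])))

theorem vars_idx : vars.map Var.idx = List.range 660 := by decide +kernel

theorem idx_inj {u v : Var} (hu : u ∈ vars) (hv : v ∈ vars) (h : u.idx = v.idx) : u = v := by
  have hn : (vars.map Var.idx).Nodup := by rw [vars_idx]; exact List.nodup_range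
  exact List.inj_on_of_nodup_map hn hu hv h

theorem chi_mem {a b c : ℕ} (h1 : a < b) (h2 : b < c) (h3 : c < 10) : Var.chi a b c ∈ vars := by
  simp only [vars, List.mem_append, mem_for3, mem_for4, List.mem_singleton]
  exact Or.inl ⟨a, b, c, h1, h2, h3, rfl⟩

theorem nn_mem {a b c : ℕ} (h1 : a < b) (h2 : b < c) (h3 : c < 10) : Var.nn a b c ∈ vars := by
  simp only [vars, List.mem_append, mem_for3, mem_for4, List.mem_singleton]
  exact Or.inr (Or.inl ⟨a, b, c, h1, h2, h3, rfl⟩)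

theorem j1_mem {a b c d : ℕ} (h1 : a < b) (h2 : b < c) (h3 : c < d) (h4 : d < 10) :
    Var.j1 a b c d ∈ vars := by
  simp only [vars, List.mem_append, mem_for3, mem_for4, List.mem_singleton]
  exact Or.inr (Or.inr (Or.inl ⟨a, b, c, d, h1, h2, h3, h4, rfl⟩))

theorem j2_mem {a b c d : ℕ} (h1 : a < b) (h2 : b < c) (h3 : c < d) (h4 : d < 10) :
    Var.j2 a b c d ∈ vars := by
  simp only [vars, List.mem_append, mem_for3, mem_for4, List.mem_singleton]
  exact Or.inr (Or.inr (Or.inr ⟨a, b, c, d, h1, h2, h3, h4, rfl⟩))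

def pos (v : Var) : ℕ := 2 * v.idx + 2
def neg (v : Var) : ℕ := 2 * v.idx + 3

def sigClauses (a b c d : ℕ) : List (List ℕ) :=
  cond (Nat.beq a 0) []
    [[pos (.chi a b c), neg (.chi a b d), pos (.chi a c d)],
     [neg (.chi a b c), pos (.chi a b d), neg (.chi a c d)],
     [pos (.chi a b c), neg (.chi a b d), pos (.chi b c d)],
     [neg (.chi a b c), pos (.chi a b d), neg (.chi b c d)],
     [pos (.chi a b c), neg (.chi a c d), pos (.chi b c d)],
     [neg (.chi a b c), pos (.chi a c d), neg (.chi b c d)],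
     [pos (.chi a b d), neg (.chi a c d), pos (.chi b c d)],
     [neg (.chi a b d), pos (.chi a c d), neg (.chi b c d)]]

def jClauses (a b c d : ℕ) : List (List ℕ) :=
  [[neg (.j1 a b c d), pos (.chi a b c), pos (.chi a b d)],
   [neg (.j1 a b c d), neg (.chi a b c), neg (.chi a b d)],
   [neg (.j2 a b c d), pos (.chi a c d), pos (.chi b c d)],
   [neg (.j2 a b c d), neg (.chi a c d), neg (.chi b c d)]]

def nClause (a b c : ℕ) : List ℕ :=
  neg (.nn a b c) ::
    ((List.range (b - a - 1)).map (fun t => pos (.j1 a (a + 1 + t) b c)) ++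
     (List.range (c - b - 1)).map (fun t => pos (.j2 a b (b + 1 + t) c)))

def hClause (a b c d e : ℕ) : List ℕ :=
  [pos (.nn a b c), pos (.nn a b d), pos (.nn a b e), pos (.nn a c d), pos (.nn a c e),
   pos (.nn a d e), pos (.nn b c d), pos (.nn b c e), pos (.nn b d e), pos (.nn c d e)]

def gen : List (List ℕ) :=
  for4 10 sigClauses ++ (for4 10 jClauses ++
    (for3 10 (fun a b c => [nClause a b c]) ++ for5 10 (fun a b c d e => [hClause a b c d e])))

def zeroLits : List ℕ := for2 10 (fun b c => cond (Nat.beq b 0) [] [neg (.chi 0 b c)])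

/-- Some point lies inside the triangle `a b c`, in terms of orientations `s`. -/
def NE (s : ℕ → ℕ → ℕ → Prop) (a b c : ℕ) : Prop :=
  (∃ p, a < p ∧ p < b ∧ ¬ (s a p b ↔ s a p c)) ∨ (∃ p, b < p ∧ p < c ∧ ¬ (s a p c ↔ s b p c))

def Flat (x y z : Prop) : Prop := (x → z → y) ∧ (y → x ∨ z)

theorem Flat.clA {x y z : Prop} (h : Flat x y z) : x ∨ ¬ y ∨ z := by
  unfold Flat at h; tauto
theorem Flat.clB {x y z : Prop} (h : Flat x y z) : ¬ x ∨ y ∨ ¬ z := by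
  unfold Flat at h; tauto
theorem xorA (x y : Prop) : ¬ ¬ (x ↔ y) ∨ x ∨ y := by tauto
theorem xorB (x y : Prop) : ¬ ¬ (x ↔ y) ∨ ¬ x ∨ ¬ y := by tauto

def sem (s : ℕ → ℕ → ℕ → Prop) : Var → Prop
  | .chi a b c => s a b c
  | .nn a b c => NE s a b c
  | .j1 a b c d => ¬ (s a b c ↔ s a b d)
  | .j2 a b c d => ¬ (s a c d ↔ s b c d)

def val (s : ℕ → ℕ → ℕ → Prop) (i : ℕ) : Prop := ∃ v ∈ vars, v.idx = i ∧ sem s v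

theorem val_idx {s : ℕ → ℕ → ℕ → Prop} {v : Var} (hv : v ∈ vars) : val s v.idx ↔ sem s v := by
  constructor
  · rintro ⟨u, hu, h, hs⟩
    rw [← idx_inj hu hv h]; exact hs
  · intro h; exact ⟨v, hv, rfl, h⟩

theorem pos_true {s : ℕ → ℕ → ℕ → Prop} {v : Var} (hv : v ∈ vars) :
    LitTrue (val s) (pos v) ↔ sem s v := by
  have h1 : (2 * v.idx + 2) % 2 = 0 := by omega
  have h2 : (2 * v.idx + 2) / 2 - 1 = v.idx := by omega
  simp only [LitTrue, pos, h1, h2, if_true, val_idx hv]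
  simp

theorem neg_true {s : ℕ → ℕ → ℕ → Prop} {v : Var} (hv : v ∈ vars) :
    LitTrue (val s) (neg v) ↔ ¬ sem s v := by
  have h1 : (2 * v.idx + 3) % 2 = 1 := by omega
  have h2 : (2 * v.idx + 3) / 2 - 1 = v.idx := by omega
  simp only [LitTrue, neg, h1, h2, val_idx hv]
  simp

theorem satL_nil {V : ℕ → Prop} : SatL V [] ↔ False := by simp [SatL]

theorem satL_cons {V : ℕ → Prop} {l : ℕ} {ls : List ℕ} :
    SatL V (l :: ls) ↔ LitTrue V l ∨ SatL V ls := by simp [SatL]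

theorem gen_sat (s : ℕ → ℕ → ℕ → Prop)
    (hs : ∀ a b c d, 0 < a → a < b → b < c → c < d → d < 10 →
      Flat (s a b c) (s a b d) (s a c d) ∧ Flat (s a b c) (s a b d) (s b c d) ∧
      Flat (s a b c) (s a c d) (s b c d) ∧ Flat (s a b d) (s a c d) (s b c d))
    (hh : ∀ a b c d e, a < b → b < c → c < d → d < e → e < 10 →
      NE s a b c ∨ NE s a b d ∨ NE s a b e ∨ NE s a c d ∨ NE s a c e ∨ NE s a d e ∨
      NE s b c d ∨ NE s b c e ∨ NE s b d e ∨ NE s c d e) :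
    ∀ c ∈ gen, SatL (val s) c := by
  intro x hx
  simp only [gen, List.mem_append, mem_for3, mem_for4, mem_for5, List.mem_singleton] at hx
  rcases hx with ⟨a, b, c, d, h1, h2, h3, h4, hx⟩ | ⟨a, b, c, d, h1, h2, h3, h4, hx⟩ |
    ⟨a, b, c, h1, h2, h3, hx⟩ | ⟨a, b, c, d, e, h1, h2, h3, h4, h5, hx⟩
  · rcases Nat.eq_zero_or_pos a with rfl | ha
    · simp [sigClauses] at hx
    · obtain ⟨f1, f2, f3, f4⟩ := hs a b c d ha h1 h2 h3 h4
      have e0 : Nat.beq a 0 = false := by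
        cases a with
        | zero => omega
        | succ n => rfl
      have m1 : Var.chi a b c ∈ vars := chi_mem (by omega) (by omega) (by omega)
      have m2 : Var.chi a b d ∈ vars := chi_mem (by omega) (by omega) (by omega)
      have m3 : Var.chi a c d ∈ vars := chi_mem (by omega) (by omega) (by omega)
      have m4 : Var.chi b c d ∈ vars := chi_mem (by omega) (by omega) (by omega)
      simp only [sigClauses, e0, cond_false, List.mem_cons, List.not_mem_nil, or_false] at hx
      rcases hx with rfl | rfl | rfl | rfl | rfl | rfl | rfl | rfl <;>
        simp only [satL_cons, satL_nil, pos_true, neg_true, m1, m2, m3, m4, sem, or_false]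
      · exact f1.clA
      · exact f1.clB
      · exact f2.clA
      · exact f2.clB
      · exact f3.clA
      · exact f3.clB
      · exact f4.clA
      · exact f4.clB
  · have m1 : Var.chi a b c ∈ vars := chi_mem (by omega) (by omega) (by omega)
    have m2 : Var.chi a b d ∈ vars := chi_mem (by omega) (by omega) (by omega)
    have m3 : Var.chi a c d ∈ vars := chi_mem (by omega) (by omega) (by omega)
    have m4 : Var.chi b c d ∈ vars := chi_mem (by omega) (by omega) (by omega)
    have m5 := j1_mem h1 h2 h3 h4
    have m6 := j2_mem h1 h2 h3 h4
    simp only [jClauses, List.mem_cons, List.not_mem_nil, or_false] at hx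
    rcases hx with rfl | rfl | rfl | rfl <;>
      simp only [satL_cons, satL_nil, pos_true, neg_true, m1, m2, m3, m4, m5, m6, sem, or_false]
    · exact xorA _ _
    · exact xorB _ _
    · exact xorA _ _
    · exact xorB _ _
  · subst hx
    have m1 := nn_mem h1 h2 h3
    by_cases hN : NE s a b c
    · rcases hN with ⟨p, hp1, hp2, hp⟩ | ⟨p, hp1, hp2, hp⟩
      · refine ⟨pos (.j1 a p b c), ?_, (pos_true (j1_mem hp1 hp2 h2 h3)).2 hp⟩
        simp only [nClause, List.mem_cons, List.mem_append, List.mem_map, List.mem_range]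
        refine Or.inr (Or.inl ⟨p - a - 1, by omega, ?_⟩)
        congr 2; omega
      · refine ⟨pos (.j2 a b p c), ?_, (pos_true (j2_mem h1 hp1 hp2 h3)).2 hp⟩
        simp only [nClause, List.mem_cons, List.mem_append, List.mem_map, List.mem_range]
        refine Or.inr (Or.inr ⟨p - b - 1, by omega, ?_⟩)
        congr 2; omega
    · exact ⟨neg (.nn a b c), by simp [nClause], (neg_true m1).2 hN⟩
  · subst hx
    have := hh a b c d e h1 h2 h3 h4 h5
    unfold hClause
    simp only [satL_cons, satL_nil, or_false]
    rw [pos_true (nn_mem (by omega) (by omega) (by omega)),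
      pos_true (nn_mem (by omega) (by omega) (by omega)),
      pos_true (nn_mem (by omega) (by omega) (by omega)),
      pos_true (nn_mem (by omega) (by omega) (by omega)),
      pos_true (nn_mem (by omega) (by omega) (by omega)),
      pos_true (nn_mem (by omega) (by omega) (by omega)),
      pos_true (nn_mem (by omega) (by omega) (by omega)),
      pos_true (nn_mem (by omega) (by omega) (by omega)),
      pos_true (nn_mem (by omega) (by omega) (by omega)),
      pos_true (nn_mem (by omega) (by omega) (by omega))]
    exact this

theorem zero_unsat (s : ℕ → ℕ → ℕ → Prop)
    (h0 : ∀ b c, 0 < b → b < c → c < 10 → s 0 b c) : ¬ SatL (val s) zeroLits := by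
  rintro ⟨l, hl, ht⟩
  simp only [zeroLits, mem_for2] at hl
  obtain ⟨b, c, h1, h2, hl⟩ := hl
  cases b with
  | zero => simp at hl
  | succ n =>
    have hl : l = neg (.chi 0 (n + 1) c) := List.mem_singleton.1 hl
    subst hl
    exact (neg_true (chi_mem (by omega) h1 h2)).1 ht (h0 _ _ (by omega) h1 h2)

end Hb
/-! ### The refutation: clauses and hints, packed in base 4096 -/

namespace Hb

def tab000000 : Tab :=
  .node 1023639603 (.node 1392836685 (.node 1896251487 (.node 2802458765 (.node 352392077 (.node
  127242179214427473413096300333900034 .leaf .leaf) .leaf) (.node 3138090125 (.node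
  1800454825926675117672322655039068247293180690391724360962261230 .leaf .leaf) .leaf)) (.node
  3708657853 (.node 1896264717 (.node 799897 .leaf .leaf) .leaf) (.node 3977155853 (.node 1879298145
  .leaf .leaf) .leaf))) (.node 2533965949 (.node 3339468989 (.node 1292153805 (.node
  154508077174359309504442041275662600 .leaf .leaf) .leaf) (.node 3641537741 (.node
  126917073942305398936 .leaf .leaf) .leaf)) (.node 3977134273 (.node 2567533645 (.node 17465368688
  .leaf .leaf) .leaf) (.node 5393729005663326759903617 (.node 458165266384065389334693 .leaf .leaf)
  .leaf)))) (.node 1694892121 (.node 2332590199 (.node 3138093231 (.node 956527533 (.node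
  144770460361175599737060524565840118 .leaf .leaf) .leaf) (.node 3440153773 (.node 922855 .leaf
  .leaf) .leaf)) (.node 3775774929 (.node 2366141485 (.node 37563048634174026662748513321290 .leaf
  .leaf) .leaf) (.node 8189272321 (.node 7806154241605016249644264355225569304776663260 .leaf .leaf)
  .leaf))) (.node 2701779063 (.node 3540828355 (.node 1694880749 (.node 439287 .leaf .leaf) .leaf)
  (.node 3775771885 (.node 1879457812 .leaf .leaf) .leaf)) (.node 4010721491 (.node 2802439277
  (.node 28139973911182318920393506286278722046721071915058 .leaf .leaf) .leaf) (.node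
  100624842722293024770629465516564730 (.node 299 .leaf .leaf) .leaf))))
def tab000001 : Tab :=
  .node 1157898293 (.node 1627775053 (.node 2097651831 (.node 2836013207 (.node 654463901 (.node
  132435110169269594408972551195951386 .leaf .leaf) .leaf) (.node 3305895069 (.node 16076448033
  .leaf .leaf) .leaf)) (.node 3742220487 (.node 2198336541 (.node 735 .leaf .leaf) .leaf) (.node
  4044240157 (.node 7697571385425 .leaf .leaf) .leaf))) (.node 2601066633 (.node 3507265721 (.node
  1527083997 (.node 155806468804679000576171541750292808 .leaf .leaf) .leaf) (.node 3742192861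
  (.node 557978812353328842986185261855245580235641468176246055078 .leaf .leaf) .leaf)) (.node
  4010688715 (.node 2701784157 (.node 2656170224 .leaf .leaf) .leaf) (.node 89631373795777 (.node
  135322 .leaf .leaf) .leaf)))) (.node 1829150803 (.node 2399707267 (.node 3305898163 (.node
  1124340669 (.node 149963866723687881891282228234944782 .leaf .leaf) .leaf) (.node 3507287229
  (.node 29480035138227367318319363801386 .leaf .leaf) .leaf)) (.node 3910033589 (.node 2500400189
  (.node 513 .leaf .leaf) .leaf) (.node 287173212299780417 (.node 1669555873405811004610570084366
  .leaf .leaf) .leaf))) (.node 2768896131 (.node 3675087027 (.node 1829147645 (.node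
  27895084795614498369205005623574 .leaf .leaf) .leaf) (.node 3910038781 (.node 671170568 .leaf
  .leaf) .leaf)) (.node 4044267741 (.node 2836018301 (.node 1174864026 .leaf .leaf) .leaf) (.node
  114257950332626788073107866466238728 (.node 106 .leaf .leaf) .leaf))))
def tab000010 : Tab :=
  .node 1124335663 (.node 1527078993 (.node 1896267875 (.node 2835996819 (.node 553767829 (.node
  131137035606380248851067284653048058 .leaf .leaf) .leaf) (.node 3171660949 (.node
  7584243793452972316052353177 .leaf .leaf) .leaf)) (.node 3742204099 (.node 2064094229 (.node
  10135871831 .leaf .leaf) .leaf) (.node 4010702101 (.node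
  25394886058264543070386887788693139673481324167224 .leaf .leaf) .leaf))) (.node 2567520387 (.node
  3473711283 (.node 1459966933 (.node 155157431465191719049017371429110056 .leaf .leaf) .leaf)
  (.node 3708638421 (.node 408314763617201443066151135 .leaf .leaf) .leaf)) (.node 3977150661 (.node
  2601088085 (.node 110423005329014793652049005207253093 .leaf .leaf) .leaf) (.node
  24609868175408888904701313441 (.node 135335 .leaf .leaf) .leaf)))) (.node 1795588173 (.node
  2366152829 (.node 3171655861 (.node 1023644597 (.node 146068851836715006964002183946871062 .leaf
  .leaf) .leaf) (.node 3473724597 (.node 1284795044784790750445834 .leaf .leaf) .leaf)) (.node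
  3876470959 (.node 2399704117 (.node 947445 .leaf .leaf) .leaf) (.node 269718044972949793 (.node
  333 .leaf .leaf) .leaf))) (.node 2735341693 (.node 3540844743 (.node 1762030581 (.node 669 .leaf
  .leaf) .leaf) (.node 3876467957 (.node 148905992138301075761305465421386281197 .leaf .leaf)
  .leaf)) (.node 4044251353 (.node 2802472053 (.node 330623319301453437239361 .leaf .leaf) .leaf)
  (.node 110362935252225782004672404323860732 (.node 619 .leaf .leaf) .leaf))))
def tab000011 : Tab :=
  .node 1191452731 (.node 1661337683 (.node 2231894139 (.node 2836029595 (.node 788714405 (.node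
  138278504608520430551576629220450546 .leaf .leaf) .leaf) (.node 3339457701 (.node 78731 .leaf
  .leaf) .leaf)) (.node 3775758541 (.node 2231907365 (.node 825 .leaf .leaf) .leaf) (.node
  4044272933 (.node 1879179284 .leaf .leaf) .leaf))) (.node 2601083021 (.node 3507282109 (.node
  1627780069 (.node 955641 .leaf .leaf) .leaf) (.node 3742225637 (.node
  218230064663167651808314471022602740731986 .leaf .leaf) .leaf)) (.node 4010705103 (.node
  2768884837 (.node 7698427580525 .leaf .leaf) .leaf) (.node 481 (.node
  1836264121072602136559884858755844778217613941347877938078562376452162009432467450921091444880670775763354870536727504476211486766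
  .leaf .leaf) .leaf)))) (.node 1862705241 (.node 2500403319 (.node 3339452601 (.node 1191441349
  (.node 150613221014520286823045365176254766 .leaf .leaf) .leaf) (.node 3540841669 (.node
  31857266671691159710001588961600 .leaf .leaf) .leaf)) (.node 3943588027 (.node 2533971013 (.node
  579 .leaf .leaf) .leaf) (.node 353 (.node 155862352018088380645472 .leaf .leaf) .leaf))) (.node
  2802442377 (.node 3708641465 (.node 1862710277 (.node 767117 .leaf .leaf) .leaf) (.node 3943601413
  (.node 48322654690348220383616731842570286410060711178960276928329072688275482 .leaf .leaf)
  .leaf)) (.node 4044284129 (.node 3003847813 (.node 4812242690089 .leaf .leaf) .leaf) (.node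
  123347005677701436510142641789239542 .leaf .leaf))))
def tab000100 : Tab :=
  .node 1023647797 (.node 1493524557 (.node 1896259681 (.node 2802466959 (.node 453088145 (.node
  127891374971544707894353416898634002 .leaf .leaf) .leaf) (.node 3171644561 (.node
  13893009080197894562723652864326569180564007805036 .leaf .leaf) .leaf)) (.node 3742195905 (.node
  1896281105 (.node 757 .leaf .leaf) .leaf) (.node 4010685713 (.node 1879732435 .leaf .leaf)
  .leaf))) (.node 2567512193 (.node 3440156847 (.node 1392833489 (.node
  154508394164399515402278451300221208 .leaf .leaf) .leaf) (.node 3675092177 (.node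
  4674868104154583593771945287791 .leaf .leaf) .leaf)) (.node 3977142467 (.node 2601071697 (.node
  16891247734247515 .leaf .leaf) .leaf) (.node 204400048118423953 (.node 9290120125636751 .leaf
  .leaf) .leaf)))) (.node 1694900315 (.node 2366144635 (.node 3171647667 (.node 990090161 (.node
  146068376351654703883262810559455494 .leaf .leaf) .leaf) (.node 3473708209 (.node
  32014910608004425397968565477778 .leaf .leaf) .leaf)) (.node 3775783123 (.node 2366157873 (.node
  537629 .leaf .leaf) .leaf) (.node 3809553 (.node 7697118662795 .leaf .leaf) .leaf))) (.node
  2735333499 (.node 3540836549 (.node 1694897137 (.node 25993144554314554504910308868346 .leaf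
  .leaf) .leaf) (.node 3775788273 (.node 1373438961899817389164961945 .leaf .leaf) .leaf)) (.node
  4044243159 (.node 2802455665 (.node 609932249080653098527268802409112832966754 .leaf .leaf) .leaf)
  (.node 107116957279179410628072857712697588 (.node 621 .leaf .leaf) .leaf))))
def tab000101 : Tab :=
  .node 1191444537 (.node 1661329489 (.node 2198339703 (.node 2836021401 (.node 688018337 (.node
  132435585654329897489711924583366954 .leaf .leaf) .leaf) (.node 3305911457 (.node 275387 .leaf
  .leaf) .leaf)) (.node 3775750347 (.node 2231890977 (.node 660571 .leaf .leaf) .leaf) (.node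
  4044256545 (.node 2166546288270208621106307080 .leaf .leaf) .leaf))) (.node 2601074827 (.node
  3507273915 (.node 1594217441 (.node 155806785794719197248383565350576472 .leaf .leaf) .leaf)
  (.node 3742209249 (.node 5625605987950844434915009142993 .leaf .leaf) .leaf)) (.node 4010696909
  (.node 2735338593 (.node 31254996452786329 .leaf .leaf) .leaf) (.node 5407185 (.node
  2899205968255137302047097978301968670904090862 .leaf .leaf) .leaf)))) (.node 1862697047 (.node
  2399715461 (.node 3305906357 (.node 1157895105 (.node 150612745529459990661524281607045406 .leaf
  .leaf) .leaf) (.node 3540825281 (.node 4227405 .leaf .leaf) .leaf)) (.node 3943579833 (.node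
  2533954625 (.node 1417053597680167963181308 .leaf .leaf) .leaf) (.node 71203245285713 (.node
  3347235662855910781698725364041339857422172270 .leaf .leaf) .leaf))) (.node 2768904325 (.node
  3675095221 (.node 1862693889 (.node 267193 .leaf .leaf) .leaf) (.node 3943585025 (.node
  387007388395074608444231805 .leaf .leaf) .leaf)) (.node 4044275935 (.node 2836034689 (.node
  7380859684163247932299025609354700597996361792550552648834891489294 .leaf .leaf) .leaf) (.node
  114258267322666993970944276490797336 (.node 346 .leaf .leaf) .leaf))))
def tab000110 : Tab :=
  .node 1157890099 (.node 1527087187 (.node 1896276069 (.node 2836005013 (.node 620901273 (.node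
  131786231363497487945136594429919498 .leaf .leaf) .leaf) (.node 3272340633 (.node 1191637105 .leaf
  .leaf) .leaf)) (.node 3742212293 (.node 2097656857 (.node 767 .leaf .leaf) .leaf) (.node
  4010718489 (.node 7699383427139 .leaf .leaf) .leaf))) (.node 2567528581 (.node 3473719477 (.node
  1493529561 (.node 155805993319618697495432168362877240 .leaf .leaf) .leaf) (.node 3708654809
  (.node 247415544277345218584375018459418701027837883938524778515934208798349500540 .leaf .leaf)
  .leaf)) (.node 3977158855 (.node 2668221529 (.node
  395195913451859272595947521082742153661868634839261283 .leaf .leaf) .leaf) (.node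
  6083844912457204192207281 (.node 448149649496870305664873584960076337405960244 .leaf .leaf)
  .leaf)))) (.node 1829142609 (.node 2399699073 (.node 3272343727 (.node 1090778041 (.node
  149314670966570645103619015064142078 .leaf .leaf) .leaf) (.node 3507270841 (.node 64337439547677
  .leaf .leaf) .leaf)) (.node 3910025395 (.node 2399720505 (.node 24249583200841263566255780045054
  .leaf .leaf) .leaf) (.node 37529896190257 (.node 963 .leaf .leaf) .leaf))) (.node 2768887937
  (.node 3641532591 (.node 1795593209 (.node 455681 .leaf .leaf) .leaf) (.node 3910022393 (.node
  445686519873809902155792893041016394318908881749310287437854 .leaf .leaf) .leaf)) (.node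
  4044259547 (.node 2836001913 (.node 9049911905647802757815340842962275055501493731425 .leaf .leaf)
  .leaf) (.node 112959875847127586744002617109766392 (.node 372750 .leaf .leaf) .leaf))))
def tab000111 : Tab :=
  .node 1191460925 (.node 1694883927 (.node 2231902333 (.node 3037405359 (.node 889394089 (.node
  142173361271253697814827348417077498 .leaf .leaf) .leaf) (.node 3339474089 (.node
  22982706454827031008982424936796 .leaf .leaf) .leaf)) (.node 3775766735 (.node 2332587049 (.node
  31064985159772331813156788011296 .leaf .leaf) .leaf) (.node 4044289321 (.node
  238578915532499869487869791580594451931920546995913803809004 .leaf .leaf) .leaf))) (.node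
  2601091215 (.node 3540820161 (.node 1661334505 (.node 37721543654268903159615337234766 .leaf
  .leaf) .leaf) (.node 3775755497 (.node 1373868752604349545971577072 .leaf .leaf) .leaf)) (.node
  4010713297 (.node 2768901225 (.node 2818522239009 .leaf .leaf) .leaf) (.node
  96729986059559757507378746319937778 (.node 472415387713302260072652 .leaf .leaf) .leaf)))) (.node
  1862713435 (.node 2533957755 (.node 3339460795 (.node 1191457737 (.node
  153210002688860108175336791919190264 .leaf .leaf) .leaf) (.node 3607975113 (.node
  7584291111772180756639252940 .leaf .leaf) .leaf)) (.node 3943596221 (.node 2567517257 (.node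
  1879503003 .leaf .leaf) .leaf) (.node 1298498184714648002929 (.node
  472156053289462575609662231312237192224319229885746503887 .leaf .leaf) .leaf))) (.node 2802450571
  (.node 3708649659 (.node 1896248329 (.node 849073 .leaf .leaf) .leaf) (.node 3977139465 (.node
  4880110346351 .leaf .leaf) .leaf)) (.node 251712393 (.node 3037410441 (.node 286787 .leaf .leaf)
  .leaf) (.node 125943787816278210414954658206425330 .leaf .leaf))))
def tab001000 : Tab :=
  .node 1023623189 (.node 1493483535 (.node 1896218691 (.node 2802376805 (.node 352400271 (.node
  127891057981504511222141393432600842 .leaf .leaf) .leaf) (.node 3138098319 (.node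
  19707303154585632 .leaf .leaf) .leaf)) (.node 3742105695 (.node 1896272911 (.node 745 .leaf .leaf)
  .leaf) (.node 3977164047 (.node 1879298203 .leaf .leaf) .leaf))) (.node 2567438393 (.node
  3440042031 (.node 1359279055 (.node 154508235669379413606563294590976272 .leaf .leaf) .leaf)
  (.node 3675083983 (.node 2167179176439441281918578782 .leaf .leaf) .leaf)) (.node 3976994955
  (.node 2601063503 (.node 366646213181392945263 .leaf .leaf) .leaf) (.node 19296625033 (.node
  26549086783406442074891698717415868163845985032701114693332592156761 .leaf .leaf) .leaf)))) (.node
  1694867497 (.node 2366087199 (.node 3171622931 (.node 990081967 (.node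
  145419497584577668380623814066823422 .leaf .leaf) .leaf) (.node 3440161967 (.node
  37880270986379840195747420832182 .leaf .leaf) .leaf)) (.node 3775733873 (.node 2366149679 (.node
  675 .leaf .leaf) .leaf) (.node 63374727495945 (.node
  1933453224117206751876000135301973708135878317070836341416133 .leaf .leaf) .leaf))) (.node
  2735186001 (.node 3540795461 (.node 1694888943 (.node 980241 .leaf .leaf) .leaf) (.node 3775780079
  (.node 7698259656872 .leaf .leaf) .leaf)) (.node 4044185759 (.node 2802447471 (.node
  3770393971682596388238764274674924177472381079 .leaf .leaf) .leaf) (.node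
  100625159712333226055653682194735362 (.node 6942328467497 .leaf .leaf) .leaf))))
def tab001001 : Tab :=
  .node 1191411749 (.node 1661272095 (.node 2198298639 (.node 2835972207 (.node 688010143 (.node
  132435427159309795693996767874122018 .leaf .leaf) .leaf) (.node 3305903263 (.node 77259050525039
  .leaf .leaf) .leaf)) (.node 3775701097 (.node 2198344735 (.node 737 .leaf .leaf) .leaf) (.node
  4044248351 (.node 1879179362 .leaf .leaf) .leaf))) (.node 2601033795 (.node 3507200059 (.node
  1527092191 (.node 155806627299699100065480601853469008 .leaf .leaf) .leaf) (.node 3742201055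
  (.node 21931583258320052349782981768281136594315409981676 .leaf .leaf) .leaf)) (.node 4010590357
  (.node 2735330399 (.node 17701310240723481588191870851037980441288331665592426986323705979120
  .leaf .leaf) .leaf) (.node 1512868946988154151369 (.node 543 .leaf .leaf) .leaf)))) (.node
  1862623289 (.node 2399682601 (.node 3305848865 (.node 1157886911 (.node
  149964025218707983686997384944189718 .leaf .leaf) .leaf) (.node 3540817087 (.node 160667 .leaf
  .leaf) .leaf)) (.node 3943399553 (.node 2500408383 (.node 37880038674368392468675473973592 .leaf
  .leaf) .leaf) (.node 70660535853385 (.node 1926920324369809929355447307703582220146573754493 .leaf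
  .leaf) .leaf))) (.node 2768781403 (.node 3674947667 (.node 1829155839 (.node
  31223480217747595572414287864082 .leaf .leaf) .leaf) (.node 3943576831 (.node
  847602651147135212185764710803733636610244704 .leaf .leaf) .leaf)) (.node 4044218535 (.node
  2836026495 (.node 19710946058604627 .leaf .leaf) .leaf) (.node
  114258108827646892175229119781552400 (.node 951 .leaf .leaf) .leaf))))
def tab001010 : Tab :=
  .node 1157832735 (.node 1527062549 (.node 1896235079 (.node 2835955819 (.node 553776023 (.node
  131137352596420450136091501331218690 .leaf .leaf) .leaf) (.node 3238786199 (.node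
  6115828680034139427685504664348201341938109818267804272185756221493 .leaf .leaf) .leaf)) (.node
  3742122083 (.node 2097648663 (.node 26944114684446151199621074960640 .leaf .leaf) .leaf) (.node
  4010710295 (.node 8876784725345995806770006044834 .leaf .leaf) .leaf))) (.node 2567454781 (.node
  3473621045 (.node 1493521367 (.node 155157589960211818538326431532286256 .leaf .leaf) .leaf)
  (.node 3708646615 (.node 217900380410178826324888684067428912390384 .leaf .leaf) .leaf)) (.node
  3977011343 (.node 2601096279 (.node 31081442824442234631585782967042714864679487357068 .leaf
  .leaf) .leaf) (.node 6046056754999272340890025 (.node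
  146698595190621265033884034989932181424958236029034627 .leaf .leaf) .leaf)))) (.node 1829044275
  (.node 2399666213 (.node 3272269851 (.node 1023652791 (.node 148665633743168576460055725563158774
  .leaf .leaf) .leaf) (.node 3507262647 (.node 840877 .leaf .leaf) .leaf)) (.node 3909820539 (.node
  2399712311 (.node 811 .leaf .leaf) .leaf) (.node 66391875043625 (.node 69 .leaf .leaf) .leaf)))
  (.node 2768765015 (.node 3641368653 (.node 1795585015 (.node 504853 .leaf .leaf) .leaf) (.node
  3876476151 (.node 529020355122972049072316 .leaf .leaf) .leaf)) (.node 4044202147 (.node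
  2835993719 (.node 194456719338680745598052844626026886246864167474069920198225873322112213048
  .leaf .leaf) .leaf) (.node 110363093747245886106793657639174404 (.node 1009 .leaf .leaf) .leaf))))
def tab001011 : Tab :=
  .node 1191428137 (.node 1694851109 (.node 2231877653 (.node 3037388809 (.node 855839655 (.node
  140875286863144636101709922967773426 .leaf .leaf) .leaf) (.node 3339465895 (.node 447483 .leaf
  .leaf) .leaf)) (.node 3775717485 (.node 2299032615 (.node 3793165 .leaf .leaf) .leaf) (.node
  4044281127 (.node 31977039134088186955956014093851048846041789579415 .leaf .leaf) .leaf))) (.node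
  2601050183 (.node 3540779073 (.node 1661326311 (.node 573 .leaf .leaf) .leaf) (.node 3775747303
  (.node 5627366925535643629834125857008 .leaf .leaf) .leaf)) (.node 4010606745 (.node 2768893031
  (.node 409515168554529789948777032297116885159 .leaf .leaf) .leaf) (.node
  90887067220991647720183059704684788 (.node 130977769648553965810257249209006222622204117621448794
  .leaf .leaf) .leaf)))) (.node 1862639677 (.node 2533859379 (.node 3339427879 (.node 1191449543
  (.node 150613221014520296048669751734780214 .leaf .leaf) .leaf) (.node 3540849863 (.node
  30114015114700971689582660075786 .leaf .leaf) .leaf)) (.node 3943415941 (.node 2567509063 (.node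
  835 .leaf .leaf) .leaf) (.node 5280860407133128997929321 (.node 1667002844075599523826304172255
  .leaf .leaf) .leaf))) (.node 2802360417 (.node 3708526681 (.node 1862718471 (.node 483 .leaf
  .leaf) .leaf) (.node 3977131271 (.node 536485774889739872784056726828449675581196134904877367461
  .leaf .leaf) .leaf)) (.node 151024519 (.node 3037402247 (.node 286832 .leaf .leaf) .leaf) (.node
  123996042901103505153705931290222846 .leaf .leaf))))
def tab001100 : Tab :=
  .node 1124261915 (.node 1527054355 (.node 1896226885 (.node 2835947625 (.node 520213395 (.node
  129838961198271187137949859203743986 .leaf .leaf) .leaf) (.node 3171652755 (.node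
  13887434394805920322872704910169714602114565095578 .leaf .leaf) .leaf)) (.node 3742113889 (.node
  1996968979 (.node 775 .leaf .leaf) .leaf) (.node 4010693907 (.node 1879732293 .leaf .leaf)
  .leaf))) (.node 2567446587 (.node 3473612851 (.node 1392841683 (.node
  155157272970171617253302214719865120 .leaf .leaf) .leaf) (.node 3675100371 (.node
  229747073418627682255548184574097963245325078008892155397487972560371896552 .leaf .leaf) .leaf))
  (.node 3977003149 (.node 2601079891 (.node 16909115620515860 .leaf .leaf) .leaf) (.node 409 (.node
  135189 .leaf .leaf) .leaf)))) (.node 1795473455 (.node 2366095393 (.node 3171631125 (.node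
  1023636403 (.node 146068693341694905168287027237626126 .leaf .leaf) .leaf) (.node 3473716403
  (.node 488467 .leaf .leaf) .leaf)) (.node 3876249719 (.node 2399695923 (.node 286610124873834815
  .leaf .leaf) .leaf) (.node 281 (.node 112 .leaf .leaf) .leaf))) (.node 2735194195 (.node
  3540803655 (.node 1694905331 (.node 705 .leaf .leaf) .leaf) (.node 3842913523 (.node
  529020355122972049785019 .leaf .leaf) .leaf)) (.node 4044193953 (.node 2802463859 (.node
  41165756596297161196361952326464955462114056611340348 .leaf .leaf) .leaf) (.node
  109713739533803616178206151460020468 (.node 1057 .leaf .leaf) .leaf))))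
def tab001101 : Tab :=
  .node 1191419943 (.node 1661280289 (.node 2231869459 (.node 2835980401 (.node 688026531 (.node
  132435744149349996979020984686543154 .leaf .leaf) .leaf) (.node 3339449507 (.node 963839 .leaf
  .leaf) .leaf)) (.node 3775709291 (.node 2231899171 (.node 561 .leaf .leaf) .leaf) (.node
  4044264739 (.node 36353928330728016032844690513969293 .leaf .leaf) .leaf))) (.node 2601041989
  (.node 3507208253 (.node 1627771875 (.node 155806785794719206474007951909101920 .leaf .leaf)
  .leaf) (.node 3742217443 (.node
  184657162498211070739152920765085170158049660977682009686433901334169383590031822731654707794173562841186544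
  .leaf .leaf) .leaf)) (.node 4010598551 (.node 2735346787 (.node 335712275 .leaf .leaf) .leaf)
  (.node 251699254391079385 (.node 456793034643401567911212442584326681762372591559273758928 .leaf
  .leaf) .leaf)))) (.node 1862631483 (.node 2500288559 (.node 3339419685 (.node 1157903299 (.node
  150613062519500187333736305073078566 .leaf .leaf) .leaf) (.node 3540833475 (.node 168863 .leaf
  .leaf) .leaf)) (.node 3943407747 (.node 2533962819 (.node 397 .leaf .leaf) .leaf) (.node
  172867289772015961 (.node 38052330936841420952 .leaf .leaf) .leaf))) (.node 2802352223 (.node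
  3708518487 (.node 1862702083 (.node 705 .leaf .leaf) .leaf) (.node 3943593219 (.node
  8874734884174646888373965734055 .leaf .leaf) .leaf)) (.node 4044226729 (.node 2936722563 (.node
  5548137964762680042815733493913 .leaf .leaf) .leaf) (.node 120750223423077230960009348041916662
  .leaf .leaf))))
def tab001110 : Tab :=
  .node 1157840929 (.node 1627701275 (.node 2097635337 (.node 2835964013 (.node 654455707 (.node
  131786548353537684617348617895952658 .leaf .leaf) .leaf) (.node 3272348827 (.node 136085 .leaf
  .leaf) .leaf)) (.node 3742130277 (.node 2164782107 (.node 625 .leaf .leaf) .leaf) (.node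
  4010726683 (.node 1879290096 .leaf .leaf) .leaf))) (.node 2601025601 (.node 3507191865 (.node
  1527075803 (.node 155806310309658898780456385041047872 .leaf .leaf) .leaf) (.node 3708663003
  (.node 773321045191062670651146793367717876097095 .leaf .leaf) .leaf)) (.node 4010582163 (.node
  2701775963 (.node 2197155825895192397933464288002451038203898525713898346479721 .leaf .leaf)
  .leaf) (.node 25074208558739436705550459321 (.node 332581053597779637847397460467027376783493
  .leaf .leaf) .leaf)))) (.node 1829052469 (.node 2399674407 (.node 3305840671 (.node 1124332475
  (.node 149963549733647680606258011556774150 .leaf .leaf) .leaf) (.node 3507279035 (.node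
  359809977747644839 .leaf .leaf) .leaf)) (.node 3909828733 (.node 2466845755 (.node
  1454834839327058722701584 .leaf .leaf) .leaf) (.node 1167035853200458301753 (.node
  43871350636494970693157687525216821344 .leaf .leaf) .leaf))) (.node 2768773209 (.node 3674939473
  (.node 1829139451 (.node 290522317839393101 .leaf .leaf) .leaf) (.node 3910030587 (.node
  7698259361830 .leaf .leaf) .leaf)) (.node 4044210341 (.node 2836010107 (.node 19710947535114307
  .leaf .leaf) .leaf) (.node 113609071565549750264062773367537920 (.node 164 .leaf .leaf) .leaf))))
def tab001111 : Tab :=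
  .node 1392820233 (.node 1694859303 (.node 2332516379 (.node 3138052111 (.node 889402283 (.node
  142173678261293899099851565095248130 .leaf .leaf) .leaf) (.node 3406599339 (.node 668767 .leaf
  .leaf) .leaf)) (.node 3775725679 (.node 2332595243 (.node 209831 .leaf .leaf) .leaf) (.node 249
  (.node 31527398042427530 .leaf .leaf) .leaf))) (.node 2701615181 (.node 3540787267 (.node
  1661342699 (.node 545825 .leaf .leaf) .leaf) (.node 3775763691 (.node 4880760967189 .leaf .leaf)
  .leaf)) (.node 4010614939 (.node 2768909419 (.node 687902753 .leaf .leaf) .leaf) (.node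
  99326768314183963057512040067260658 (.node 21 .leaf .leaf) .leaf)))) (.node 1896210497 (.node
  2533867573 (.node 3339436073 (.node 1191465931 (.node 153859198407282271695396948176961792 .leaf
  .leaf) .leaf) (.node 3641529547 (.node 304972836889067257627462829917886922006586 .leaf .leaf)
  .leaf)) (.node 3976986761 (.node 2567525451 (.node 17465372785 .leaf .leaf) .leaf) (.node
  1307723779689337610617 (.node 469219639867938660798009266699708520076779658 .leaf .leaf) .leaf)))
  (.node 2802368611 (.node 3708534875 (.node 1896256523 (.node 62345 .leaf .leaf) .leaf) (.node
  3977147659 (.node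
  2994209806697162072996086815228853053341924615072377591140863409957332447713042597 .leaf .leaf)
  .leaf)) (.node 318837643 (.node 3104535691 (.node 31486778841249704726754251730596081 .leaf .leaf)
  .leaf) (.node 127241862224387272128072083655729402 .leaf .leaf))))
def tab010000 : Tab :=
  .node 990068757 (.node 1459929103 (.node 1795555395 (.node 2768822373 (.node 251695595 (.node
  127890899486484409426426236790481158 .leaf .leaf) .leaf) (.node 2936074987 (.node
  8960636330426843788623402098927 .leaf .leaf) .leaf)) (.node 3607887967 (.node 1661227627 (.node
  817 .leaf .leaf) .leaf) (.node 3339252587 (.node 31529396091855014 .leaf .leaf) .leaf))) (.node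
  2466775097 (.node 3406487599 (.node 1224757803 (.node 154508235669379408993751101311713548 .leaf
  .leaf) .leaf) (.node 2969891627 (.node 1141561285962775072233640089 .leaf .leaf) .leaf)) (.node
  3876331659 (.node 2265182891 (.node 4093718569 .leaf .leaf) .leaf) (.node 322617476249158021
  (.node 155862352013754910662796 .leaf .leaf) .leaf)))) (.node 1661313065 (.node 2298978335 (.node
  3104514067 (.node 755028491 (.node 145419339089557566584908657424703738 .leaf .leaf) .leaf) (.node
  2936206091 (.node 906453 .leaf .leaf) .leaf)) (.node 3742179441 (.node 2063725195 (.node 787 .leaf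
  .leaf) .leaf) (.node 261 (.node 2498223809566435130894283043438586096737689688 .leaf .leaf)
  .leaf))) (.node 2668077137 (.node 3473686597 (.node 1459769931 (.node 539 .leaf .leaf) .leaf)
  (.node 3506893643 (.node 5625607192390639183996554231877 .leaf .leaf) .leaf)) (.node 3842859167
  (.node 2298868427 (.node 1354526098676431332544176294 .leaf .leaf) .leaf) (.node
  100625001217313126566344622158684414 (.node 532580 .leaf .leaf) .leaf))))
def tab010001 : Tab :=
  .node 1090748453 (.node 1594163231 (.node 2164744207 (.node 2768863343 (.node 486609403 (.node
  132435268664289696204687707838071070 .leaf .leaf) .leaf) (.node 3003249403 (.node 857271 .leaf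
  .leaf) .leaf)) (.node 3607928937 (.node 1996550779 (.node 775 .leaf .leaf) .leaf) (.node
  3607753595 (.node 1879289889 .leaf .leaf) .leaf))) (.node 2500370499 (.node 3440091195 (.node
  1392595515 (.node 155806627299699095452668408574206284 .leaf .leaf) .leaf) (.node 3238392635
  (.node 19022386041412665846262201696494 .leaf .leaf) .leaf)) (.node 3876372629 (.node 2030367419
  (.node 2147524622619741786077004017 .leaf .leaf) .leaf) (.node 25304338956778731705698763205
  (.node 33 .leaf .leaf) .leaf)))) (.node 1761959993 (.node 2366128169 (.node 3272294433 (.node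
  822202907 (.node 149964025218707979074185191664926994 .leaf .leaf) .leaf) (.node 3204707099 (.node
  635983 .leaf .leaf) .leaf)) (.node 3842736257 (.node 1996681883 (.node
  9093276023914055704046354746 .leaf .leaf) .leaf) (.node 1180874260498683724101 (.node
  638412175405846061029761082 .leaf .leaf) .leaf))) (.node 2735226971 (.node 3641393235 (.node
  1392726619 (.node 643 .leaf .leaf) .leaf) (.node 3070751579 (.node 7697605017698 .leaf .leaf)
  .leaf)) (.node 3977109671 (.node 2567369435 (.node 4812242587747 .leaf .leaf) .leaf) (.node
  114258108827646887562416926502289676 (.node 1031 .leaf .leaf) .leaf))))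
def tab010010 : Tab :=
  .node 1090723871 (.node 1493508117 (.node 1862680647 (.node 2701738091 (.node 453022195 (.node
  131137194101400350646782441295167742 .leaf .leaf) .leaf) (.node 2868998899 (.node
  28862745917541908328215234262637809452410805635904235788424007950848250176689533309067652 .leaf
  .leaf) .leaf)) (.node 3675013219 (.node 1962963571 (.node 37880038674375311686965392867678 .leaf
  .leaf) .leaf) (.node 3473503091 (.node 529097600301861513064475 .leaf .leaf) .leaf))) (.node
  2533900349 (.node 3440066613 (.node 1258345011 (.node 155157431465191723661829564708372780 .leaf
  .leaf) .leaf) (.node 3104142131 (.node 406477772338691356360106083 .leaf .leaf) .leaf)) (.node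
  3943456911 (.node 2399433395 (.node
  17698229791328723611404846503129235509637211432711698298309522817184 .leaf .leaf) .leaf) (.node
  1471475262757716705701 (.node 554283159 .leaf .leaf) .leaf)))) (.node 1761935411 (.node 2299002917
  (.node 3238715419 (.node 889278995 (.node 148016438063441481594786432972718322 .leaf .leaf) .leaf)
  (.node 3070456595 (.node 357333 .leaf .leaf) .leaf)) (.node 3842711675 (.node 2197975699 (.node
  749 .leaf .leaf) .leaf) (.node 16143573285 (.node 479 .leaf .leaf) .leaf))) (.node 2668101719
  (.node 3607814221 (.node 1258476115 (.node 675 .leaf .leaf) .leaf) (.node 2936501075 (.node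
  2498227993798579021079786235351474088286077091 .leaf .leaf) .leaf)) (.node 3909984419 (.node
  2433118931 (.node 330694795087882483937288 .leaf .leaf) .leaf) (.node
  110363093747245881493981464359911680 (.node 1003 .leaf .leaf) .leaf))))
def tab010011 : Tab :=
  .node 1157873705 (.node 1594187813 (.node 2198323221 (.node 3003834377 (.node 721441283 (.node
  138927700288247525416845921810890998 .leaf .leaf) .leaf) (.node 3137499907 (.node
  34551875620818248646808414388642 .leaf .leaf) .leaf)) (.node 3675054189 (.node 1929474691 (.node
  723 .leaf .leaf) .leaf) (.node 3742004099 (.node 7698444251301 .leaf .leaf) .leaf))) (.node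
  2567495751 (.node 3406561345 (.node 1325519427 (.node 972039 .leaf .leaf) .leaf) (.node 3372643139
  (.node 70762164212841696875530511509815317 .leaf .leaf) .leaf)) (.node 3943497881 (.node
  2164617923 (.node 47280761412146753566 .leaf .leaf) .leaf) (.node
  88290443345330665281071671900324082 (.node 23611115691363154654989041467439 .leaf .leaf) .leaf))))
  (.node 1829085245 (.node 2466750515 (.node 3272319015 (.node 956453411 (.node
  150613221014520291435857558455517490 .leaf .leaf) .leaf) (.node 3338957603 (.node
  6577869666349872905482207554 .leaf .leaf) .leaf)) (.node 3909861509 (.node 2130932387 (.node 655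
  .leaf .leaf) .leaf) (.node 5261966328389464251359589 (.node
  469829748902043073742653085023434712631500888 .leaf .leaf) .leaf))) (.node 2701697121 (.node
  3641417817 (.node 1526977123 (.node 557 .leaf .leaf) .leaf) (.node 3205002083 (.node
  26856454499832445914591795096270731086226447802387 .leaf .leaf) .leaf)) (.node 83898851 (.node
  2902487779 (.node 2410980367139793546421164641234745425082266394877434750500932 .leaf .leaf)
  .leaf) (.node 123995884406083403357990774648103162 .leaf .leaf))))
def tab010100 : Tab :=
  .node 1090707483 (.node 1459945491 (.node 1829118021 (.node 2668175465 (.node 385896943 (.node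
  127891374971544712507165610177896726 .leaf .leaf) .leaf) (.node 3003200239 (.node
  472364639746768789381218 .leaf .leaf) .leaf)) (.node 3641450593 (.node 1929392751 (.node 497 .leaf
  .leaf) .leaf) (.node 3406377839 (.node 7699383345184 .leaf .leaf) .leaf))) (.node 2500337723
  (.node 3406503987 (.node 1291883055 (.node 155157114475151517763993154683814172 .leaf .leaf)
  .leaf) (.node 3037016879 (.node 1918958904854039558399092662851576565824902054013 .leaf .leaf)
  .leaf)) (.node 3909894285 (.node 2332308143 (.node 110360082653087636627287197233832035 .leaf
  .leaf) .leaf) (.node 12250317205 (.node 553734310 .leaf .leaf) .leaf)))) (.node 1761919023 (.node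
  2332540961 (.node 3138076693 (.node 822153743 (.node 146068534846674805678977967201575178 .leaf
  .leaf) .leaf) (.node 3003331343 (.node 18493129079 .leaf .leaf) .leaf)) (.node 3842695287 (.node
  2130850447 (.node 515 .leaf .leaf) .leaf) (.node 8524890389 (.node 458784 .leaf .leaf) .leaf)))
  (.node 2701639763 (.node 3507249223 (.node 1526895183 (.node 859 .leaf .leaf) .leaf) (.node
  2869375823 (.node 609918943798481206318307186364625126797547 .leaf .leaf) .leaf)) (.node
  3876421793 (.node 2365993679 (.node 609932249080653098527268802409112296366121 .leaf .leaf) .leaf)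
  (.node 107117115774199512423788014354817272 (.node 351 .leaf .leaf) .leaf))))
def tab010101 : Tab :=
  .node 1124311079 (.node 1627725857 (.node 2164760595 (.node 2802425969 (.node 553734655 (.node
  132435744149349992366208791407280430 .leaf .leaf) .leaf) (.node 3070374655 (.node
  31541669587998196767621828051362 .leaf .leaf) .leaf)) (.node 3641491563 (.node 2063676031 (.node
  743 .leaf .leaf) .leaf) (.node 3674878847 (.node 31527397925240928 .leaf .leaf) .leaf))) (.node
  2533933125 (.node 3473653821 (.node 1258394175 (.node 155806785794719201861195758629839196 .leaf
  .leaf) .leaf) (.node 3305517887 (.node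
  6173191111558430889636598852424753060662395934874383476400468187 .leaf .leaf) .leaf)) (.node
  3909935255 (.node 2097492671 (.node 4043944103 .leaf .leaf) .leaf) (.node
  4203918679214421917901269 (.node 115335788015942991933 .leaf .leaf) .leaf)))) (.node 1795522619
  (.node 2466734127 (.node 3238756389 (.node 889328159 (.node 150612904024480090150833341643096354
  .leaf .leaf) .leaf) (.node 3271832351 (.node 5378908053869984235964891472 .leaf .leaf) .leaf))
  (.node 3876298883 (.node 2063807135 (.node 695 .leaf .leaf) .leaf) (.node 4260181 (.node
  10712203891081894398244149254811745 .leaf .leaf) .leaf))) (.node 2668134495 (.node 3607855191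
  (.node 1459851871 (.node 676965 .leaf .leaf) .leaf) (.node 3137876831 (.node
  5626379728920300237171064401935 .leaf .leaf) .leaf)) (.node 4010672297 (.node 2868916959 (.node
  8786864234304713107185811287323968236634538124 .leaf .leaf) .leaf) (.node
  120101027743350136094740055451476210 .leaf .leaf))))
def tab010110 : Tab :=
  .node 1124286497 (.node 1594146843 (.node 2064080905 (.node 2735300717 (.node 419484151 (.node
  131786389858517587434445654465970446 .leaf .leaf) .leaf) (.node 2936124151 (.node
  175477569728861744723181269525509750852 .leaf .leaf) .leaf)) (.node 3708575845 (.node 1929425527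
  (.node 86925 .leaf .leaf) .leaf) (.node 3540628343 (.node 1879732282 .leaf .leaf) .leaf))) (.node
  2466807873 (.node 3406528569 (.node 1325470263 (.node 155806151814638799291147325004996924 .leaf
  .leaf) .leaf) (.node 3171267383 (.node 24251331351995879573 .leaf .leaf) .leaf)) (.node 3842810003
  (.node 1963242167 (.node 13308354351708504724423630982779055 .leaf .leaf) .leaf) (.node
  363751589727453621 (.node 155953429720035483898004 .leaf .leaf) .leaf)))) (.node 1795498037 (.node
  2332565543 (.node 3238731807 (.node 755077655 (.node 149314829461590744592928075100193026 .leaf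
  .leaf) .leaf) (.node 3137581847 (.node 7352130045388559343345557906 .leaf .leaf) .leaf)) (.node
  3876274301 (.node 1929556631 (.node 555 .leaf .leaf) .leaf) (.node 2253109 (.node 163994 .leaf
  .leaf) .leaf))) (.node 2701664345 (.node 3607830609 (.node 1325601367 (.node
  37880038674377618093062032499040 .leaf .leaf) .leaf) (.node 3003626327 (.node
  529020424930832539070617 .leaf .leaf) .leaf)) (.node 3943547045 (.node 2500244183 (.node
  312434029213813764410348912331952891174908926921627680790638746551127504033239327416922607307737599033461303828682130244489811938822186995298832460
  .leaf .leaf) .leaf) (.node 113608913070529650774753713331486972 (.node 89 .leaf .leaf) .leaf))))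
def tab010111 : Tab :=
  .node 1359265801 (.node 1627750439 (.node 2298961947 (.node 3104497679 (.node 788566535 (.node
  142173519766273799610542505059197182 .leaf .leaf) .leaf) (.node 2869080839 (.node
  23774175596744812715658729070842 .leaf .leaf) .leaf)) (.node 3708616815 (.node 1996599943 (.node
  275 .leaf .leaf) .leaf) (.node 3694837 (.node 31532829263892705 .leaf .leaf) .leaf))) (.node
  2668060749 (.node 3440123971 (.node 1392644679 (.node 527 .leaf .leaf) .leaf) (.node 3439768391
  (.node 2549021430243456433070545032666303765443336464480587298185248 .leaf .leaf) .leaf)) (.node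
  3977060507 (.node 2231743175 (.node 544904061468473201963724091727840590200921 .leaf .leaf) .leaf)
  (.node 97379181739286852372648038910378230 (.node 6874548768829 .leaf .leaf) .leaf)))) (.node
  1761992769 (.node 2500313141 (.node 3305881641 (.node 1023578663 (.node
  153859039912262172206087888140910844 .leaf .leaf) .leaf) (.node 2902766375 (.node
  1605913680610877058097470 .leaf .leaf) .leaf)) (.node 3842769033 (.node 2198057639 (.node
  17465716848 .leaf .leaf) .leaf) (.node 77671468073333 (.node
  7861789195987306031742284264105930293135192418771150 .leaf .leaf) .leaf))) (.node 2735259747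
  (.node 3674980443 (.node 1594102375 (.node 575 .leaf .leaf) .leaf) (.node 3272127335 (.node
  154797018881487921199067959526292376800706665838870306958 .leaf .leaf) .leaf)) (.node 184570343
  (.node 2868949735 (.node 463017 .leaf .leaf) .leaf) (.node 126592983496005305280223950796865782
  .leaf .leaf))))
def tab011000 : Tab :=
  .node 1023647765 (.node 1493524495 (.node 1896259651 (.node 2802466917 (.node 385888749 (.node
  127891216476524610711450453468651790 .leaf .leaf) .leaf) (.node 2969637613 (.node 463073 .leaf
  .leaf) .leaf)) (.node 3742195807 (.node 1694790253 (.node 807 .leaf .leaf) .leaf) (.node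
  3372815213 (.node 458907 .leaf .leaf) .leaf))) (.node 2567512121 (.node 3440156719 (.node
  1258320429 (.node 154508394164399510789466258020958484 .leaf .leaf) .leaf) (.node 3003454253
  (.node 134265036048194984912402483813991923772 .leaf .leaf) .leaf)) (.node 3977142411 (.node
  2298745517 (.node 5572147225702979184142434325 .leaf .leaf) .leaf) (.node
  3410369678949525364621709 (.node
  108817744225196579788673428271390656981640824357026752827108922044551333 .leaf .leaf) .leaf))))
  (.node 1694900265 (.node 2366144543 (.node 3171647507 (.node 788591117 (.node
  145419656079597767869932874102874370 .leaf .leaf) .leaf) (.node 2969768717 (.node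
  2238932170519288212808102 .leaf .leaf) .leaf)) (.node 3775783025 (.node 2097287821 (.node 343
  .leaf .leaf) .leaf) (.node 63642558980365 (.node
  2879834058669351454099124998399270819815257200803787540333461742 .leaf .leaf) .leaf))) (.node
  2735333457 (.node 3540836421 (.node 1493332557 (.node 633 .leaf .leaf) .leaf) (.node 3540456269
  (.node 48322757199694113810612177267554880964292790479978555566700163842531468 .leaf .leaf)
  .leaf)) (.node 4044243103 (.node 2332431053 (.node 26944346038799589425907755544741 .leaf .leaf)
  .leaf) (.node 104520333403518428188961469908336882 (.node 413737 .leaf .leaf) .leaf))))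
def tab011001 : Tab :=
  .node 1191444517 (.node 1661329439 (.node 2198339599 (.node 2836021359 (.node 520172029 (.node
  132435585654329892876899731304104230 .leaf .leaf) .leaf) (.node 3036812029 (.node
  35344350674115137208847057936802 .leaf .leaf) .leaf)) (.node 3775750249 (.node 2030113405 (.node
  553 .leaf .leaf) .leaf) (.node 3641316221 (.node
  49296172403994676705275565628957847357219754341762515947866041701306039682000494157832 .leaf
  .leaf) .leaf))) (.node 2601074755 (.node 3507273787 (.node 1224831549 (.node
  155806627299699104678292795132731732 .leaf .leaf) .leaf) (.node 3271955261 (.node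
  23314981152892940790316156879003 .leaf .leaf) .leaf)) (.node 4010696853 (.node 2063930045 (.node
  4663187056740183177480683687 .leaf .leaf) .leaf) (.node 90448961208781 (.node
  2998329775364143039699161327 .leaf .leaf) .leaf)))) (.node 1862697017 (.node 2399715369 (.node
  3305906209 (.node 855765533 (.node 150612587034439888865809124964925722 .leaf .leaf) .leaf) (.node
  3238269725 (.node 250803 .leaf .leaf) .leaf)) (.node 3943579777 (.node 2030244509 (.node 398307
  .leaf .leaf) .leaf) (.node 1189979413870155120973 (.node 638412175430870877059825722 .leaf .leaf)
  .leaf))) (.node 2768904283 (.node 3675095123 (.node 1426289245 (.node 291781 .leaf .leaf) .leaf)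
  (.node 3104314205 (.node 609867116570335687428252509596949962596442 .leaf .leaf) .leaf)) (.node
  4044275879 (.node 2600932061 (.node 386898800511029235121967229 .leaf .leaf) .leaf) (.node
  114258267322666989358132083211534612 (.node 609 .leaf .leaf) .leaf))))
def tab011010 : Tab :=
  .node 1157890079 (.node 1527087125 (.node 1896276039 (.node 2836004971 (.node 385921525 (.node
  131786072868477386149421437787799814 .leaf .leaf) .leaf) (.node 2902561525 (.node
  25034867446342679873168539902449493128791758418415424830233793181261957 .leaf .leaf) .leaf))
  (.node 3742212195 (.node 1996526197 (.node 849 .leaf .leaf) .leaf) (.node 3507065717 (.node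
  129174218823931392056 .leaf .leaf) .leaf))) (.node 2567528509 (.node 3473719349 (.node 1291907637
  (.node 155157589960211823151138624811548980 .leaf .leaf) .leaf) (.node 3137704757 (.node
  1446263865529 .leaf .leaf) .leaf)) (.node 3977158799 (.node 1929679541 (.node
  297036502664690650739521964440547273105329071956024219567061095709310361730 .leaf .leaf) .leaf)
  (.node 361499240025457069 (.node 3659228314920499716696917809903168604341706987 .leaf .leaf)
  .leaf)))) (.node 1829142579 (.node 2399698981 (.node 3272343579 (.node 721515029 (.node
  149314512471550543307903858422022394 .leaf .leaf) .leaf) (.node 3104019221 (.node 88393619718575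
  .leaf .leaf) .leaf)) (.node 3910025339 (.node 2231538325 (.node 467 .leaf .leaf) .leaf) (.node
  3973421 (.node 971 .leaf .leaf) .leaf))) (.node 2768887895 (.node 3641532493 (.node 1292038741
  (.node 795 .leaf .leaf) .leaf) (.node 2970063701 (.node 31532070346055749 .leaf .leaf) .leaf))
  (.node 4044259491 (.node 2466681557 (.node 330694824361280313335872 .leaf .leaf) .leaf) (.node
  112959717352107484948287460467646708 (.node 571 .leaf .leaf) .leaf))))
def tab011011 : Tab :=
  .node 1191460905 (.node 1694883877 (.node 2231902229 (.node 3037405193 (.node 755003909 (.node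
  141524482542871730966979215558213878 .leaf .leaf) .leaf) (.node 3171062533 (.node
  37721775871819185606914888917428 .leaf .leaf) .leaf)) (.node 3775766637 (.node 1963037317 (.node
  37721543654273515971808616497490 .leaf .leaf) .leaf) (.node 3775566725 (.node
  609917630494012114683430213585316064288919 .leaf .leaf) .leaf))) (.node 2601091143 (.node
  3540820033 (.node 1359082053 (.node 37563048634167107444458594427204 .leaf .leaf) .leaf) (.node
  3406205765 (.node 5338806379453550806537609249 .leaf .leaf) .leaf)) (.node 4010713241 (.node
  2198180549 (.node 1265664632317407159976005 .leaf .leaf) .leaf) (.node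
  90887225716011749515898216346804472 (.node 1935013428073686057257582752 .leaf .leaf) .leaf))))
  (.node 1862713405 (.node 2533957683 (.node 3339460647 (.node 990016037 (.node
  153209844193840006379621635277070580 .leaf .leaf) .leaf) (.node 2869203749 (.node 619585 .leaf
  .leaf) .leaf)) (.node 3943596165 (.node 2164495013 (.node 890059 .leaf .leaf) .leaf) (.node
  315889983527469421 (.node 9055954223811578403513753160677582708095697133 .leaf .leaf) .leaf)))
  (.node 2802450529 (.node 3708649561 (.node 1560539749 (.node 23615719252822206422699889238266
  .leaf .leaf) .leaf) (.node 3238564709 (.node 7697605046435 .leaf .leaf) .leaf)) (.node 184562149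
  (.node 2936050405 (.node 1807669022911109001505454105362699733221444 .leaf .leaf) .leaf) (.node
  123996201396123604643014991326273794 .leaf .leaf))))
def tab011100 : Tab :=
  .node 1124335643 (.node 1527078931 (.node 1896267845 (.node 2835996777 (.node 419459569 (.node
  130488156877998282003219151794184438 .leaf .leaf) .leaf) (.node 3036762865 (.node
  101035089254434137944854831864354457192683514904614 .leaf .leaf) .leaf)) (.node 3742204001 (.node
  1929400945 (.node 37880038674366086062578834342230 .leaf .leaf) .leaf) (.node 3439940465 (.node
  416965255518231286324846871724597748415063048380786933841 .leaf .leaf) .leaf))) (.node 2567520315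
  (.node 3473711155 (.node 1224782385 (.node 155157272970171621866114407999127844 .leaf .leaf)
  .leaf) (.node 3070579505 (.node 7446537286636413181219430579741682236434579304744621465911505
  .leaf .leaf) .leaf)) (.node 3977150605 (.node 2365870769 (.node 167957 .leaf .leaf) .leaf) (.node
  24532478028874808972773548445 (.node 688550031 .leaf .leaf) .leaf)))) (.node 1795588143 (.node
  2366152737 (.node 3171655701 (.node 855716369 (.node 146068851836715002351189990667608338 .leaf
  .leaf) .leaf) (.node 3036893969 (.node 8938495670867523200211534262 .leaf .leaf) .leaf)) (.node
  3876470903 (.node 2164413073 (.node 761 .leaf .leaf) .leaf) (.node 268591877234622749 (.node 169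
  .leaf .leaf) .leaf))) (.node 2735341651 (.node 3540844615 (.node 1224913489 (.node 685165 .leaf
  .leaf) .leaf) (.node 2902938449 (.node 1373438969968571512477339781 .leaf .leaf) .leaf)) (.node
  4044251297 (.node 2399556305 (.node 7697756430387 .leaf .leaf) .leaf) (.node
  109713898028823717973921308102140152 (.node 97 .leaf .leaf) .leaf))))
def tab011101 : Tab :=
  .node 1191452711 (.node 1661337633 (.node 2231894035 (.node 2836029553 (.node 721433089 (.node
  132435744149350001591833177965805878 .leaf .leaf) .leaf) (.node 3103937281 (.node 742535 .leaf
  .leaf) .leaf)) (.node 3775758443 (.node 2097238657 (.node 487 .leaf .leaf) .leaf) (.node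
  3708441473 (.node 1879503017 .leaf .leaf) .leaf))) (.node 2601082949 (.node 3507281981 (.node
  1291956801 (.node 805 .leaf .leaf) .leaf) (.node 3339080513 (.node
  92270448840726571259031170534888528327430221848718 .leaf .leaf) .leaf)) (.node 4010705047 (.node
  2131055297 (.node 22414600022070097273247307099963561 .leaf .leaf) .leaf) (.node 15069569501
  (.node 472386533722579341131940 .leaf .leaf) .leaf)))) (.node 1862705211 (.node 2500403247 (.node
  3339452453 (.node 922890785 (.node 150613062519500191946548498352341290 .leaf .leaf) .leaf) (.node
  3305394977 (.node 5358021 .leaf .leaf) .leaf)) (.node 3943587971 (.node 2097369761 (.node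
  17183981893 .leaf .leaf) .leaf) (.node 10370818397 (.node 9290120126095502 .leaf .leaf) .leaf)))
  (.node 2802442335 (.node 3708641367 (.node 1493414497 (.node 683 .leaf .leaf) .leaf) (.node
  3171439457 (.node 6690507062719821262970230083688536910530076722 .leaf .leaf) .leaf)) (.node
  4044284073 (.node 2868925153 (.node 23208699525100782684673425377428174381659992420429 .leaf
  .leaf) .leaf) (.node 122697809997974341644873349198799090 .leaf .leaf))))
def tab011110 : Tab :=
  .node 1157898273 (.node 1627775003 (.node 2097651721 (.node 2836013165 (.node 453046777 (.node
  131786548353537689230160811175215382 .leaf .leaf) .leaf) (.node 2969686777 (.node 332751 .leaf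
  .leaf) .leaf)) (.node 3742220389 (.node 1962988153 (.node 247 .leaf .leaf) .leaf) (.node
  3574190969 (.node 528973127568441882247386 .leaf .leaf) .leaf))) (.node 2601066561 (.node
  3507265593 (.node 1359032889 (.node 155806468804678995963359348471030084 .leaf .leaf) .leaf)
  (.node 3204830009 (.node 5957917108761959139575709805 .leaf .leaf) .leaf)) (.node 4010688659
  (.node 1996804793 (.node 1633424577805949406562651347118413900275720 .leaf .leaf) .leaf) (.node
  1499152106361002721725 (.node 135267 .leaf .leaf) .leaf)))) (.node 1829150773 (.node 2399707175
  (.node 3305898015 (.node 788640281 (.node 149963708228667782401973168198893834 .leaf .leaf) .leaf)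
  (.node 3171144473 (.node 27735622228710423733453582606650 .leaf .leaf) .leaf)) (.node 3910033533
  (.node 1963119257 (.node 6384677635104130606453473534 .leaf .leaf) .leaf) (.node
  286047037449642301 (.node 10710778963988029954385506608537650 .leaf .leaf) .leaf))) (.node
  2768896089 (.node 3675086929 (.node 1359163993 (.node 523 .leaf .leaf) .leaf) (.node 3037188953
  (.node 458852 .leaf .leaf) .leaf)) (.node 4044267685 (.node 2533806809 (.node
  6173178290458987184202868702084816625403686114294909833051406424 .leaf .leaf) .leaf) (.node
  113609071565549754876874966646800644 (.node 108 .leaf .leaf) .leaf))))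
def tab011111 : Tab :=
  .node 1392836617 (.node 1694892071 (.node 2332590107 (.node 3138093071 (.node 721465865 (.node
  144121264681448504871791231975399666 .leaf .leaf) .leaf) (.node 2902643465 (.node 3948839 .leaf
  .leaf) .leaf)) (.node 3775774831 (.node 2030162569 (.node 595 .leaf .leaf) .leaf) (.node
  15235694845 (.node 36353924364522158393492150964175000 .leaf .leaf) .leaf))) (.node 2701779021
  (.node 3540828227 (.node 1426207305 (.node 643 .leaf .leaf) .leaf) (.node 3473331017 (.node
  82757839874080809 .leaf .leaf) .leaf)) (.node 4010721435 (.node 2265305801 (.node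
  36919153082755232753185857631404352959152096084058 .leaf .leaf) .leaf) (.node
  99975963993911057922781332657701110 (.node 531 .leaf .leaf) .leaf)))) (.node 1896251457 (.node
  2533965877 (.node 3339468841 (.node 1224749609 (.node 153859198407282276308209141456224516 .leaf
  .leaf) .leaf) (.node 2936329001 (.node 91999154235000540544621355117082144326396951528422703270
  .leaf .leaf) .leaf)) (.node 3977134217 (.node 2231620265 (.node 1831219261 .leaf .leaf) .leaf)
  (.node 78221356384637 (.node 27967669955965200994879214534173217004 .leaf .leaf) .leaf))) (.node
  2802458723 (.node 3708657755 (.node 1627665001 (.node 37404553614067618135398524813630 .leaf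
  .leaf) .leaf) (.node 3305689961 (.node 7697605046404 .leaf .leaf) .leaf)) (.node 218132969 (.node
  2902512361 (.node 54526804216481229578263473138110625 .leaf .leaf) .leaf) (.node
  127242020719407373923787240297849086 .leaf .leaf))))
def tab100000 : Tab :=
  .node 973295636 (.node 1443155982 (.node 1778782274 (.node 2752049252 (.node 234914283 (.node
  127242179214427475719502396973531396 .leaf .leaf) .leaf) (.node 2919293675 (.node
  2187655354170958540258992350 .leaf .leaf) .leaf)) (.node 3591114846 (.node 1644446315 (.node 503
  .leaf .leaf) .leaf) (.node 3322471275 (.node 129144406392238137513 .leaf .leaf) .leaf))) (.node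
  2450001976 (.node 3389714478 (.node 1207976491 (.node 154508077174359311810848137915293962 .leaf
  .leaf) .leaf) (.node 2953110315 (.node 1377666498064274637332766759 .leaf .leaf) .leaf)) (.node
  3859558538 (.node 2248401579 (.node 1152279588539705089638409 .leaf .leaf) .leaf) (.node
  1319134776619912765827 (.node 114555576139633462108888981127858525409379 .leaf .leaf) .leaf))))
  (.node 1644539944 (.node 2282205214 (.node 3087740946 (.node 738247179 (.node
  144770460361175602043466621205471480 .leaf .leaf) .leaf) (.node 2919424779 (.node 373723 .leaf
  .leaf) .leaf)) (.node 3725406320 (.node 2046943883 (.node 867 .leaf .leaf) .leaf) (.node 2007299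
  (.node 1042495479487612358078646107501056643703594884509884226588761 .leaf .leaf) .leaf))) (.node
  2651304016 (.node 3456913476 (.node 1442988619 (.node 8424210707 .leaf .leaf) .leaf) (.node
  3490112331 (.node 23103789817136069234708766256646207212180717600 .leaf .leaf) .leaf)) (.node
  3826086046 (.node 2282087115 (.node 692465 .leaf .leaf) .leaf) (.node
  100625001217313124259938525519053052 (.node 2181447740 .leaf .leaf) .leaf))))
def tab100001 : Tab :=
  .node 1073975332 (.node 1577390110 (.node 2147971086 (.node 2752090222 (.node 469828091 (.node
  132435268664289693898281611198439708 .leaf .leaf) .leaf) (.node 2986468091 (.node 808093 .leaf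
  .leaf) .leaf)) (.node 3591155816 (.node 1979769467 (.node 847 .leaf .leaf) .leaf) (.node
  3590972283 (.node 7697571385375 .leaf .leaf) .leaf))) (.node 2483597378 (.node 3423318074 (.node
  1375814203 (.node 155806468804679002882577638389924170 .leaf .leaf) .leaf) (.node 3221611323
  (.node 799237567385653461450863 .leaf .leaf) .leaf)) (.node 3859599508 (.node 2013586107 (.node
  5548157860161873288196461794591 .leaf .leaf) .leaf) (.node 21916221891 (.node 135188 .leaf .leaf)
  .leaf)))) (.node 1745186872 (.node 2349355048 (.node 3255521312 (.node 805421595 (.node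
  149963866723687884197688324874576144 .leaf .leaf) .leaf) (.node 3187925787 (.node 340945 .leaf
  .leaf) .leaf)) (.node 3825963136 (.node 1979900571 (.node 1284795047037552401866996 .leaf .leaf)
  .leaf) (.node 70248120049987 (.node 2614936270462232029911945736238 .leaf .leaf) .leaf))) (.node
  2718453850 (.node 3624620114 (.node 1375945307 (.node 623 .leaf .leaf) .leaf) (.node 3053970267
  (.node 31529390152491170 .leaf .leaf) .leaf)) (.node 3960336550 (.node 2550588123 (.node
  5548138082790803031667692421218 .leaf .leaf) .leaf) (.node 114257950332626790379513963105870090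
  (.node 61 .leaf .leaf) .leaf))))
def tab100010 : Tab :=
  .node 1073950750 (.node 1476734996 (.node 1845907526 (.node 2684964970 (.node 436240883 (.node
  131137194101400348340376344655536380 .leaf .leaf) .leaf) (.node 2852217587 (.node
  1298681246602062557164940919742629284838654012 .leaf .leaf) .leaf)) (.node 3658240098 (.node
  1946182259 (.node 693367 .leaf .leaf) .leaf) (.node 3456721779 (.node 1879322661 .leaf .leaf)
  .leaf))) (.node 2517127228 (.node 3423293492 (.node 1241563699 (.node
  155157431465191721355423468068741418 .leaf .leaf) .leaf) (.node 3087360819 (.node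
  24227963229339844699 .leaf .leaf) .leaf)) (.node 3926683790 (.node 2382652083 (.node
  725575405398490342827982434230181106794639 .leaf .leaf) .leaf) (.node 6017715636883771697807779
  (.node 554094691 .leaf .leaf) .leaf)))) (.node 1745162290 (.node 2282229796 (.node 3221942298
  (.node 872497683 (.node 146068851836715009270408280586502424 .leaf .leaf) .leaf) (.node 3053675283
  (.node 7622872749043970135471341958 .leaf .leaf) .leaf)) (.node 3825938554 (.node 2181194387
  (.node 853 .leaf .leaf) .leaf) (.node 65986604589347 (.node 901 .leaf .leaf) .leaf))) (.node
  2651328598 (.node 3591041100 (.node 1241694803 (.node 637 .leaf .leaf) .leaf) (.node 2919719763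
  (.node
  15681631275264646322632514090639557929701272004010895023659490248379528326151974262156091030220545310863
  .leaf .leaf) .leaf)) (.node 3893211298 (.node 2416337619 (.node 797390790621661104639582245 .leaf
  .leaf) .leaf) (.node 110362935252225784311078500963492094 (.node 1011 .leaf .leaf) .leaf))))
def tab100011 : Tab :=
  .node 1141100584 (.node 1577414692 (.node 2181550100 (.node 2987061256 (.node 704659971 (.node
  138927541793227425927536861808402676 .leaf .leaf) .leaf) (.node 3120718595 (.node 193445 .leaf
  .leaf) .leaf)) (.node 3658281068 (.node 1912693379 (.node 60212794180051 .leaf .leaf) .leaf)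
  (.node 3725222787 (.node 31532827653329135 .leaf .leaf) .leaf))) (.node 2550722630 (.node
  3389788224 (.node 1308738115 (.node 507 .leaf .leaf) .leaf) (.node 3355861827 (.node
  893870493659232383275236068352112445298581587 .leaf .leaf) .leaf)) (.node 3926724760 (.node
  2147836611 (.node
  46627256917625299466715321063998938929615194261599588129801744333694469385197753909329 .leaf
  .leaf) .leaf) (.node 84395269731365602183178120378401010 (.node 23615640615740326477070266855471
  .leaf .leaf) .leaf)))) (.node 1812312124 (.node 2449977394 (.node 3255545894 (.node 939672099
  (.node 150613221014520289129451461815886128 .leaf .leaf) .leaf) (.node 3322176291 (.node 570409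
  .leaf .leaf) .leaf)) (.node 3893088388 (.node 2114151075 (.node 645 .leaf .leaf) .leaf) (.node
  5252519289017628323029347 (.node 775573311148545388396781666 .leaf .leaf) .leaf))) (.node
  2684924000 (.node 3624644696 (.node 1510195811 (.node 489 .leaf .leaf) .leaf) (.node 3188220771
  (.node 171662332433358993780491708852608242995766159318408798226 .leaf .leaf) .leaf)) (.node
  67117539 (.node 2885706467 (.node 1174863912 .leaf .leaf) .leaf) (.node
  123347005677701438816548738428870904 .leaf .leaf))))
def tab100100 : Tab :=
  .node 1073934362 (.node 1443172370 (.node 1812344900 (.node 2651402344 (.node 369115631 (.node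
  127891374971544710200759513538265364 .leaf .leaf) .leaf) (.node 2986418927 (.node
  232972299002152656824053391918190330425361532148711284846 .leaf .leaf) .leaf)) (.node 3624677472
  (.node 1912611439 (.node 578605 .leaf .leaf) .leaf) (.node 3389596527 (.node 1879732447 .leaf
  .leaf) .leaf))) (.node 2483564602 (.node 3389730866 (.node 1275101743 (.node
  155156955980131418274684094681325850 .leaf .leaf) .leaf) (.node 3020235567 (.node 5914617834770532
  .leaf .leaf) .leaf)) (.node 3893121164 (.node 2315526831 (.node
  97361197257156919453429885462401091 .leaf .leaf) .leaf) (.node 50039828013459 (.node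
  46163661190047555726 .leaf .leaf) .leaf)))) (.node 1745145902 (.node 2315767840 (.node 3121303572
  (.node 805372431 (.node 146068534846674803372571870561943816 .leaf .leaf) .leaf) (.node 2986550031
  (.node 111505 .leaf .leaf) .leaf)) (.node 3825922166 (.node 2114069135 (.node
  26785619635943289957889455923464 .leaf .leaf) .leaf) (.node 34780479439123 (.node 1879179361 .leaf
  .leaf) .leaf))) (.node 2684866642 (.node 3490476102 (.node 1510113871 (.node 493 .leaf .leaf)
  .leaf) (.node 2852594511 (.node 2880260777461202501441369282496957109528491645582537680230023322
  .leaf .leaf) .leaf)) (.node 3859648672 (.node 2349212367 (.node 80736041103525974085 .leaf .leaf)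
  .leaf) (.node 107117115774199510117381917715185910 (.node 130 .leaf .leaf) .leaf))))
def tab100101 : Tab :=
  .node 1107537958 (.node 1610952736 (.node 2147987474 (.node 2785652848 (.node 536953343 (.node
  132435585654329899796118021222998316 .leaf .leaf) .leaf) (.node 3053593343 (.node 627783 .leaf
  .leaf) .leaf)) (.node 3624718442 (.node 2046894719 (.node 485 .leaf .leaf) .leaf) (.node
  3658097535 (.node 7697118658729 .leaf .leaf) .leaf))) (.node 2517160004 (.node 3456880700 (.node
  1241612863 (.node 155806785794719199554789661990207834 .leaf .leaf) .leaf) (.node 3288736575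
  (.node 8744037766026830098580994585067769000110063853 .leaf .leaf) .leaf)) (.node 3893162134
  (.node 2080711359 (.node 277901114635987042416 .leaf .leaf) .leaf) (.node
  17180555836795232206204494291 (.node 206072528346141107395881297335212671082 .leaf .leaf)
  .leaf)))) (.node 1778749498 (.node 2449961006 (.node 3221983268 (.node 872546847 (.node
  150612904024480087844427245003464992 .leaf .leaf) .leaf) (.node 3255051039 (.node
  36770767216674850415303200571814 .leaf .leaf) .leaf)) (.node 3859525762 (.node 2047025823 (.node
  98539612042182950 .leaf .leaf) .leaf) (.node 17417167187 (.node
  48708684779598677678830531553100014 .leaf .leaf) .leaf))) (.node 2651361374 (.node 3591082070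
  (.node 1443070559 (.node 775313 .leaf .leaf) .leaf) (.node 3121095519 (.node
  609867116566118103066870508353711562428430 .leaf .leaf) .leaf)) (.node 3993899176 (.node
  2852135647 (.node 3457525096492694837878694229885097719173800077 .leaf .leaf) .leaf) (.node
  118153441052396149031588900235067634 (.node 0 .leaf .leaf) .leaf))))
def tab100110 : Tab :=
  .node 1107513376 (.node 1577373722 (.node 2047307784 (.node 2718527596 (.node 402702839 (.node
  131786389858517585128039557826339084 .leaf .leaf) .leaf) (.node 2919342839 (.node
  718756125609396874568643862947964823036015 .leaf .leaf) .leaf)) (.node 3691802724 (.node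
  1912644215 (.node 889 .leaf .leaf) .leaf) (.node 3523847031 (.node 7699383427155 .leaf .leaf)
  .leaf))) (.node 2450034752 (.node 3389755448 (.node 1308688951 (.node
  155806151814638796984741228365365562 .leaf .leaf) .leaf) (.node 3154486071 (.node 1443998494759
  .leaf .leaf) .leaf)) (.node 3826036882 (.node 1946460855 (.node 8642447687270826204005775220797
  .leaf .leaf) .leaf) (.node 1487620105427011748275 (.node
  12355725290953350527204314162780823112133323909120053 .leaf .leaf) .leaf)))) (.node 1778724916
  (.node 2315792422 (.node 3221958686 (.node 738296343 (.node 149314829461590742286521978460561664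
  .leaf .leaf) .leaf) (.node 3120800535 (.node 23140582684340672087757937811778 .leaf .leaf) .leaf))
  (.node 3859501180 (.node 1912775319 (.node 529435 .leaf .leaf) .leaf) (.node 9196134707 (.node 301
  .leaf .leaf) .leaf))) (.node 2684891224 (.node 3591057488 (.node 1308820055 (.node 663 .leaf
  .leaf) .leaf) (.node 2986845015 (.node 19986167462162491 .leaf .leaf) .leaf)) (.node 3926773924
  (.node 2483462871 (.node
  3943473704179495268768009083922078919096816522748203797880041486083598779660842251252317388019719509591589092438884439
  .leaf .leaf) .leaf) (.node 113608754575509551285444653328998650 (.node 91 .leaf .leaf) .leaf))))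
def tab100111 : Tab :=
  .node 1342492680 (.node 1610977318 (.node 2282188826 (.node 3087724558 (.node 771785223 (.node
  142173519766273797304136408419565820 .leaf .leaf) .leaf) (.node 2852299527 (.node 586803 .leaf
  .leaf) .leaf)) (.node 3691843694 (.node 1979818631 (.node 501 .leaf .leaf) .leaf) (.node 243
  (.node 32169885434541929086822548103392 .leaf .leaf) .leaf))) (.node 2651287628 (.node 3423350850
  (.node 1375863367 (.node 414701 .leaf .leaf) .leaf) (.node 3422987079 (.node
  651563743143516672925613344129870828460992912472300696965168617486862408818708 .leaf .leaf)
  .leaf)) (.node 3960287386 (.node 2214961863 (.node 70347638159605714953 .leaf .leaf) .leaf) (.node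
  97379023244266752883338978907889908 (.node 115335788015942934588 .leaf .leaf) .leaf)))) (.node
  1745219648 (.node 2483540020 (.node 3289108520 (.node 1006797351 (.node
  153858881417242072716778828138422522 .leaf .leaf) .leaf) (.node 2885985063 (.node
  2125581550003948275589542 .leaf .leaf) .leaf)) (.node 3825995912 (.node 2181276327 (.node
  71539576377457 .leaf .leaf) .leaf) (.node 317579245803536755 (.node
  2561433267225443818983621455704664889700220716678741706011566337080241670794729365739 .leaf .leaf)
  .leaf))) (.node 2718486626 (.node 3658207322 (.node 1577321063 (.node 535 .leaf .leaf) .leaf)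
  (.node 3255346023 (.node 7697605046440 .leaf .leaf) .leaf)) (.node 167789031 (.node 2852168423
  (.node 7404375880467078234560132226608393211366899811 .leaf .leaf) .leaf) (.node
  126592825000985205790914890794377460 .leaf .leaf))))
def tab101000 : Tab :=
  .node 1006874644 (.node 1476751374 (.node 1879486530 (.node 2785693796 (.node 369107437 (.node
  127891216476524608405044356829020428 .leaf .leaf) .leaf) (.node 2952856301 (.node
  3750119518999670486221832456296025429049196710 .leaf .leaf) .leaf)) (.node 3725422686 (.node
  1678008941 (.node 777 .leaf .leaf) .leaf) (.node 3356033901 (.node 458813 .leaf .leaf) .leaf)))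
  (.node 2550739000 (.node 3423383598 (.node 1241539117 (.node 154508394164399508483060161381327122
  .leaf .leaf) .leaf) (.node 2986672941 (.node 23311611611983011948827207909437 .leaf .leaf) .leaf))
  (.node 3960369290 (.node 2281964205 (.node 4193047138413 .leaf .leaf) .leaf) (.node 4718987 (.node
  736039378376652866225366367153058756450132056 .leaf .leaf) .leaf)))) (.node 1678127144 (.node
  2349371422 (.node 3154874386 (.node 771809805 (.node 145419656079597765563526777463243008 .leaf
  .leaf) .leaf) (.node 2952987405 (.node 1303675300294830486298874 .leaf .leaf) .leaf)) (.node
  3759009904 (.node 2080506509 (.node 545 .leaf .leaf) .leaf) (.node 15505907979 (.node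
  48315598098426738222935216299181997933323478135536835871409851243348202 .leaf .leaf) .leaf)))
  (.node 2718560336 (.node 3524063300 (.node 1476551245 (.node 859 .leaf .leaf) .leaf) (.node
  3523674957 (.node 6487644081525054925957867436196085683328125821070 .leaf .leaf) .leaf)) (.node
  4027469982 (.node 2315649741 (.node 259032159577118108846425981243482073156021653642268991655
  .leaf .leaf) .leaf) (.node 100625159712333228362059778834366724 (.node 245800 .leaf .leaf)
  .leaf))))
def tab101001 : Tab :=
  .node 1174671396 (.node 1644556318 (.node 2181566478 (.node 2819248238 (.node 503390717 (.node
  132435427159309798000402864513753380 .leaf .leaf) .leaf) (.node 3020030717 (.node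
  1213178613619585556837 .leaf .leaf) .leaf)) (.node 3758977128 (.node 2013332093 (.node 627 .leaf
  .leaf) .leaf) (.node 3624534909 (.node 8875470783869290304406401130637 .leaf .leaf) .leaf)))
  (.node 2584301634 (.node 3490500666 (.node 1208050237 (.node 155806627299699102371886698493100370
  .leaf .leaf) .leaf) (.node 3255173949 (.node 86025 .leaf .leaf) .leaf)) (.node 3993923732 (.node
  2047148733 (.node
  2119906727254616232900837792813142558992566998793690804708109833037377675613732673720018654732453
  .leaf .leaf) .leaf) (.node 369915857686716875 (.node 32462155414544419166634092708208750 .leaf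
  .leaf) .leaf)))) (.node 1845923896 (.node 2382942248 (.node 3289133088 (.node 838984221 (.node
  149964025218707985993403481583821080 .leaf .leaf) .leaf) (.node 3221488413 (.node 603195 .leaf
  .leaf) .leaf)) (.node 3926806656 (.node 2013463197 (.node 2191710824481451849474380 .leaf .leaf)
  .leaf) (.node 17284669771 (.node 638412175430870877059826213 .leaf .leaf) .leaf))) (.node
  2752131162 (.node 3658322002 (.node 1409507933 (.node 517 .leaf .leaf) .leaf) (.node 3087532893
  (.node 2253856543469988206448768727364530880956924001 .leaf .leaf) .leaf)) (.node 4027502758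
  (.node 2584150749 (.node 1832543232744055951348314794742834684750248263688 .leaf .leaf) .leaf)
  (.node 114258267322666987051725986571903250 (.node 331 .leaf .leaf) .leaf))))
def tab101010 : Tab :=
  .node 1141116958 (.node 1510314004 (.node 1879502918 (.node 2819231850 (.node 369140213 (.node
  131137352596420452442497597970850052 .leaf .leaf) .leaf) (.node 2885780213 (.node
  77144563572349777425606037246771118212 .leaf .leaf) .leaf)) (.node 3725439074 (.node 1979744885
  (.node 755 .leaf .leaf) .leaf) (.node 3490284405 (.node 1879732387 .leaf .leaf) .leaf))) (.node
  2550755388 (.node 3456946228 (.node 1275126325 (.node 155157589960211820844732528171917618 .leaf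
  .leaf) .leaf) (.node 3120923445 (.node 477040903186811621564559 .leaf .leaf) .leaf)) (.node
  3960385678 (.node 1912898229 (.node 1851257068276175926605440896119738408722521 .leaf .leaf)
  .leaf) (.node 1478394481047633854891 (.node
  849769261856085358355415214914526563428849285785581321145819370 .leaf .leaf) .leaf)))) (.node
  1812369458 (.node 2382925860 (.node 3255570458 (.node 704733717 (.node
  148665633743168578766461822202790136 .leaf .leaf) .leaf) (.node 3087237909 (.node
  314763808474317161 .leaf .leaf) .leaf)) (.node 3893252218 (.node 2214757013 (.node 761 .leaf
  .leaf) .leaf) (.node 16242516267 (.node 67 .leaf .leaf) .leaf))) (.node 2752114774 (.node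
  3624759372 (.node 1275257429 (.node 37563048634171720256651873689928 .leaf .leaf) .leaf) (.node
  2953282389 (.node 529020355124002807853245 .leaf .leaf) .leaf)) (.node 4027486370 (.node
  2449900245 (.node 424217581918376620566951187957966260730585570475440388693863071199798779990
  .leaf .leaf) .leaf) (.node 112310680167400489572327227879694578 (.node 583 .leaf .leaf) .leaf))))
def tab101011 : Tab :=
  .node 1174687784 (.node 1678110756 (.node 2215129108 (.node 3020632072 (.node 738222597 (.node
  141524324047851631477670155555725556 .leaf .leaf) .leaf) (.node 3154281221 (.node
  7351553895929568788030251386 .leaf .leaf) .leaf)) (.node 3758993516 (.node 1946256005 (.node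
  285483950023704891 .leaf .leaf) .leaf) (.node 3758785413 (.node
  10239299545130872868703632347712512274062065090710 .leaf .leaf) .leaf))) (.node 2584318022 (.node
  3524046912 (.node 1342300741 (.node 463881 .leaf .leaf) .leaf) (.node 3389424453 (.node
  387802564423008489477983332285823035875365 .leaf .leaf) .leaf)) (.node 3993940120 (.node
  2181399237 (.node 2317930528 .leaf .leaf) .leaf) (.node 90887225716011747209492119707173110 (.node
  12149923424641501264976233758244809510833398668845885261870586062467417881102802014326 .leaf
  .leaf) .leaf)))) (.node 1845940284 (.node 2517184562 (.node 3322687526 (.node 973234725 (.node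
  152560807009133011003661402689118450 .leaf .leaf) .leaf) (.node 2852422437 (.node
  2134876392473232183787978 .leaf .leaf) .leaf)) (.node 3926823044 (.node 2147713701 (.node
  37721543654275822377905256128852 .leaf .leaf) .leaf) (.node 1291578966431876202859 (.node
  6828043649333655649592541889630429 .leaf .leaf) .leaf))) (.node 2785677408 (.node 3691876440
  (.node 1543758437 (.node 26944114684450764011814354223364 .leaf .leaf) .leaf) (.node 3221783397
  (.node 31529390270197868 .leaf .leaf) .leaf)) (.node 167780837 (.node 2919269093 (.node
  533936412765245427368005 .leaf .leaf) .leaf) (.node 123996201396123602336608894686642432 .leaf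
  .leaf))))
def tab101100 : Tab :=
  .node 1107562522 (.node 1510305810 (.node 1879494724 (.node 2819223656 (.node 402678257 (.node
  130487998382978182513910091791696116 .leaf .leaf) .leaf) (.node 3019981553 (.node
  31823100367462555 .leaf .leaf) .leaf)) (.node 3725430880 (.node 1912619633 (.node
  5959003497270820334906425600 .leaf .leaf) .leaf) (.node 3423159153 (.node
  36359310237326436109842349564469345 .leaf .leaf) .leaf))) (.node 2550747194 (.node 3456938034
  (.node 1208001073 (.node 155157272970171619559708311359496482 .leaf .leaf) .leaf) (.node
  3053798193 (.node 15171555981407224520812239092180832845186785452254 .leaf .leaf) .leaf)) (.node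
  3960377484 (.node 2349089457 (.node 2600931497 .leaf .leaf) .leaf) (.node
  24493782955607769003254620571 (.node 684133 .leaf .leaf) .leaf)))) (.node 1778815022 (.node
  2349379616 (.node 3154882580 (.node 838935057 (.node 146068693341694907474693123877257488 .leaf
  .leaf) .leaf) (.node 3020112657 (.node 37880232291306564148164885406118 .leaf .leaf) .leaf))
  (.node 3859697782 (.node 2147631761 (.node 72638002967322868 .leaf .leaf) .leaf) (.node
  268028789810413851 (.node 1033 .leaf .leaf) .leaf))) (.node 2718568530 (.node 3524071494 (.node
  1208132177 (.node 37721543654271209565711976866128 .leaf .leaf) .leaf) (.node 2886157137 (.node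
  31532074744840410 .leaf .leaf) .leaf)) (.node 4027478176 (.node 2382774993 (.node
  19710947535048772 .leaf .leaf) .leaf) (.node 109713898028823715667515211462508790 (.node 99 .leaf
  .leaf) .leaf))))
def tab101101 : Tab :=
  .node 1174679590 (.node 1644564512 (.node 2215120914 (.node 2819256432 (.node 704651777 (.node
  132435744149349999285427081326174516 .leaf .leaf) .leaf) (.node 3087155969 (.node
  26944075970423469124132355211578 .leaf .leaf) .leaf)) (.node 3758985322 (.node 2080457345 (.node
  521 .leaf .leaf) .leaf) (.node 3691660161 (.node 129136221901786480808 .leaf .leaf) .leaf)))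
  (.node 2584309828 (.node 3490508860 (.node 1275175489 (.node 573 .leaf .leaf) .leaf) (.node
  3322299201 (.node 11266697328435441 .leaf .leaf) .leaf)) (.node 3993931926 (.node 2114273985
  (.node 2166914932897542401844396200 .leaf .leaf) .leaf) (.node 61587485794779 (.node
  7806094048840560576672774306952224457956434129 .leaf .leaf) .leaf)))) (.node 1845932090 (.node
  2483630126 (.node 3322679332 (.node 906109473 (.node 150613062519500189640142401712709928 .leaf
  .leaf) .leaf) (.node 3288613665 (.node 32173986054110660688443489206674 .leaf .leaf) .leaf))
  (.node 3926814850 (.node 2080588449 (.node 27736589737683045624237052404004 .leaf .leaf) .leaf)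
  (.node 42341400682843 (.node 454291069202393981028 .leaf .leaf) .leaf))) (.node 2785669214 (.node
  3691868246 (.node 1476633185 (.node 563 .leaf .leaf) .leaf) (.node 3154658145 (.node
  10237202006490665276886966036411066627930088390745 .leaf .leaf) .leaf)) (.node 4027510952 (.node
  2852143841 (.node 536436699677329655984583625448384868813662000409493438625 .leaf .leaf) .leaf)
  (.node 120750223423077233266415444681548024 .leaf .leaf))))
def tab101110 : Tab :=
  .node 1141125152 (.node 1611001882 (.node 2080878600 (.node 2819240044 (.node 436265465 (.node
  131786548353537686923754714535584020 .leaf .leaf) .leaf) (.node 2952905465 (.node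
  7855043172512627510727999824 .leaf .leaf) .leaf)) (.node 3725447268 (.node 1946206841 (.node 483
  .leaf .leaf) .leaf) (.node 3557409657 (.node 1879290092 .leaf .leaf) .leaf))) (.node 2584293440
  (.node 3490492472 (.node 1342251577 (.node 155806310309658901086862481680679234 .leaf .leaf)
  .leaf) (.node 3188048697 (.node 1178955929 .leaf .leaf) .leaf)) (.node 3993915538 (.node
  1980023481 (.node
  525346661192094195318183559183713817148852952357738239345668001908278016976765972085196595228218206131832442836203083413141009989282947459682409545737
  .leaf .leaf) .leaf) (.node 6131079988282831219499451 (.node 9295548779966562 .leaf .leaf)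
  .leaf)))) (.node 1812377652 (.node 2382934054 (.node 3289124894 (.node 771858969 (.node
  149963708228667780095567071559262472 .leaf .leaf) .leaf) (.node 3154363161 (.node 914653 .leaf
  .leaf) .leaf)) (.node 3893260412 (.node 1946337945 (.node 567 .leaf .leaf) .leaf) (.node
  1169342259297096204603 (.node 1666693259947970540533581029476 .leaf .leaf) .leaf))) (.node
  2752122968 (.node 3658313808 (.node 1342382681 (.node 665 .leaf .leaf) .leaf) (.node 3020407641
  (.node 1879457852 .leaf .leaf) .leaf)) (.node 4027494564 (.node 2517025497 (.node
  5548138239776125352874153848921 .leaf .leaf) .leaf) (.node 113609071565549752570468870007169282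
  (.node 160 .leaf .leaf) .leaf))))
def tab101111 : Tab :=
  .node 1376063496 (.node 1678118950 (.node 2315816986 (.node 3121319950 (.node 704684553 (.node
  142173678261293901406257661734879492 .leaf .leaf) .leaf) (.node 2885862153 (.node 865471 .leaf
  .leaf) .leaf)) (.node 3759001710 (.node 2013381257 (.node 218025 .leaf .leaf) .leaf) (.node
  15203860731 (.node 7697118662747 .leaf .leaf) .leaf))) (.node 2685005900 (.node 3524055106 (.node
  1409425993 (.node 749 .leaf .leaf) .leaf) (.node 3456549705 (.node 1191592033 .leaf .leaf) .leaf))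
  (.node 3993948314 (.node 2248524489 (.node 330694808596757371699291 .leaf .leaf) .leaf) (.node
  99975805498890958433472272655212788 (.node 511 .leaf .leaf) .leaf)))) (.node 1879478336 (.node
  2517192756 (.node 3322695720 (.node 1207968297 (.node 153859198407282274001803044816593154 .leaf
  .leaf) .leaf) (.node 2919547689 (.node 326846653659766759225059004626904386511016 .leaf .leaf)
  .leaf)) (.node 3960361096 (.node 2214838953 (.node 2964523023617828311501717673 .leaf .leaf)
  .leaf) (.node 319831588326654331 (.node
  37273759767783396018828048441527212837611492416277683216711317004904964307 .leaf .leaf) .leaf)))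
  (.node 2785685602 (.node 3691884634 (.node 1610883689 (.node 37246058593970435232435128394044
  .leaf .leaf) .leaf) (.node 3288908649 (.node 894240734471169851976277917948038274780446810 .leaf
  .leaf) .leaf)) (.node 201351657 (.node 2885731049 (.node 19710122163495152 .leaf .leaf) .leaf)
  (.node 127242020719407371617381143658217724 .leaf .leaf))))
def tab110000 : Tab :=
  .node 1006850068 (.node 1476710414 (.node 1879445570 (.node 2785603684 (.node 335618959 (.node
  127891057981504508915735296792969480 .leaf .leaf) .leaf) (.node 3121317007 (.node
  6692358754442982043707111396622752374699966572 .leaf .leaf) .leaf)) (.node 3725332574 (.node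
  1879491599 (.node 32332945349013125645648742629678 .leaf .leaf) .leaf) (.node 3960382735 (.node
  7697606467738 .leaf .leaf) .leaf))) (.node 2550665272 (.node 3423268910 (.node 1342497743 (.node
  154508235669379411300157197951344910 .leaf .leaf) .leaf) (.node 3658302671 (.node
  477027057124773315666087 .leaf .leaf) .leaf)) (.node 3960221834 (.node 2584282191 (.node
  25196162663452001554126855217173 .leaf .leaf) .leaf) (.node 78901504803207 (.node
  14980956086732246842288043398601969559009981498859684 .leaf .leaf) .leaf)))) (.node 1678094376
  (.node 2349314078 (.node 3154849810 (.node 973300655 (.node 145419497584577666074217717427192060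
  .leaf .leaf) .leaf) (.node 3423380655 (.node 5989316872691796616716701 .leaf .leaf) .leaf)) (.node
  3758960752 (.node 2349368367 (.node 605 .leaf .leaf) .leaf) (.node 63237256708359 (.node
  129136222383343796445 .leaf .leaf) .leaf))) (.node 2718412880 (.node 3524022340 (.node 1678107631
  (.node 527 .leaf .leaf) .leaf) (.node 3758998767 (.node
  108810185516066870643504124277591892320997279480694497348 .leaf .leaf) .leaf)) (.node 4027412638
  (.node 2785666159 (.node 15439521202163288629184607123808479928100240072854 .leaf .leaf) .leaf)
  (.node 100625159712333223749247585555104000 (.node 413757 .leaf .leaf) .leaf))))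
def tab110001 : Tab :=
  .node 1174638628 (.node 1644498974 (.node 2181525518 (.node 2819199086 (.node 671228831 (.node
  132435427159309793387590671234490656 .leaf .leaf) .leaf) (.node 3289121951 (.node
  9248056390749491513607659978 .leaf .leaf) .leaf)) (.node 3758927976 (.node 2181563423 (.node 755
  .leaf .leaf) .leaf) (.node 4027467039 (.node 458811 .leaf .leaf) .leaf))) (.node 2584260674 (.node
  3490426938 (.node 1510310879 (.node 155806627299699097759074505213837646 .leaf .leaf) .leaf)
  (.node 3725419743 (.node 798355542961877729038489 .leaf .leaf) .leaf)) (.node 3993817236 (.node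
  2718549087 (.node
  8683137954834908089961831599362631921633554427058957536084417876121098959313849031557196409784127692
  .leaf .leaf) .leaf) (.node 6187264167491643475395015 (.node 53 .leaf .leaf) .leaf)))) (.node
  1845850168 (.node 2382909480 (.node 3289075744 (.node 1141105599 (.node
  149964025218707981380591288304558356 .leaf .leaf) .leaf) (.node 3524035775 (.node
  32015916528662174145004682273124 .leaf .leaf) .leaf)) (.node 3926626432 (.node 2483627071 (.node
  611389 .leaf .leaf) .leaf) (.node 288862467430498631 (.node 2248763 .leaf .leaf) .leaf))) (.node
  2752008282 (.node 3658174546 (.node 1812374527 (.node 663 .leaf .leaf) .leaf) (.node 3926795519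
  (.node 110004037631314860264668438756483740386593090655781017 .leaf .leaf) .leaf)) (.node
  4027445414 (.node 2819245183 (.node 330694799589559476256932 .leaf .leaf) .leaf) (.node
  114258108827646889868823023141921038 (.node 59 .leaf .leaf) .leaf))))
def tab110010 : Tab :=
  .node 1141059614 (.node 1510289428 (.node 1879461958 (.node 2819182698 (.node 536994711 (.node
  131137352596420447829685404691587328 .leaf .leaf) .leaf) (.node 3222004887 (.node 2485784628 .leaf
  .leaf) .leaf)) (.node 3725348962 (.node 2080867351 (.node 35661340780597875592951036535058 .leaf
  .leaf) .leaf) (.node 3993928983 (.node 26858862190679398155112840354009143307006264946745 .leaf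
  .leaf) .leaf))) (.node 2550681660 (.node 3456847924 (.node 1476740055 (.node
  155157589960211816231920334892654894 .leaf .leaf) .leaf) (.node 3691865303 (.node
  1042247278849717036280483935970441477904442286636895796297968 .leaf .leaf) .leaf)) (.node
  3960238222 (.node 2584314967 (.node 31076630305777746262993761167510799658539047248093 .leaf
  .leaf) .leaf) (.node 24725953395209979538766193063 (.node 43977483098302328174443988481415061557
  .leaf .leaf) .leaf)))) (.node 1812271154 (.node 2382893092 (.node 3255496730 (.node 1006871479
  (.node 148665475248148476970746665560670452 .leaf .leaf) .leaf) (.node 3490481335 (.node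
  37404785812709987343645976158626 .leaf .leaf) .leaf)) (.node 3893047418 (.node 2382930999 (.node
  781 .leaf .leaf) .leaf) (.node 271378032753672487 (.node 71 .leaf .leaf) .leaf))) (.node
  2751991894 (.node 3624595532 (.node 1778803703 (.node 523 .leaf .leaf) .leaf) (.node 3859694839
  (.node 7698260013218 .leaf .leaf) .leaf)) (.node 4027429026 (.node 2819212407 (.node
  330694795087882735378468 .leaf .leaf) .leaf) (.node 110363093747245883800387560999543042 (.node
  617 .leaf .leaf) .leaf))))
def tab110011 : Tab :=
  .node 1174655016 (.node 1678077988 (.node 2215104532 (.node 3020615688 (.node 839058343 (.node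
  138927700288247527723252018450522360 .leaf .leaf) .leaf) (.node 3322684583 (.node 37767 .leaf
  .leaf) .leaf)) (.node 3758944364 (.node 2282251303 (.node 877 .leaf .leaf) .leaf) (.node
  4027499815 (.node 129136222381783572618 .leaf .leaf) .leaf))) (.node 2584277062 (.node 3524005952
  (.node 1644544999 (.node 127891 .leaf .leaf) .leaf) (.node 3758965991 (.node
  13007525483020551861721164648218724 .leaf .leaf) .leaf)) (.node 3993833624 (.node 2752111719
  (.node 26286717157300062606083675231010967 .leaf .leaf) .leaf) (.node
  90238030036284652344222827116732658 (.node 206072538883216852647609421625222103188 .leaf .leaf)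
  .leaf)))) (.node 1845866556 (.node 2517086258 (.node 3322654758 (.node 1174668231 (.node
  150613221014520293742263655095148852 .leaf .leaf) .leaf) (.node 3524068551 (.node 242607 .leaf
  .leaf) .leaf)) (.node 3926642820 (.node 2550727751 (.node 649 .leaf .leaf) .leaf) (.node
  1286966154238598676839 (.node 1667003042463414507544890720495 .leaf .leaf) .leaf))) (.node
  2785587296 (.node 3691753560 (.node 1845937159 (.node 517 .leaf .leaf) .leaf) (.node 3960349959
  (.node 29280495893299812313951667924309572576831091709047424715360924381348 .leaf .leaf) .leaf))
  (.node 134243207 (.node 3020620935 (.node 30969120560709982 .leaf .leaf) .leaf) (.node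
  123996042901103502847299834650591484 .leaf .leaf))))
def tab110100 : Tab :=
  .node 1107488794 (.node 1510281234 (.node 1879453764 (.node 2819174504 (.node 503432083 (.node
  127891374971544714813571706817528088 .leaf .leaf) .leaf) (.node 3154871443 (.node
  533903028654600033743003 .leaf .leaf) .leaf)) (.node 3725340768 (.node 1980187667 (.node 390113
  .leaf .leaf) .leaf) (.node 3993912595 (.node 458791 .leaf .leaf) .leaf))) (.node 2550673466 (.node
  3456839730 (.node 1376060371 (.node 155157114475151520070399251323445534 .leaf .leaf) .leaf)
  (.node 3658319059 (.node 892748614613843608346182514684835391964930284 .leaf .leaf) .leaf)) (.node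
  3960230028 (.node 2584298579 (.node 1454532486872036045813530415608070832271 .leaf .leaf) .leaf)
  (.node 2998679 (.node 672071780 .leaf .leaf) .leaf)))) (.node 1778700334 (.node 2349322272 (.node
  3154858004 (.node 1006855091 (.node 146068693341694902861880930597994764 .leaf .leaf) .leaf)
  (.node 3456935091 (.node 36295320738078266293671142482338 .leaf .leaf) .leaf)) (.node 3859476598
  (.node 2382914611 (.node 513047 .leaf .leaf) .leaf) (.node 2089239 (.node 458821 .leaf .leaf)
  .leaf))) (.node 2718421074 (.node 3524030534 (.node 1678124019 (.node 593 .leaf .leaf) .leaf)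
  (.node 3826132211 (.node 6869005591695408508094379316692329649665458317 .leaf .leaf) .leaf))
  (.node 4027420832 (.node 2785682547 (.node 19710947535040521 .leaf .leaf) .leaf) (.node
  109064702349096620802245918872068338 (.node 132 .leaf .leaf) .leaf))))
def tab110101 : Tab :=
  .node 1174646822 (.node 1644507168 (.node 2215096338 (.node 2819207280 (.node 671245219 (.node
  132435744149349994672614888046911792 .leaf .leaf) .leaf) (.node 3322668195 (.node
  1313156912112843074076956 .leaf .leaf) .leaf)) (.node 3758936170 (.node 2215117859 (.node 631
  .leaf .leaf) .leaf) (.node 4027483427 (.node 7699400827120 .leaf .leaf) .leaf))) (.node 2584268868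
  (.node 3490435132 (.node 1610990563 (.node 155806785794719204167601855269470558 .leaf .leaf)
  .leaf) (.node 3725436131 (.node 179697091818157704920568233922322995880019 .leaf .leaf) .leaf))
  (.node 3993825430 (.node 2718565475 (.node 2150101010 .leaf .leaf) .leaf) (.node
  1028653739889223107031 (.node 28158151371079832 .leaf .leaf) .leaf)))) (.node 1845858362 (.node
  2483515438 (.node 3322646564 (.node 1141121987 (.node 150612904024480092457239438282727716 .leaf
  .leaf) .leaf) (.node 3524052163 (.node 1861052915557251423928686 .leaf .leaf) .leaf)) (.node
  3926634626 (.node 2517181507 (.node 693 .leaf .leaf) .leaf) (.node 705758012809538765143 (.node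
  155862347517302460219684 .leaf .leaf) .leaf))) (.node 2785579102 (.node 3691745366 (.node
  1845920771 (.node 988445 .leaf .leaf) .leaf) (.node 3926811907 (.node
  609867103585375956729801699091944101175462 .leaf .leaf) .leaf)) (.node 4027453608 (.node
  2919941251 (.node 1851601642075640093958789576679666704818214 .leaf .leaf) .leaf) (.node
  120750064928057131470700288039428340 .leaf .leaf))))
def tab110110 : Tab :=
  .node 1141067808 (.node 1610928154 (.node 2080862216 (.node 2819190892 (.node 637674395 (.node
  131786389858517589740851751105601808 .leaf .leaf) .leaf) (.node 3255567515 (.node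
  26785580940872324816843568382274 .leaf .leaf) .leaf)) (.node 3725357156 (.node 2148000795 (.node
  495 .leaf .leaf) .leaf) (.node 3993945371 (.node 458919 .leaf .leaf) .leaf))) (.node 2584252480
  (.node 3490418744 (.node 1510294491 (.node 155806310309658896474050288401416510 .leaf .leaf)
  .leaf) (.node 3691881691 (.node 1669052814436495635673903153205 .leaf .leaf) .leaf)) (.node
  3993809042 (.node 2684994651 (.node 793239803060519767688384527 .leaf .leaf) .leaf) (.node
  88944012976567 (.node 38074567802743038061 .leaf .leaf) .leaf)))) (.node 1812279348 (.node
  2382901286 (.node 3289067550 (.node 1107551163 (.node 149314829461590746899334171739824388 .leaf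
  .leaf) .leaf) (.node 3490497723 (.node 898255 .leaf .leaf) .leaf)) (.node 3893055612 (.node
  2450064443 (.node 5378605725543775606848643322 .leaf .leaf) .leaf) (.node 311 (.node
  38052330937009717300 .leaf .leaf) .leaf))) (.node 2752000088 (.node 3658166352 (.node 1812358139
  (.node 735 .leaf .leaf) .leaf) (.node 3893249275 (.node 31532070346178723 .leaf .leaf) .leaf))
  (.node 4027437220 (.node 2819228795 (.node 80736041103828201498 .leaf .leaf) .leaf) (.node
  113608913070529653081159809971118334 (.node 162 .leaf .leaf) .leaf))))
def tab110111 : Tab :=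
  .node 1376047112 (.node 1678086182 (.node 2315743258 (.node 3121278990 (.node 872620971 (.node
  142173678261293896793445468455616768 .leaf .leaf) .leaf) (.node 3389818027 (.node 365527 .leaf
  .leaf) .leaf)) (.node 3758952558 (.node 2315813931 (.node 5804251536098531064146944254 .leaf
  .leaf) .leaf) (.node 1974519 (.node 528941978424093595738336 .leaf .leaf) .leaf))) (.node
  2684842060 (.node 3524014146 (.node 1644561387 (.node 613 .leaf .leaf) .leaf) (.node 3758982379
  (.node 29219982714799176645913602236481646 .leaf .leaf) .leaf)) (.node 3993841818 (.node
  2752128107 (.node 330612926120031881850947 .leaf .leaf) .leaf) (.node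
  97379181739286854679054135550009592 (.node 6874548674580 .leaf .leaf) .leaf)))) (.node 1879437376
  (.node 2517094452 (.node 3322662952 (.node 1174684619 (.node 153859039912262174512493984780542206
  .leaf .leaf) .leaf) (.node 3624748235 (.node 69972973740351 .leaf .leaf) .leaf)) (.node 3960213640
  (.node 2550744139 (.node 17465708699 .leaf .leaf) .leaf) (.node 5346989562235690924122487 (.node
  1921923644899076754628645956402006098234489479409 .leaf .leaf) .leaf))) (.node 2785595490 (.node
  3691761754 (.node 1879475211 (.node 847 .leaf .leaf) .leaf) (.node 3960366347 (.node
  81491523697311432394058977363320428014012235075175082819384281598580787839467370608020275340 .leaf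
  .leaf) .leaf)) (.node 302056331 (.node 3087754379 (.node
  3458826125023328223896288075529350444393980055 .leaf .leaf) .leaf) (.node
  126592983496005307586630047436497144 .leaf .leaf))))
def tab111000 : Tab :=
  .node 1006874676 (.node 1476751436 (.node 1879486560 (.node 2785693838 (.node 436306833 (.node
  127891216476524613017856550108283152 .leaf .leaf) .leaf) (.node 3154863249 (.node
  8982672175656549394431130407414144705090549585555588321545564664946276650262839700414478 .leaf
  .leaf) .leaf)) (.node 3725422784 (.node 1879499793 (.node 739 .leaf .leaf) .leaf) (.node
  3993904401 (.node 1879498851 .leaf .leaf) .leaf))) (.node 2550739072 (.node 3423383726 (.node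
  1376052177 (.node 154508394164399513095872354660589846 .leaf .leaf) .leaf) (.node 3658310865
  (.node 3174929670417211671752510718062 .leaf .leaf) .leaf)) (.node 3960369346 (.node 2584290385
  (.node 473858279011424855610296838030164861354524763 .leaf .leaf) .leaf) (.node
  834916190996426097039 (.node 38052332034608132237 .leaf .leaf) .leaf)))) (.node 1678127194 (.node
  2349371514 (.node 3154874546 (.node 973308849 (.node 145419656079597770176338970742505732 .leaf
  .leaf) .leaf) (.node 3456926897 (.node 28688101561043005647402680074526 .leaf .leaf) .leaf))
  (.node 3759010002 (.node 2349376561 (.node 303 .leaf .leaf) .leaf) (.node 15571296527 (.node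
  31527398042808544 .leaf .leaf) .leaf))) (.node 2718560378 (.node 3524063428 (.node 1678115825
  (.node 283583 .leaf .leaf) .leaf) (.node 3759006961 (.node
  48322757199794525986422163788216468769295162492133680489358030959788182 .leaf .leaf) .leaf))
  (.node 4027470038 (.node 2785674353 (.node 4812243050662 .leaf .leaf) .leaf) (.node
  106467920094472415252112625124745458 (.node 101 .leaf .leaf) .leaf))))
def tab111001 : Tab :=
  .node 1174671416 (.node 1644556368 (.node 2181566582 (.node 2819248280 (.node 671237025 (.node
  132435585654329895183305827943735592 .leaf .leaf) .leaf) (.node 3289130145 (.node 4678017 .leaf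
  .leaf) .leaf)) (.node 3758977226 (.node 2215109665 (.node 1379265440755911702454516 .leaf .leaf)
  .leaf) (.node 4027475233 (.node 31527398026149908 .leaf .leaf) .leaf))) (.node 2584301706 (.node
  3490500794 (.node 1577436129 (.node 155806785794719194941977468710945110 .leaf .leaf) .leaf)
  (.node 3725427937 (.node 2614935741565230279599519989818 .leaf .leaf) .leaf)) (.node 3993923788
  (.node 2718557281 (.node 12996669898162848218981240234150 .leaf .leaf) .leaf) (.node 22115828175
  (.node 17278803239695967885400507868988324349062314379016228177058128112 .leaf .leaf) .leaf))))
  (.node 1845923926 (.node 2382942340 (.node 3289133236 (.node 1141113793 (.node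
  150612745529459988355118184967414044 .leaf .leaf) .leaf) (.node 3524043969 (.node
  2257823959178290256421340 .leaf .leaf) .leaf)) (.node 3926806712 (.node 2517173313 (.node 152473
  .leaf .leaf) .leaf) (.node 291085405265330511 (.node 90239773830026179369557246166237295 .leaf
  .leaf) .leaf))) (.node 2752131204 (.node 3658322100 (.node 1845912577 (.node 699 .leaf .leaf)
  .leaf) (.node 3926803713 (.node 847602758806809435667818457905404017751949408 .leaf .leaf) .leaf))
  (.node 4027502814 (.node 2819253377 (.node 5546768974598621007491634470971 .leaf .leaf) .leaf)
  (.node 114258267322666991664538179851165974 (.node 293 .leaf .leaf) .leaf))))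
def tab111010 : Tab :=
  .node 1141116978 (.node 1510314066 (.node 1879502948 (.node 2819231892 (.node 604119961 (.node
  131786231363497485638730497790288136 .leaf .leaf) .leaf) (.node 3255559321 (.node
  1122601149434191428381106194 .leaf .leaf) .leaf)) (.node 3725439172 (.node 2080875545 (.node 585
  .leaf .leaf) .leaf) (.node 3993937177 (.node 31536674517561375 .leaf .leaf) .leaf))) (.node
  2550755460 (.node 3456946356 (.node 1476748249 (.node 155157589960211825457544721451180342 .leaf
  .leaf) .leaf) (.node 3691873497 (.node 4874667585433519091657814031 .leaf .leaf) .leaf)) (.node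
  3960385734 (.node 2651440217 (.node 19336859872003375085042418122785 .leaf .leaf) .leaf) (.node
  24880733688157668401761690031 (.node 155953428876917062803586 .leaf .leaf) .leaf)))) (.node
  1812369488 (.node 2382925952 (.node 3255570606 (.node 1073996729 (.node
  149314670966570642797212918424510716 .leaf .leaf) .leaf) (.node 3490489529 (.node 21748408761
  .leaf .leaf) .leaf)) (.node 3893252274 (.node 2382939193 (.node 24408155639377671456773112881396
  .leaf .leaf) .leaf) (.node 153159367370293551 (.node 969 .leaf .leaf) .leaf))) (.node 2752114816
  (.node 3624759470 (.node 1778811897 (.node 15472345353 .leaf .leaf) .leaf) (.node 3893241081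
  (.node 19986167445540879 .leaf .leaf) .leaf)) (.node 4027486426 (.node 2819220601 (.node
  153376788588363103845751945889040891959172421373641646176 .leaf .leaf) .leaf) (.node
  112959875847127584437596520470135030 (.node 603 .leaf .leaf) .leaf))))
def tab111011 : Tab :=
  .node 1174687804 (.node 1678110806 (.node 2215129212 (.node 3020632238 (.node 872612777 (.node
  141524482542871733273385312197845240 .leaf .leaf) .leaf) (.node 3322692777 (.node 562215 .leaf
  .leaf) .leaf)) (.node 3758993614 (.node 2315805737 (.node 406503 .leaf .leaf) .leaf) (.node
  4027508009 (.node 528941958431946045976715 .leaf .leaf) .leaf))) (.node 2584318094 (.node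
  3524047040 (.node 1644553193 (.node 699 .leaf .leaf) .leaf) (.node 3758974185 (.node
  79562845428532719649 .leaf .leaf) .leaf)) (.node 3993940176 (.node 2752119913 (.node
  330694808617176267964484 .leaf .leaf) .leaf) (.node 94782399368605770444227591103529202 (.node
  844073114400171729553443896055494393516151 .leaf .leaf) .leaf)))) (.node 1845940314 (.node
  2517184634 (.node 3322687674 (.node 1174676425 (.node 153210002688860105868930695279558902 .leaf
  .leaf) .leaf) (.node 3591193801 (.node 84462701707837728 .leaf .leaf) .leaf)) (.node 3926823100
  (.node 2550735945 (.node 43655015945511025 .leaf .leaf) .leaf) (.node 5309201525219362291016047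
  (.node
  29821931054006526652803162792610660778270577454893590143068148418857514854045097416281363715385635840434324
  .leaf .leaf) .leaf))) (.node 2785677450 (.node 3691876538 (.node 1879467017 (.node 533 .leaf
  .leaf) .leaf) (.node 3960358153 (.node 31535783010168942 .leaf .leaf) .leaf)) (.node 234931081
  (.node 3020629129 (.node 286789 .leaf .leaf) .leaf) (.node 123996201396123606949421087965905156
  .leaf .leaf))))
def tab111100 : Tab :=
  .node 1107562542 (.node 1510305872 (.node 1879494754 (.node 2819223698 (.node 536986517 (.node
  130488156877998284309625248433815800 .leaf .leaf) .leaf) (.node 3154879637 (.node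
  2186205521825044372559917071 .leaf .leaf) .leaf)) (.node 3725430978 (.node 2047312917 (.node 713
  .leaf .leaf) .leaf) (.node 3993920789 (.node
  179808518500535780410307186509318700231448701918941610756578485205784452136188176883756330889809133925587927447319667025158170
  .leaf .leaf) .leaf))) (.node 2550747266 (.node 3456938162 (.node 1443185621 (.node
  155157431465191716742611274789478694 .leaf .leaf) .leaf) (.node 3691857109 (.node
  236066455978485025578148004559956111209213693615757484090 .leaf .leaf) .leaf)) (.node 3960377540
  (.node 2584306773 (.node 27405631676589251442834339829364176736894523162731 .leaf .leaf) .leaf)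
  (.node 5998821558140099839426975 (.node 135228 .leaf .leaf) .leaf)))) (.node 1778815052 (.node
  2349379708 (.node 3154882740 (.node 1006863285 (.node 146068851836715004657596087307239700 .leaf
  .leaf) .leaf) (.node 3456943285 (.node 1466848376815400837537 .leaf .leaf) .leaf)) (.node
  3859697838 (.node 2382922805 (.node 1804382211362353636081932 .leaf .leaf) .leaf) (.node
  65711661293855 (.node 225 .leaf .leaf) .leaf))) (.node 2718568572 (.node 3524071622 (.node
  1745249269 (.node 27895084795616804775301645254936 .leaf .leaf) .leaf) (.node 3859686645 (.node
  335312246557572604776601 .leaf .leaf) .leaf)) (.node 4027478232 (.node 2785690741 (.node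
  13392538584043858728557163933749 .leaf .leaf) .leaf) (.node 110362776757205682515363344321372410
  (.node 83 .leaf .leaf) .leaf))))
def tab111101 : Tab :=
  .node 1174679610 (.node 1644564562 (.node 2215121018 (.node 2819256474 (.node 771933093 (.node
  136330917917566443488425474004041970 .leaf .leaf) .leaf) (.node 3322676389 (.node
  35502342809417084598375304389052 .leaf .leaf) .leaf)) (.node 3758985420 (.node 2215126053 (.node
  257 .leaf .leaf) .leaf) (.node 4027491621 (.node 7697118634092 .leaf .leaf) .leaf))) (.node
  2584309900 (.node 3490508988 (.node 1610998757 (.node 613 .leaf .leaf) .leaf) (.node 3725444325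
  (.node 55595433148424 .leaf .leaf) .leaf)) (.node 3993931982 (.node 2752103525 (.node
  129158177641225019560 .leaf .leaf) .leaf) (.node 3686879 (.node 28158151958646883 .leaf .leaf)
  .leaf)))) (.node 1845932120 (.node 2483630198 (.node 3322679480 (.node 1174660037 (.node
  150613062519500194252954594991972652 .leaf .leaf) .leaf) (.node 3524060357 (.node 234413 .leaf
  .leaf) .leaf)) (.node 3926814906 (.node 2517189701 (.node 431093 .leaf .leaf) .leaf) (.node
  2539871 (.node 2268095733910 .leaf .leaf) .leaf))) (.node 2785669256 (.node 3691868344 (.node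
  1845928965 (.node 32332945348962402732381146964308 .leaf .leaf) .leaf) (.node 3926820101 (.node
  1745253556567419310562689820347677050731637521078767475728523 .leaf .leaf) .leaf)) (.node
  4027511008 (.node 2987066501 (.node 19710946058604612 .leaf .leaf) .leaf) (.node
  123346847182681337020833581786751220 .leaf .leaf))))
def tab111110 : Tab :=
  .node 1141125172 (.node 1611001932 (.node 2080878710 (.node 2819240086 (.node 637682589 (.node
  131786548353537691536566907814846744 .leaf .leaf) .leaf) (.node 3289113757 (.node 3719421 .leaf
  .leaf) .leaf)) (.node 3725447366 (.node 2181555229 (.node 805 .leaf .leaf) .leaf) (.node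
  4027458845 (.node 7697572102363 .leaf .leaf) .leaf))) (.node 2584293512 (.node 3490492600 (.node
  1510302685 (.node 155806468804678998269765445110661446 .leaf .leaf) .leaf) (.node 3725411549
  (.node 2285003106714907873332023348224006636325181477791945084969102 .leaf .leaf) .leaf)) (.node
  3993915594 (.node 2685002845 (.node 8798866632938 .leaf .leaf) .leaf) (.node 366567019642978751
  (.node 135277 .leaf .leaf) .leaf)))) (.node 1812377682 (.node 2382934146 (.node 3289125042 (.node
  1107559357 (.node 149963866723687879584876131595313420 .leaf .leaf) .leaf) (.node 3490505917
  (.node 1596551951236420953481564 .leaf .leaf) .leaf)) (.node 3893260468 (.node 2483618877 (.node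
  652377 .leaf .leaf) .leaf) (.node 1173955071483261919551 (.node 2268095213669 .leaf .leaf)
  .leaf))) (.node 2752123010 (.node 3658313906 (.node 1812366333 (.node 521 .leaf .leaf) .leaf)
  (.node 3893257469 (.node 1191432213 .leaf .leaf) .leaf)) (.node 4027494620 (.node 2819236989
  (.node 4812243050565 .leaf .leaf) .leaf) (.node 114257791837606688583798806463750406 (.node 110
  .leaf .leaf) .leaf))))
def tab111111 : Tab :=
  .node 1376063564 (.node 1678119000 (.node 2315817078 (.node 3121320110 (.node 939746221 (.node
  144770301866155500247751464563351796 .leaf .leaf) .leaf) (.node 3423372461 (.node 816291 .leaf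
  .leaf) .leaf)) (.node 3759001808 (.node 2349360173 (.node 316365 .leaf .leaf) .leaf) (.node
  3727615 (.node 121224712191428366559590502258481599010096934218760413 .leaf .leaf) .leaf))) (.node
  2685005942 (.node 3524055234 (.node 1678099437 (.node 561 .leaf .leaf) .leaf) (.node 3758990573
  (.node 7698259198013 .leaf .leaf) .leaf)) (.node 3993948370 (.node 2785657965 (.node
  5548138238692307681149281697858 .leaf .leaf) .leaf) (.node 99975963993911060229187429297332472
  (.node 279 .leaf .leaf) .leaf)))) (.node 1879478366 (.node 2517192828 (.node 3322695868 (.node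
  1275372493 (.node 154507918679339210015132981273174278 .leaf .leaf) .leaf) (.node 3624756429
  (.node 42353903456681378667298780360041943447048820070265863314052818485328 .leaf .leaf) .leaf))
  (.node 3960361152 (.node 2550752333 (.node 11425898649 .leaf .leaf) .leaf) (.node 19130573183
  (.node 540973352281431322130876916004601601629451912997146634711064740 .leaf .leaf) .leaf)))
  (.node 2785685644 (.node 3691884732 (.node 1879483405 (.node 599 .leaf .leaf) .leaf) (.node
  3960374541 (.node 1879298107 .leaf .leaf) .leaf)) (.node 335610765 (.node 3121308813 (.node
  1883224149520766789478797879469686182502422828473529128370365 .leaf .leaf) .leaf) (.node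
  127242179214427471106690203694268672 .leaf .leaf))))
def table : Tab :=
  .node 302051336 (.node 318824457 (.node 352378889 (.node 352395279 (.node 553771035 (.node
  688013343 tab000000 tab000001) (.node 889397295 tab000010 tab000011)) (.node 654458907 (.node
  688021537 tab000100 tab000101) (.node 990085167 tab000110 tab000111))) (.node 553754633 (.node
  654417935 (.node 687996949 tab001000 tab001001) (.node 990044175 tab001010 tab001011)) (.node
  687988755 (.node 889380873 tab001100 tab001101) (.node 1023614995 tab001110 tab001111)))) (.node
  352395273 (.node 520200201 (.node 620863503 (.node 654442517 tab010000 tab010001) (.node 956489743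
  tab010010 tab010011)) (.node 620879891 (.node 855826441 tab010100 tab010101) (.node 956506131
  tab010110 tab010111))) (.node 553771017 (.node 654458895 (.node 688021525 tab011000 tab011001)
  (.node 990085135 tab011010 tab011011)) (.node 688013331 (.node 889397257 tab011100 tab011101)
  (.node 1023639571 tab011110 tab011111))))) (.node 335605768 (.node 335622152 (.node 503427080
  (.node 604090382 (.node 637669396 tab100000 tab100001) (.node 939716622 tab100010 tab100011))
  (.node 604106770 (.node 839053320 tab100100 tab100101) (.node 939733010 tab100110 tab100111)))
  (.node 536997896 (.node 637685774 (.node 671248404 tab101000 tab101001) (.node 973312014 tab101010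
  tab101011)) (.node 671240210 (.node 872624136 tab101100 tab101101) (.node 1006866450 tab101110
  tab101111)))) (.node 335622158 (.node 536981512 (.node 637644814 (.node 671223828 tab110000
  tab110001) (.node 973271054 tab110010 tab110011)) (.node 671215634 (.node 872607752 tab110100
  tab110101) (.node 1006841874 tab110110 tab110111))) (.node 536997914 (.node 637685786 (.node
  671248416 tab111000 tab111001) (.node 973312046 tab111010 tab111011)) (.node 671240222 (.node
  872624174 tab111100 tab111101) (.node 1006866482 tab111110 tab111111)))))

def hints0 : List ℕ :=
  [1189, 1653, 1269, 1751, 1057, 1779, 1035, 2220, 1271, 9033647, 1441, 9054127, 1215, 1097, 2222,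
  1319, 1541, 1329, 1165, 1235, 7637168, 1121, 2233, 1799, 1761, 1309, 1123, 8152888, 1029, 2244,
  1229, 1453, 9058223, 1471, 8288090, 1381, 1317, 1393, 1089, 1295, 9041839, 1633, 7616712, 1255,
  1369, 9090991, 1513, 7755955, 1373, 2258, 1085, 8283994, 1289, 2237, 2264, 8419162, 1077, 1135,
  2230, 1111]
def hints1 : List ℕ :=
  [1543, 1455, 1823, 2251, 1169, 1409, 8574810, 1535, 1021, 1157, 2276, 1009, 8206155, 8091448,
  1109, 1607, 1113, 1193, 1737, 1015, 9017263, 9021359, 1241, 1559, 1049, 1677, 8558447, 1533, 1597,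
  1657, 1521, 1557, 1343, 1037, 1191, 1593, 33327261515, 9070511, 1469, 130467056576714, 1491,
  9086895, 8705882, 8197963, 1553, 1741, 1213, 1577, 1821, 1023, 1033, 1293, 2291, 7579932, 2221,
  2266, 2298, 2315, 2324, 1517]
def hints2 : List ℕ :=
  [1297, 1149, 135683311261496, 1435, 1013, 1529, 1305, 2238, 2270, 1017, 31131109677, 1693,
  551850971036211488, 1489, 1797, 31231875354, 7719205, 9062319, 1203, 8382766, 1045, 37590403384,
  33192941371, 1075, 1079, 1233, 1151, 9045935, 1777, 1617, 1253, 2257, 1133, 38916053314,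
  528767823788337476, 1311, 8177949, 1073, 1299, 7727345, 2269472347337213990712, 1565,
  139944187369774, 1743, 1749, 2236, 1605, 1665, 2381, 161667712551248, 8112454, 8132442, 1307,
  1153, 33060788024, 136645902120769, 1177, 33444599611, 1431, 1069]
def hints3 : List ℕ :=
  [135339713877816, 36917934421, 1375, 9074607, 148397287037254, 1195, 1047, 135889570425117,
  2329437215556388546873, 1433, 1429, 9093268956440327756355946, 8247105, 129851299121451, 1231,
  1201, 1333, 1353, 1341, 1713, 9066415, 1659, 12557624355749969983468040580404911879055727,
  1589432681702477764961092811924534947645100011901661440402694207760607451673571717460304865390412446926284661012442215681849239047482160345524445,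
  17531410083717875335518012720423193525585074453823139759686050205531878521231683, 9925894,
  9931129, 1135879, 824115595732843250101147900362284878191661735386107629709375775701915971,
  5181681, 23556878741, 1131782,
  207618258138939744903314802228910935308260387281922527127649568134987,
  4017961685151857230902901133859110764376303063044036667957677471923993546595971094101338929448,
  157859085739924781162643886184744,
  244225561001279610832250131524750436780376278757317276713077028296167324079445655693533,
  88061544274301, 2775610236000728619304, 790027787952712080008527264292043097,
  17645960286879095246134058872402743241981610311937918239547647226281410790621426,
  674261312280638583, 10646406288807144107325295, 46083616926699419982501841194,
  448888348715270176643170455751756156855694388901394334550164422459196725604608113779164425336967267031246493123665356719218633657271410688242,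
  62284143168625278406746272876807532042206599749437891585109842243,
  850836482032258197928075412600247973865805202209866249007570934658545960, 679047417929020655,
  13027926149273827844670803399301755806845580941576219879344426, 9008219124737665378924836,
  12067642903770211856575234644659065253836719, 681303204698978093, 2396313701813321033547,
  743944163715426041394152774004647745, 200268373800680507461537733438595960141384818524638,
  190183576441986190608592355259399, 3176048169761375442045996713167033352055521736463815428441,
  10646383232901001078159215, 50739498449196634425604916385196074736159799266854652969431078731,
  12387580524928485460822273998937843600950517097374590027700043, 565894271116080363]
def hints4 : List ℕ :=
  [35432057468755893220237262156271097206437537500155638994442586966372836021383214101675412768641945951925042106585912175279831909879210723684825373886689309670493750527883,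
  187173138461418744530160389890048, 30639248228, 3950370,
  546471116346773459180434706502127378250066963931861509717259053691568950370100716834146883690266433783746091547602676464818546529699936704474628751332561074668959557034034948345,
  395484180271054721259503383587961955560549507196539283876403671160789119414871018819400319972445088988232424552000816457189,
  171289240397514908113407252574947702135874050957150893494207809649343036180098653307636973657167452269056696571408505231752120133433266164880585874087349978926585351751004601023265734641758441,
  4246579597779401371328214323429083872308278902506208249944737277403386128267,
  3014146980082611158319109824444438995213562773606693477403493848492752312950453628917115061415635946715054103142788013680775760903071852981457521544525730618081030528696736693456638731842254315834517489425849239201465381124880228216356259072131887015583746685368093463544876782004035517628813354352172763987142535387296688073364009805122387404100909068849172421112272580287469034983083815823609,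
  5189057520697650300431079096547705518056966456760674937560370416724895652751323490585499700159677413562686499077,
  10797541624945842566133643,
  5799545549550869596145757331952221182042447369130832737772861499829843485267986837267937793797264872605316376825,
  99689358907314458812389049224077885991430432666432653042096787971276120465275665117970776275928063786035414959991796704400231164768561415,
  299835320396387431373245410042768359103667470492613949995789369531212756719985109703026, 5407016,
  127079284215812, 9083958886613689193370886,
  4242067973527030826179625471521781196883609364306344971991928529208050824363170806596316879171,
  3291794666791363634596341271469408526890,
  4377086393397121865751869810075352834350178854940853607749497763460539165001,
  186384019037534525439990609766972918618424787937630, 194763331764806086498883574335885,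
  172674972566162021721704449975795843128607670178808827105283643620666620130808639000002208127882140103707278381227622674482893927942646349238331437425937013545926561211064772813603947658123506,
  9881401374347420646176651, 5521736,
  985424800746928200528879686923933293982527803670277382007463473803889136745064941652748617,
  57964549275528335161443875746514752661889164589700483736346605423, 36047397141961182299737658489,
  92297510848250229254262833527256675510862649943595117676612998132461708212113510628025850592683390730967078911163537650,
  533760778340747661,
  30566015465729372331090471521592533228345565964653014657378330859986297162615314687405929781698729713430064836232332781842540423940975449805557272451314,
  196154588526195540580260196001356354621024494037031982136313433527283,
  42295749596555621150041176363308972592992719993, 2384773228794044188481,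
  18952371805283640198148492469768562071571402307370696659845168848443569746696821600215495322183535,
  2285619442136293549883,
  374019543548664840595741376456962163616925994832297272024354255312880201222572563954029389822529419255903350170364123347164,
  450380367638160110413058643949963030684494177959447233142345643576318331912202892101575580854423728223706632520440940433268423230373636415764,
  132532815119758,
  30080631902313850821948168090858640774909566697704685028608520228926766599968786318016903707486027381904232801724863897344003252571943736078953188738598784906126728952028,
  20843436130425027233182759601116633548275006170970472702632993992896449294641349411129721013704946,
  181152784796462964186242868508555,
  8711618009212567800920234092028603012225325510503957905835956785930081317102061977973408133764174800184569134271415181097667582875943286514405797635884128486035235090,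
  1138876683317174766592583404494496123178814837873039697079115958787351120793773320623906333484712099166278156474333749258065292830068171120690776904036979575995020738733839792257845946498606324226022609459419530263610443607601136379136853652099583278581261796171221389,
  18241697672631248552339308323170616737648738323285569100772603274036945530864184615991957089226411881321701953761321,
  10254779,
  18244658830052796828381017925450816756290994181193402910064873367296743822463243731156981538620707450069812929534335,
  382088956298202279747797771647402615473851543442979351819412135861157004741794842062868575358572390386699236162438717883848,
  99531206188029709712363680373344761218714654066300200215251889017280229439579900408858770736624085160805044052990362395895311331332351342884293944230948511046876776731085002640312013639035406352731800159463180740713018360836246030882968463103384869260584108326865415757062899649041163542454149396,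
  5343490214767312261090242184479386474316833393448590893254542844849294854093284502327353528302338693178970083387988924919216084795,
  40003675764035254504741551617375892579834505291211461838937974076067975010887621251274190558316466933574480242953208472761288875566841385190184428421390317770666432841033871030434287036240333940262848755932,
  1649634902064543915626261980368289233302490863307961720336363573349513202648803356506292051242994340576254859923177198271815796,
  180262910178531189014318341743071505657741958190923,
  11149664099805443515189725893505276582523231800754026598191760789957280399560861170303252879739193288711966945192788568016739304462507159035723065027092207829507575894302843512619654002130831192950908027083516021044520815,
  1919245692465802360308411830369520542767095513713228928258227167211478551481975756684648566759979588536683411689490234261179469324579754970496848375959672139221311053747411312027503,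
  32528001432800675596671888506869067214777316999109416070348497603778284857385857427339928014265917732178218073678596081824382772701162786677882020651588435852166147196847,
  473344719398444937128394689939448069675244938510253260050437784468526341110778245192770349268563426089979293111281393888282943105232297876633615068497425581999,
  40129199023832053247313536322067037068353268275648738462311427878919810435145205528620029589848849531966219094828222320946523063729363988626472113173379851236695935684466817508624646890605187643319487803883440040796568435876886719137846457299734979003007332567767796926372562222394717362546547455037387875596039843938367124735051018928684298123706661676139177725598814568132864485231,
  563079521365583046, 2328283450020775835503]
def hints5 : List ℕ :=
  [2896872510146375624936230833808243467871544245657807701164,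
  18210776670749300733381089579988998024858673792684063766446975438984584443577500,
  2242976852721850015152361186486968264476092415734568687649182410628208675513083305293948451375323028540274007733935571294112577413638087707553202761499379794887328768132936230290438949273343650277448153438442098849114882357838076566059261521527178971797407861794094926320595099809532173867469234170088513236071105640018196876275948913576627412740084512957632519303723135492212,
  1449526131611584271143110475986111773088823380981827127247890176057699643903732571499322931753557726272882662813358892720008312841875833761628990361991004226244745640546580849325488021329547462333621961775148665063305665936180036872043770362022175968103915902687027460093800458849050740,
  8951760215038073313382506,
  25070247805986653662016335138016179216513987199354919921297164886098349316498163572523869861744872639845414392422585653734181688231336,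
  21335130511983049124854367553752423585644890958134645331588955388612865885776635989615607834085307927735467842727546632175749936909368045804752959041053828006760074787631946504179134200889952118509999216495061508808067394673074509320030431422854467008327037027289641107136788,
  2547240959627577114001329496731962757530916597868044388127935166457943907813494079170521128389293093191021401896775754444709200561933108441729832157476132640335652213000080868081358900292378761436044242989294877221140,
  784016675740777756861971301039975074107048430318453349951228369450713302957122636619303174888475699790798476231427752080276562271484535020503505982531735071192138653494381350933797165280706091670798062752177048358084827814514730817,
  40219159624741478546112458046351570296804361360413087617037436923041336965973362784807199853497126175183574194894198224147520674796556549298891325473231255434144460188834198932224415767640323349535204899036,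
  73871546526944466440298710482263078567125714886521128123657413363789371639508556257,
  55573974585679964335092917543153675450812258785, 189946414362450223623476731158530,
  577281461108305431567652366460190988838670514986388069962663671971149931406231019587758158035397918666633210397447729216265004305069173712596118231988454773597312034234977314914249717705799256347,
  777369574316664326784514107689505913,
  14549694855525927596623759925586928859767283031593198725946024098801149316441244,
  7307912959237673229564858193132985229381410273549587666609904587433227287172446506701593143394254877762428483229573680910083483306073404775019185689063735913453390049,
  9720846675436819239450458, 2618818261256105314159,
  32694636290203231002842775891152125473687484459320944651211186862215967919792478073448717469347362850678950277117377747211904118464131079727480680272360812337399801171121377997851314292961,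
  2406688024961545369483, 11321692012306155003184129,
  894889782340928000001456292248323382395025924512557990211874624664474558016444558547894117206381002482051670623169991970925028011958068754645432140408889978573824177278955528086299653917311991061310373845873528234359300996808072481514516192752144344569208443878112806412106157741413651244705046525742059834849475552558646334765461222873488359384544575939727383612008309542229724543873849321874517758678618728628329766395035347035230311081775897525828988221064375723824863973792792003477573900712802587496027040829180767473621169103634825596005153052888537584933703971645890158132207890,
  2397251576977754411734985296186994107516957200191348236572284135591323685380371689434679084171000584224193299315017383032021821988094458241814013100803443589946628242656802982059370010019060249327836,
  15607781229597908469634834581748630671214483057808503861223700,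
  14839256373427370107171180549818158633720684269117509744623359336505646724811103,
  15047792034005522419357755605854878711863089284238375919574337911450601840328028959745876929702511995561528654259221564667973538913039575616946848948533734970207502485183661952335081961231705078256106691825642250532066058318311989926561911619917588777253190,
  716766016693149972,
  59803202428787882657881531912479011815957777424227652496027176595395765327115675897,
  59743944971965785485274675155720167968258802827779483703143640140352993167479863647,
  13875132210121574498141116874543772100676083,
  4504219990467099960780306767543879470761393086752526190763614399763940731129,
  2739873083205860157785, 10011179, 9881401375469197216642955,
  593957043977720608793233071965118173794157365418584105885958830357490531245432722275651852914173356181680402381838317566553330701571825596189429400778688719439908033710454683872,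
  6285831462472055832783902338318006878710374125770211676850205857732948195981311819964346080526984469818752775281185625002349639563,
  175586284626454, 617409552982136413,
  96573675972071482783805966341080119359583155707911129565696103559767584358559639157345730974312654074486057880232069421199348375690478074084262984288015148337136730644743626230595163671576859420543702407581202080500190884111793401188205744193882453604935315064485525159604600044653508117445872614439933657979533121,
  50521894392096599316260502588252431245228046219, 175954734462775, 2407842915416615626635,
  171417583208265675213638884725670338038162708717636, 719019331662275098,
  515820497836111052727747853158400909266267273214538314544245134415438688733096638035327390469275147547892502243211022739981667996272323033137086146441922046201,
  55804887444025501278152773947795371418243749531043218869477999168, 132585114050805,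
  165386457699860175835816185956235, 224382701310822341660569767467839807913409800901875,
  49546060647124171497256277811, 823455488125200852650887273592293878, 43121357757,
  2372098970247099795290,
  2021531159785457059875293873770834443139877117710121192928151527654364277593008225835078373153144738731218798699019329841536703657185018311538258348842942013125223874177850311534841,
  3039241672033199351710241797001123919755, 2361724365075200157505,
  2718889930668616433102848478755391044112, 5685624,
  187022623111641809757042797126199974694105861267508]
def hints6 : List ℕ :=
  [333940187176588108487638373062202160690105643612338016083617581977136705831063186431137475838865548234709963582633329069863248389104153536555125983429832214357033168377796139873417432233319742851683613652009881450961180829720590354314798846262998107160420088672458537213616294262073912478715136902971,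
  12839539517591506064535365761865395638569203499630670305001866,
  207116820127038168584372464453163513670438072882561123278089588218950212234260617829885888346917755847764324472039193550937295644814615836509524113307936803358280617309220116567301715056135704018129924451246512,
  253640786355314889005711716532899372667083119456594715430674424932573,
  3697075920198590500279067581373978888812750510359664729693796363416911673227,
  1040634358535426608845459225161757055893758644482559772891416456209650484878281990026491787,
  8181563, 1039, 35089069935, 1155, 7592232, 31399909618, 1567, 1619, 37203146635, 131293569157317,
  7805152, 8652603, 2213123901572485282012, 1115, 1395, 9025455, 136371026291001, 1763, 8190265,
  1523, 8677185, 1019, 1071, 8611643, 1011, 1243, 34199615297, 8943435, 1331, 8267631, 1355,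
  8096046, 1171, 1443, 1635, 128819701491933, 1579, 1715, 1179, 1679, 7919903, 9004890,
  136302306814265, 37406202219, 8365883, 8554379, 1031, 538909309679372513, 8734523, 1291, 8972629,
  36296914778, 32473495814, 135614858270523]
def hints7 : List ℕ :=
  [34535221067, 1167, 8877883, 1599, 32003737883, 546788545932699911, 2245409924178454386948,
  7657823, 8271727, 35105847151, 1667, 133218369181955, 1695, 8231237, 37823641419, 8390465, 1159,
  1411, 8456555, 1051, 1371, 1099, 38008305519, 155827580266745, 8829253, 9303919, 38177892665,
  1059, 8513355, 9225571330206428644370693, 1087, 8533899, 1335, 9389889, 1091, 8324923,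
  38614161771, 1383, 159194146904366, 9508747, 38966421817, 38983145774, 9746777,
  664972637948421190, 177672132879846,
  380474774377701420059923858417652542408481803500475237790184335727478977093192147771064635424941486424733897394603077648576,
  732250724601709988, 176258073504899006837185980268583373529159212782083,
  237718554383068654120221772691762162844932415674597,
  107077535627638723678921936813949924608284944267905613955238952824131012377573750042459413489163290161425991464386616515195201293220909392951057429932422545,
  2565899618738342726407035078872820375831,
  975144350756031161079122849028445525128836685567772347473499315580482790409292956158766744678599758402500162124806385583502046193729888780334329218336799473909162472631764123891462147545623904492951123134323926590394767484102556656317115080137132480,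
  2810197087429012639809, 167775805834360, 3580226704672806065376974506620640883912,
  90684160436460608011379066677363709599733593723783919158066237239796566811006694849678725857887594680,
  59954564065041331010613694490561103542038545489, 12337030789131220299326505,
  136878803491495355398709949218144075783117823218031837677841144363837133487512294886515461601446759373385645705524058061936939235141025121769859630677451110,
  3558340071162379363191642370203981245005839424746602930618412833349121214591859232106621295537068885079547344085656670291405299801417944259323293940848719848804476490205910757296162629976422975348558330636200251154716]
def hints8 : List ℕ :=
  [663570212463486768, 595171461034261025,
  197733913525848728505835068252913898270864695384120285278165898916906,
  6194222851866783657084257792799243399705929122555452811711655383033967940368143377930264706574604899090763817677,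
  245939515138937123169667755073080528036494576605687,
  246140382012528995923631778404800719175083780696720, 3113438750531569664996,
  5513195802472845443909487288535724094182908846804250092372667161275690231133601820139553948156,
  152879025309643436026534257623586, 14942347133906571137199129323942076935454457789445131459465801,
  78380698912039389585605385096831874351779368059490014815529570325858194006767608864081695884883249711,
  9002332379869044496639266, 872453733828170967287389635038397521,
  81866679820935124697072683871208990882193974390845437755389443743111823658133377350696224279575700521,
  11312235747026120304010281, 281022776875682692614111668374901183742729999531593219653091817362892,
  5845428, 14452272588529841744776049271374111918500342, 164356278938991325064680257368577,
  9796397622763577061188094, 626188685108019227705041113430571513, 51499788826372687819045036988,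
  119776086501130221973908839232827945840067612515599308156604888700121402480957379459601580336589773740452672721852162248890695949813234169,
  663570212346390322, 217439724220284362106674784034172034261073476577561,
  211259393034768031814190060935736, 148446850008260235000237808650637,
  2736771646854082284429867797880237170988041069801861767862060456111917761601807159834536767638738905012931796039295223498467216154471359840527297470125452070402546906132026415544636,
  739568524677101339, 187156075820841, 12625070927314074327098409,
  277442827708877735335608354972322292265887980062571450620597854791302,
  4494318941568047325099662199149714398586514866551008119781198435746936026584300419465308750718709227782975291586,
  32105936214, 27852480634, 4097069754624043270462404232218081918346976629034087703266,
  886083277153380627400026983861224646,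
  13067485706536102191936292067405202222046510613937490882017442293227967612128450072373789560114505981854590522134185827296953916518993123493329873170838958638694544940081953954730608545752087328046907662,
  374242134665122493576799275693391787918042829548287094975795667880905006253714295492088487977394090565806,
  6394293438948205471395058093723476935055517875482641935906648980380258075679291982303441991352505554309888775430,
  606408906202785314161804192671586533, 209118991264737215450532496416794,
  17111486086959189849896248682611244513736935462677411030088182,
  39515693369336662245061199101413180989340800452769945696999517265888158112428441567901657274157433243706751515126099580938095503793176889312631565863989101577709292865199,
  882194138174240532354972892363105620, 673204189620422593394074310452872644,
  19813214711231472600583638723835279646703493666582339500685096384333774340648496203738031904973572837186324084084765499080214890914167662553553686277937584729339974942789588854133460786890660417706455156315800253186177775674130468747548543053961877678143987,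
  4511997800636, 68865867411491831358759358622169209869048855239368969812617451749,
  753919288481913451,
  2349154452963063803744155098186277877673744212501458372160047415353293029157661669825708044745198239386516371043817113919867857351562540775879506981705589128763891,
  121448516335397441106171147129317557300118103804282398417940154941388356901658813398000579197212137858032235145177665011181374883062946291,
  1115694262666020607156428748301498221514470202442694602924356429616234618,
  36376012530185662452324410409,
  18928077933152987253913952047380745330078219277712392256368083487944214183567368,
  382641960295985271398500495893574513145119415889388771813550193541440258426178860192476040511705417571007,
  769402938901209521,
  4237563427418126773570373243881559100748862690383045614334021691125860432541925917623002407966236281714637879217343656585686183675929625395940502223484374648936247032932408918276453833687698062460252268602880442649991664668052232395455,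
  104039703216784089947919990632074950661181038041671966192646195610962798082552614054821711493521498738695306132136407923,
  11014582]
def hints9 : List ℕ :=
  [2938825972047925694471538253662560689232181733232582538010,
  283195939332862151142690698691493218188086130635977553667624979732979, 743226049451054423,
  1048078263771070288689573910483673189906888561138102523178048516737185489627036760271568201059342258256551221471612621610015635760723661770846005120622853793440370449849912348356625625767724764038340917085033738132318684176293023240569492403656963107616911858098158040070268251819639962487334917439314984599609888404728365381360212416160263926015779392030948711569817298733236489195739271130736521016589736639,
  19816229917961577632931240518861450312298964362854913508910871119565620959042239, 184792613726605,
  11014577, 189749830177534,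
  1298033341507951699833102740952753646243628737205298524624282126013454475303777462396806457660585723548135554113214290014558911,
  317641239773987799658045452506895040239908915129134458478793345563600381084262819346288987118728956537411616296419508463064021915286875595156153662303823780543,
  11790203315303342153456319,
  10428908946518645185757491088391057782009954961511512914764015628731509501209000295833011095275337714400962957935675339832136047431039028123646915899015704974177768001545735629205003982130906036530443636714760621275701473451256835768634379738958010191170035,
  16879790318159264885152597748961071083551801017948488198576831,
  3202616505445621698768467247523603565104479706815840567729451778537901424975500369742074722992842620099050715954427521262546949668415438064232441448664068459141490000098797313757099970958202954828275,
  601738818224684882708762023969616977, 130200898323648, 11362374,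
  357741404020098210118268286720760558935409828267733418884857885801294131397359326076548935716015349671391123570957601942576062971986696526527,
  3906283712854007297594046811701551540734488828488971469975551246050722535240722044796418972351,
  107869607065370789670015684115115207431337227028408142416720392189297928778151335710282951050033251470475368403450780351,
  81467872858936916671, 283568757995660041008990691265832113527146118478177269277980619594227,
  4126468459623881515141336184980407191582863760488894279799,
  1312661911352495246052261427362341517089393550832966425236161522073574651681472587719933986,
  1174495684119934473345638571041614509939562490507724254789316703001663687585088563994664607636112105444848691001484178493746920096705739625411378503585475235488646438839559748229283483981633911380882001372933305097675847225324779071820255650011568627,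
  2755824335146581705101109456085040124584806949722282496413058880981941054596340606776687593809708663026490956534592253940940993856208963861779623513209937382215198677964534114824919704960947371006451,
  12846161094154004530191806674797078053993000,
  8106967509570802921159337323811948024896788225438134921354382651278341582959035417419225128329531161338658670489931553871788204946644238039524962721012825684329121192,
  752512386850337991,
  2557500122101229032185360866657441115394793913110934482321508268180061617503657982194414561229023635496632128388453190262710757874714396388907977941910760903433044415645240938942325710265127408957112390614232817513687312,
  7779267060, 10375546,
  657668321144875015517272127631365599050468718518988506956098080967481816395403347004415327818012518848502833848414624451170236603652289649711585615525058311089862137148039236291782031487099375832496258480286414062,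
  142653162325005777237470456976291224457256708325827875636788080514390319412534136367387071160748124946727005898685861496378961828380428130222619264115716620392380149362380919,
  35564599050534236072054484129951460448014681027701250785878104460750076184028924644648105989744265328380579437810951823801718735530223080490439453539518077890346747845107,
  311543335623925823695816931369630098031300188690770870164523273978903009994074133920540840030741611882948835926680106238492,
  902609112344902461687533907100440304135120029078714867, 664972431873778764, 584755981143790931,
  824954247559740940386547853403995018364794680217076433066673273851926499742545627400955769500962588582138730898160222585556922896242716154905066215990613537853055057435243663604938383861708204215058401460531737961532360171996481316,
  183751759892496257028315783360611572220022922062492823481138688286875749698318903067418393306726973762500149935602482295529977085541309711641317433475317904189172602459681864258345390271365679,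
  50628998510026570358216440367, 192309280597454, 2954323488605361549852,
  5859326366138218666604975582541347481975132221176655204646660921929818955065601480023838237491699054101116883343262559716876380963751787220832990300736467338234225863436198932958641149613881189037140198400579691435537888852372729938724227000908686714020590048439763835543412865429128061963782607064371111351014891155656202929369987620381398730334890544530353463305207142962289799780439030108249531709534962750171015945465451330803262284107498863325,
  30038784902154834800132375499575113432772434847007123082421960727251842104190643552554055192738616574014474506650087907254539802606067,
  6737216869867001872950756, 870566706125922193689870973736024677,
  990210484625975206345411233528312156096803822595605933338176030750733099546288612023665458305056342142769380921343631170724609410291087609843703398732605599468799314799775327706475628268359657972365381138440211345530802710705043955,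
  5321687592935274617348587802801363925409808525460799758239569014196137672631850007861581751750,
  1440754776679513206886790167920657347088324445866426370033592830710708308696598264009648368664087975337220415923157294337877754,
  62167358703630889096794931907785880853169558712, 751107760830776520,
  480176641208862879865130240115572826888124779469507453884767389672809362347713484961916979398483835387805862251427013677914138166102271248616374633310121295234450797868421058876114716962946788200044098983581760492019319474925373251603176911332600410179695074407532130798976737671708224973574368747897342274720107445007645474376755735619695730349494692407979989966942963297642793080069871830856825937900580122945780675827832484282527583007496200630053159847193853238121322398397142441789665789735442612305620871657778786046723979763,
  49916329452571719612322166603362477849347649371410284613957514329991173756741366524397065810738570420703571529212566751941839591212662391518585999015152126391444225250598131312287789750281699689930492510191975373394912448288057304337547110788656915461857204663175826799632996449513765418151262798955948084843142263851220267137892859071968735552587029745578085746673997321624693345799607642970110378037540704340329519603,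
  544562542809861111641094816312740165936897605073818657738006965437472686723752506995365268229094887860087404729497288861765507985166937144646621942898399410942,
  1145264978301973057769552400793587090686566050912008208343992230567618128256365727798943290726252057785671090318836936871279358,
  147137045359612824169480742266035712922713286206249807884608632552273172828165251760395294032541320618196129479742047690844739803308196372610386056539269887,
  71871191196614682309081524690886448803275936875158468837797521907,
  17546677538235962501384056358317971028648538090670230598576627]
def hints10 : List ℕ :=
  [132675874474755,
  22248221002189435110466720049501136846153735547436469303249250014252712365121127305511107615996637,
  3316866966604417967451618273138410638518364552972245646158352138003282873092,
  70530313386727788492324445008537135541068095199747252426062883589,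
  17194203365931266900427844964598123781389453651459464995298055,
  404237318672654740276132968255050638786866706991463267438264356884206751612096599401558097178054056383433376504644552099235792084312882179023214098936940194661629477444544604945351077404896122759206617119082543730340944757628382946843491057945598097304572743831054050563560781887210557597969309327698675178221719276019,
  333692387061823020485107,
  1355840498761560101706980326345012209508394997303398835813188693237448344911402803027700485,
  5961690751676068427754642987721947073450886241179946811152770346378910750988633083230489794544972331139054365445,
  728024476092683403,
  122039217167191432951282835016843819533684994830976582923410291008741321789252227073028975195108843208325520031380638230307121204711458484,
  673135206265545840,
  1075461070989401844046530964451194482745568850552929843242018420859008043607444492113376336307265333605907210,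
  8590192052294422777751128277393185592507810177096914457244002182933800219427429635098148299639389355744137935279219007738386715964197249032541272816726118869851338951684054442244534186547922703767822288227754767294038753857409434710663954974224658844591241740135806150838288052032918513007847948937722596046550523399968844572360781308968731408209192007777667571,
  1795584034919414183629242951827338333892352313716599414296294136024183456534758274717919263339649591604352169679937700561627100929116656889192675191405638350779469,
  5064540936268139081098681379792646780912697201806307388266428395138420566044791895766572546137415575781854403700971842233298338315357077819614711605947840985736588001654233096609630388233811129376839560523439462458844093381565268149987294823716511304179,
  24583802197078893160981237680168502059171756027006469244975260989963146047120427437718700269257579352140702135531954683141847048954701272471746703809284,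
  1703230870618156642275797863721043977565329317638740648613210329752921819056993520252149762871677357700347889553879959535197513068846227607327834912746796132333271222155939343980553489256039511698518104402021942203482629505534100789217415692741954107437271161242688989427184236351792518407766706014388719721681512499279810010357139724710187845720989407719473987260491776652967836126609092849873238770539497164067058044226380408323922487272373662611098224786633489758023519917459388752443323456812752684436771382037258,
  457425889137861989788856239798287866241047192251074712991165330011840391761464941199975039871981101203256755987433740253968,
  167591754198499030357096571950117721276240956277503323459454808365983553877424242053662047745281529992294668738319565121250903795386787605860442477622358247087509766363171595,
  755214835074059616168198547496979621479656305984542750677988721384179316507500265794326774530755549694347465013374221218019731296031173551515112596395131801143079086931346901067040492273135540996,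
  30329327197747187240468479605892034772119616588178665581991722560479044418183450284722654464319236570624457208889010162021141130009352,
  1160363549476629844983033995551967885998494009334124180231353879648819978,
  102583400182928002634270414936582004245812713671963141117598579505627917251262754687421533584299759287860912040989246816954531552358970174878935673065196293,
  34504138024817222757994169956425589150710518431840626745386889642313758662805784679123055690752418077278570978602800962947624839222463277363210104027930,
  563717597421374287640562908396076812256664786456864718698272228939957130846418342934431533252432086182222326049478026489035425680163651645905463994179089111446218235828275746158369355713950292824497997658481820921653937844413026677133263238882791184364659125646717685692274237931279727293444504286702901051050127637560694209364425065834024316388174108569694564714022910724,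
  6091915022960449877463628545446617493062156530662689581290040841642396472748966012702149533958642289248068134192244811924603017638319092893582273284,
  1421911690666944081035555148696323289333269188489545908554341252484417848200602807803996894693178828986222608053128219720820359074278136521705971,
  55303613592387859365651458872841074180521067287296538731554179181427547420274739699,
  15400328930176665368121412814716500804454131962356926207840118124289627093516970144289703786454172674946127033676825938446887014518779995367193398968809380365953730799990349817277541980187197214267512515304642260991110719704629838264861424217969695512057884293815648071032030440184181787034520632379670223029172296589155074134193969332745033706865046950999542126840803881884400281604726477917060346903717585791507587311631324395027204,
  8883543825564970130561125225615748506409936945584937307999398418677897891934952878233891163664926664778025713067809554734460580755400413826627185434,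
  32457549533938842411184742346934385072705954920951284238103838513280199614356270038035968206409152767229015835349902155471144828563615076106810169997555501703248003359717244041839675128602,
  5397064390220901923096961482660627882358087667973438353517975275775611905433756040596049406726,
  775025318196860854600759300225314157306304361433964712,
  14277095490255879145178056674350412231250521561259164790091637596518408537835410490696118205890439585046689310967143428497082879173315149428794450709475632933012910923300489634258955879649818791039106380894424113281395482,
  4274770150273853479124938051019615229331915379059831354042656037765163173709937472492586027775152587156514358373817420856216883414861335441786789139266379947751427341145208286747027366561019328500200376778306316051296258392048969338855367626801742253100781083020877734424,
  12537953557340232732073692592860709470812034682614961064205153578141261562085544,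
  52703305740364559331305360132, 12338675566137563214441275018958883707455645378350729965701893,
  32358155721,
  379416048364737804583374323600225916114763939036403440518089274901815482414097994532304076745840173291281453307422322049439177171763263312387582967276621124668258243465144598987058412066327973715189356451277063604267123928483810477600527878964806395353463960799928036936017773763338,
  14811062974619192388565072263451183738207002,
  83404623838805687482963974083460928484692693923585219706858823878185796852677710161132703767380126499,
  4971302781321453746030841939156877736814253571268510762189030514259359606868632106514498218787,
  1738232060798822896298795960428619466518874389799649659659487805804749349276056487489251023145617768949016716468633609812368093,
  119450397663834047598389249253377102220633019154598595360396806333696260201158113794986804688232212800849460548201454976456217036253354717,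
  32504885181469247518446607468677239843539440664123369962658159059800979059966016661287876011567604433607014149176588565402778212323054305618397189120281974069905934381628379035910654875626930055023987925186627912718070076477374900576081587865400301606267977741167979159709117333025927421280593174820421097244528810495354715266791667606367841790725,
  740692156436968925, 187662855253927503811574433972380541350040828922355,
  2956747247572974955522913362074954019722685754062966405853,
  64804774417151200412948222149762552874002484032226423778296852532236610018813480439028851783441616813777694905808441767421482919545345454520866046512159148483841229190306838366587421210609783014004972449284925466812393483043,
  179849124462223922375651320169510074874988373452764922637247752302725432994981860654488663372028837164388426068672581038848276929050290178918661160998713054995706795155545953082222224568710552587959502202220456543993222657040712,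
  749420561413465908,
  7214563649221048989133718482962616319784842677906535155562726614549267623879015736567030872399834904818396907019442269693166752691,
  173449992809572467276369032461592065413424171595657421041408616405261945568843169490512522599613469235295442534662056933519358188860838246644594369565541400067531587235900195,
  2341261011221223683043429585226913154032185256857229908196628086253905385429615732141285604244626686427061991412466829489232598488513917459054677872906608898501411,
  1212703808055821151384949330098827658620877021813191521521105343898310983986664762287831843,
  81887227182707249552862409183139665887206984362224081236340964399586311830406502899,
  1626907510228679477043148070075628809304168725929060298959432014955781972314299803326812405858768111791912273036071589343838074930822423604099680,
  754205567264499500]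
def hints11 : List ℕ :=
  [12077808190027467464637024,
  819840004950119270843507601833855032640846333864557399647642976563018461,
  7045115721901333664254166007839291058306943746289131215135900140805415931729552524438719348662359243243323683833861495184784410560745919711608770194610085270630984483,
  618535452889044589,
  567110937539374195925119836992478615771089395251401302818195470534334518920774858881476654302072774229424874954367835398979321772298438688617947486186521355858595920416854261597908800430518916327948860213598347782322195814926256965588507044483099676644196610752903053714274601361587819486789567719044985166420378712616887141148216280812,
  33802445980273139233894338428525842176144683078014928270470826061626346046970776252834597486381100072230391201637258255420882807510998170889493673216493210545694584871343032216532739599318976923285322781178893096126366661901775971906503353643538788946907599377269851487696949288679216052639339607182548760062399147895884775541508,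
  354184927538867239188520500982158098559497823689191549339731380392875604425253339311309214133733667183005108033237622058898201827114657109475089018935017930449791745628736377777544764783248607321948034853583266960827317175057367795730384111984620152645521146686173,
  36739261513034987737207347495636013358956171140100853494035358691016547546851425902816490984844514313944435664661176532269268956398362592366308262718243,
  16477388822687085154435519767860658735739007350687664612785921107338945421868974629883119067160179533404474123887995996661667862344867860842925790218057849657528112450949507175112542639425358977237944591539828227552880058427475341877306377414574227246390063,
  1246950099522717945987448788030423999934188361046915022101381794267473863616081395117910358254052052069008191624427011370477344257735726789126366646251875298187070167325899941592745596914522419865020938031898046720257534744780453149926536335473027866,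
  2877524254604564371809154899527105928486524612930496907763,
  16000341791454976882161465417999253433655234403901651508090572023427492538578137508146558343858675,
  9128779, 10459979, 10509131, 10910540, 30949038926, 8055632, 43336686411, 10447698, 10451794,
  19238566738, 19171461970, 18970131284, 7691093,
  21454711417461846171152365790835572181710028944398859162387406880142547879183666636254499545889611,
  68515641987299860553771579960749502151994192903096019224413059420372984259087002826936311800141899494010826173298037412974216291990458449750208176162908335069756221485314401209207920999551047822646307688342170162501041413668156412508685810514,
  328598469872428955631437225505707941645401381536955709363725314386449233268080023815433333567879075793449395070260794707614449669330557059923493846888843791292706106830938455001043266391766905651245471041976687364737944656042638705277815399628365503623165388340045,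
  80224235808698475495956353883229477940771821664295827481378250582629207340839849564314778703093239004815307682805999271040843026724092551370799072930470183462833731706888212528761908813006367677548478530245328898109832229928315924216617255781949479637392636749,
  1721695027476084751696777537946778375867425063603161177688209692834506604722828534821967042327748568916395916662804090199538507,
  420335695087095258711506583625579681199164017360991345281507574705368503940016688295135588732411485577274389445669452823378,
  1157534098800809536941854057696016017107285117254162776865706106609285972,
  1824923773743913484347433521191033371891760670657695556387584297853608631294005579216134627954276872281719784778227499199739976269998339428543314,
  26556122514003790931263980194339211128241111280711424994921104463908216708838080737659340401515283793684388622257966715448451279674194,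
  19143240530, 210387938050129987853113946901334,
  152570972560713201654876310817730178381587826360909812025301766789425898301919885190966373641155072586536895558319761526191205585049648869794077757322640210,
  5696950240508594650270270816432438848910404955847138494856507071155003767329929218021430043719138756757106780038445965919001791250119355975933976300689620292365368184429196479899146983453634626524649341038756050333237584215542304085868679607875145928055947675375875037667145083836966472531,
  3073068209340249307979, 132602860014424,
  408142315625926453809828968783866605700842336393361804493012143963492088335221476754757354981383740944408285795264463572237162217615071198029,
  2168440763184505486419377298283073000215882451317392680243621079553600675685984556973506365228318746472748679920089448473476928863395418746493870547206938341566013015010887427484491,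
  1954474519699232623572379980132573918377116685642844566388098448315554302397158198756246780747206664128667115960555520506813751515626178286927603358861697929284456697383693243944112021307809756722287438970447747114957994658366115285266478425862699049078554599630193232696363418802310982832702958039567190,
  1954474519699232623572379980132573918377116685642845791196678488600531043148562467980331430484146198858603633081219201472492018487347370030283787653585333638028074343099207426957003786356538051200022999850461443373909523424014975541798070493316457211598616533912211418760447186153845083149506027789314903,
  12162286967888209067191117,
  7215539272496534742014039485809313336381542433684242224709084685168307852665559224521339675708266134720796149260134649376355126813122615276226252857874107657963522354939900632939547292202211878737441539174464037393418838491383217083325473232675854311461565203046137984027169828398467939604937147529246903122,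
  22234597039689866042097184630488378348084366622386020179275615021244015112787259966520138469487490321298630360061994125494387078168874943784130693732436688002985410955319422220382538945635559734481176973231754631923627148411822595693473421843239830136862927626556181881129810,
  1751443332857685703076573232815963658539497466549041246390454882004158904221526270639586690030666272060905370426953510308600658,
  13762060682207692766846693714351896622659324058757632059728251121453776596425554,
  264945108115908205923107269765458073077079710034109806199337993832067295785632613748431721779538322307922,
  24033841483538159760311527034008307067266442768152956226748435059140008198240874536790400007723851,
  3458513157370942861798709278534558485660763820023909997789743921921730599755,
  206143448070598319089514885138068270523403902004537363320450999180107, 681303204598658867,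
  265475281084260156934881729270242817353992970614843329929939460299243507812209664035665,
  2533516149374917352273,
  4085311007390202369217601338057404299797388638529439344891884464151865686554031564857861184091678775305380866600137915583838396193622463945612583877389871941303480604500000366819159815773150292535292366603386142013860706036501553852492482465126499321622054126750376073292446732417333358936114085351010413131483081824339997027649585798174262515953150814209228387941485257719296981458546517785876248518238447917911,
  58682394932705903736588225889081163907483137537201866588510147182863906277382714246919300359985215128935183744224395232606169918292228244107226702885143035181291382398761875806153089669948124235894599128218661028215217531731,
  990231704156855524325106757746725295299959870929196355707424266106542955388726177005046589137564402677999848532521455621216641890886285381256543879407147151390105803893836754922699208862249148532860967009918871379529073216816392907158522801996361272064437255776062295,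
  209689719709157435756051904381427382363853180537403328332302529546578941516876462368001981126542365251033607639795362319165479667163943707427273886881942135588131596740086239399035768139720529250095815731274435503381152594399864841711953168923469]
def hints12 : List ℕ :=
  [18019215418817152612626226011473572236305543384270409149494904817924314831277888805672568201415802527255502150610019453620987121453911,
  49925212871512719138483093972883532393323651984185319461416866383035790043184255876412743970028920784279389768723698986151311529978907914337251765290687503093456167147230541364287692438349,
  50514834656486174802743520251039776885341470838980981942965033803,
  829182705629764734550418611973262155,
  2981163287628262463351705046791202377665392081283668142156509631948990445515566178685010948341428851126801249393910930176101961730521389871512159744543868455257042543189340691151698,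
  1456185835524090465897769338770252129729900882200525899263086316383773587295092185694038861,
  998393464018349568860607685341359352907371552278158155,
  14474070826944478009361932787159794764855866,
  11855352233083379330505051544916233309543448452462244930071382, 43548948713,
  182379148913753043241810127969677109597703625534395950162754253735350100894100167976535439241623482275126172577931374637197746787203824152180970102526021293572401625919884040459360916849810350873785531855115355126290413546679565313240256992298740524591808628747083,
  42870211804609627407588825223484880000692599634,
  1261942592157831237332532304631773778337857790894621894502135886800471674530155482431413074,
  64911235984142036187117708426106386984396708690,
  739822377182267318025592787191470656613980109097479316488308287624453863836577683094716298766492699464786162632514679841404890359513117354058955306028614849141628496523562487659618917893377678162,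
  72555528412485059417105986207053362370388480487360225066616879080702828096685157195,
  257769018263634064485877623720900552808750460281308746178814107003723,
  65535422730866773424501793708032231124923139075184916409743113660196924244287065307528978139354311499,
  1411336831872566951497361294988127953385279505441013181931603928476889707325432968748126285431061921876241239,
  27231584057857124950447614775029607349574034240470292979092085930564066787637000864490818895326834635263886432982228233854672289708882,
  1687320760415198311845934241953415221831251392320251139676185372978938215782409776692291261073145786105150110038868573761633099,
  6022765474477355829794281712662377449516670187782638201405594089343906240060577784618562813921070167810890873675,
  59062720369017531841873262852918474992456444811, 3061547439370431298392,
  134683515790052982364024932327193108275677034979536843093401347676420102416139604225012449669573785333464634239160807853933082555326853225652560163096185524703413523605119234009358888087370578,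
  228135781693221308386095152831310,
  43700297601269304713403887506055236558468493817616824464805320135177717295846816334009939080720359263018089266217265921787414450508319023298311457429923852491986631469902,
  961697156393782578643871774822198093, 2894459907478867738265442056660018540668340451765592083275,
  18636192209898787946397639878110372942470813489583753686581972437355605423209968003823693699211373093161105430494500427074131435786290173246647683558235672010113685972888851820042388065178240547212063141058563765936072215536727751321138240669655680674630785321714344015684056067975773844466515,
  1125142544993444228520922863158554458135374977452823022534162272293236741387660259563768454277921202798851402628190632725559735771085160418476961665659904495234638550446034356453776302843240698037261796205590026191300253230738783053,
  13978632625915687698148699895252553508903763,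
  1960753667613940274574368142201803027194500530201909536042860495902071508982430878291035609683293423771758009904197752835070802,
  49661643603,
  1959737937375539309924288510002326045670862890666964385679211848739980539897758895218723623690242992152095965730845828336445546334465670711130957,
  414990650235316632038966992394287544857517159994216835224255329113752847172293232314123020137934183391136720909481503181645,
  1279467057357930955636345975934192870129894426966157804832686454769593165, 12192651, 1521826721,
  18936896418,
  74888517854716478253043836291987981668438071602183441401540808322367492353746368703989281143689914728368876376999422802,
  1882580152435036983481033464991708828730468904794695836682726309816802257422778900007768646386974126519781457878915937620663768027107449976979590482663456728480587,
  634627837578822880930078350070045518,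
  128498987453100258945548940596292658613188653835752658310785478294919108666143801983039742241825854788273878721599828693091929264884547146423370919546858326,
  2066518609390727323287786794890884505110608186403261454389888385466686999593692886048462090228910280082400410608434425722292833356159395518262518992040982016942772986789819260108408621157476012367345238407789866574651342942578900053968582656140487464829208435957496303958695193855132436555739926959208902513258507128875937,
  623231579238144537545135216228723506777879528398989300769982794611652859694688112022847043697169889728178899025057231182318515869725351743211458941694955823126756766181080135086257184176020014790646380184892418902,
  37982369322166738420502667398709197783377952083189205950401518117690569641517938416364952494732611065993528157553064935773364612558105448187758450159112248672782992943958,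
  3005059917278376995672, 37867482950789083594434603853,
  25252250505751433080348856364631920582989546278835691782875437619929025033108548069303473133139349253300773881915092541129452598639721001172965707185721415925408126006098614894527072127135880942303243295661259140893585177720475669707822441236853209057814735036047773591239510,
  343709478560087292849301053603881447606813137089401569363810297795947035562669891996208961201745213864779,
  56761015059957525441429154722,
  294606617667785615433852152822287556480545610913161352966444854618964, 12255282,
  14310757601660730847079295404902046158629159814767337079678665286895338527709845259459644434029268262943557781062631464012614580362338312709698034568207697831435030816548146872783085075437234337332149154,
  688618448662498136,
  73167040402008990211254574327510745605347038123280755350345278499545977680123210579,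
  151424003139617612673171120626033375282430328621883918824703409267728923888941225496245751151974840562069681858365158411514491759292910682832458442793511093943524677224006301178350946954721259730136829636437066929016709093447962178299501249652851971301613123786921839559821869135165919300296634366546583381010607838259293974511699763006437435356735848760129941909482876402783328694250328,
  696754063545187192087207767140314320566318111303449505,
  56492514973425498100190217203993861690614390930341469186274368350158460872036552802241887628798721429827977126868768457538928429702446253574143117389589751415589010593337277030801945189919348533641864734550895198673873118953421354069119932806415264924225099488940092122113652950458497404973051262734045876090591197737989504840539805555625591748394451826604934575077662441144777802111196533777480624984]
def hints13 : List ℕ :=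
  [722092193732117997048567867004196945354298543190711924064286721278958783402189456458705453423066539235694591091932151134978311515593551349749387822143121550771739441746900579150001759643471032499004523506238110044871601956999432829757813132205026363381369889263424536112869255876325783543936381637931594537093168470502226887612861674751181161598459728772186539120607357736890576480842719198405860668890294740084490142804152417937346035146202772466511910851309860367181921383379448427820388984599089041138039118486606151643517346641802697285695798102,
  564972740071806766418081613098426866462846225069229584547589678050767342557441908372141969482696126548417270725828279384714418852192327086262717078245926579019,
  86117329154857879746858374321739337091700630732068504782587923002946649912211925131663916627981512997639089745789099392721124971546766162,
  7790180570481551873603396929798506528353255052689263689127493825351798889903569648071594362923275455568151064300664731600984216006514128726173301665,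
  17863154619, 18534247355, 7646140, 31485946813,
  7924035205253964537988939161184349882082145263474090724607514423548026134922089953698482414203804437390365966914167185391929260173796022260564132591592463979435422414491657793007397709,
  12292480101486086764907213398553211734444202286322311195758679944879578157877136189636143726030156905313125749679064500494970068743464025366216390728012492672769998626952149729869395164042687553115343778,
  5462234713812129158029232717682365922772972443651568423105613251267931618667157723729758567250,
  325574675999993051992464220137564397218930687726619613316874585366580658237281058237259,
  15036540445070824404286913632133893644565083638958464171752279, 50516996293, 50562091970,
  21553818566, 12327878, 7793607, 5179685832, 9157578,
  2668008331450124386185712866202974541205697100878820187796234873506897181512459817168662273589118874770771129634545854575024778308890517572319398279876122090913640187772740451416915,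
  2897877964, 2864323532, 21486713804, 20581215180, 20312808396, 21419609037, 20514106317,
  20279073742, 19876527054, 20950166478,
  1259405508237427656465548712970053643055030702902804671180470873656239467525870275603329480523532829511202414751168452722697793809837214583384089876405847974639206474633186053406089954136567501679093694405451968431155971635364413585672176922297915406186386073952312899853457091179580043928245892749624146500916149386964668429133118737492089930587371261080136783703516726762440455499239398341475022699501049717568296613724170541737848375539485523,
  32071470476568499418836289202423363636621853974121996544808426217140179402228087439621923203530433649167234517750816017831423405368458150662607534631498421232665295425218411467305523404530269208931371212001699679327364933007899851059635726554800858918055454023150352101139091204879863774536329276510356620829484279584777068087235500906469483907343838033400200223675,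
  2495331288, 8065428440, 8098982872, 7931202521, 9071549402, 9205767131, 8937331676, 4055731165,
  21269179357, 3955071966, 18568063968, 31754882017, 21151718370, 31435619299,
  1120838186851724392941350838861160189044460344657648612, 535010451734289383]
def hints : List ℕ :=
  hints0 ++ (hints1 ++ (hints2 ++ (hints3 ++ (hints4 ++ (hints5 ++ (hints6 ++ (hints7 ++ (hints8 ++
  (hints9 ++ (hints10 ++ (hints11 ++ (hints12 ++ (hints13)))))))))))))

theorem zero_mask : setAll zeroLits 0 = 215692740590690793883576285880765537795773733911444684436922968451240 := by decide +kernel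

theorem gen_length : gen.length = 2220 := by decide +kernel

theorem check_inputs : checkInputs table gen 0 = true := by decide +kernel

theorem check_hints : checkAll table 215692740590690793883576285880765537795773733911444684436922968451240 hints 2220 = true := by decide +kernel

theorem hints_length : hints.length = 829 := by decide +kernel

theorem last_clause : unpack 64 (table.get 3048) = [] := by decide +kernel

theorem core (s : ℕ → ℕ → ℕ → Prop)
    (h0 : ∀ b c, 0 < b → b < c → c < 10 → s 0 b c)
    (hs : ∀ a b c d, 0 < a → a < b → b < c → c < d → d < 10 →
      Flat (s a b c) (s a b d) (s a c d) ∧ Flat (s a b c) (s a b d) (s b c d) ∧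
      Flat (s a b c) (s a c d) (s b c d) ∧ Flat (s a b d) (s a c d) (s b c d))
    (hh : ∀ a b c d e, a < b → b < c → c < d → d < e → e < 10 →
      NE s a b c ∨ NE s a b d ∨ NE s a b e ∨ NE s a c d ∨ NE s a c e ∨ NE s a d e ∨
      NE s b c d ∨ NE s b c e ∨ NE s b d e ∨ NE s c d e) : False := by
  have hA : AInv (val s) (setAll zeroLits 0) :=
    setAll_spec _ _ (by intro k hk; simp at hk) (zero_unsat s h0)
  rw [zero_mask] at hA
  have h1 := checkInputs_spec (V := val s) gen 0 (by intro j hj; omega) (gen_sat s hs hh) check_inputs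
  rw [gen_length, Nat.zero_add] at h1
  have h2 := checkAll_spec hA hints 2220 h1 check_hints 3048 (by rw [hints_length]; norm_num)
  rw [last_clause] at h2
  exact satL_nil.1 h2

end Hb
/-! ### Geometry -/

namespace Hb

/-- Orientation determinant of three points. -/
def orient (p q r : Pt) : ℝ := (q.1 - p.1) * (r.2 - p.2) - (q.2 - p.2) * (r.1 - p.1)

theorem collinear_of_orient {p q r : Pt} (hpq : p ≠ q) (h : orient p q r = 0) :
    Collinear ℝ ({p, q, r} : Set Pt) := by
  rw [collinear_iff_of_mem (p₀ := p) (by simp)]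
  refine ⟨q - p, ?_⟩
  intro x hx
  simp only [Set.mem_insert_iff, Set.mem_singleton_iff] at hx
  unfold orient at h
  rcases hx with rfl | rfl | rfl
  · exact ⟨0, by simp⟩
  · exact ⟨1, by simp⟩
  · by_cases h1 : q.1 - p.1 = 0
    · have h2 : q.2 - p.2 ≠ 0 := by
        intro h2
        apply hpq
        ext <;> linarith
      refine ⟨(x.2 - p.2) / (q.2 - p.2), ?_⟩
      have h3 : x.1 - p.1 = 0 := by
        rw [h1] at h
        have : (q.2 - p.2) * (x.1 - p.1) = 0 := by linarith
        exact (mul_eq_zero.1 this).resolve_left h2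
      ext
      · simp [h1]; linarith
      · simp; field_simp; ring
    · refine ⟨(x.1 - p.1) / (q.1 - p.1), ?_⟩
      ext
      · simp; field_simp; ring
      · simp; field_simp; linarith

theorem orient_of_collinear {p q r : Pt} (h : Collinear ℝ ({p, q, r} : Set Pt)) :
    orient p q r = 0 := by
  rw [collinear_iff_of_mem (p₀ := p) (by simp)] at h
  obtain ⟨v, hv⟩ := h
  obtain ⟨s, hs⟩ := hv q (by simp)
  obtain ⟨t, ht⟩ := hv r (by simp)
  subst hs ht
  simp [orient]
  ring

theorem mem_triangle {a b c p : Pt} (h : p ∈ convexHull ℝ ({a, b, c} : Set Pt)) :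
    ∃ x y z : ℝ, 0 ≤ x ∧ 0 ≤ y ∧ 0 ≤ z ∧ x + y + z = 1 ∧ p = x • a + y • b + z • c := by
  rw [convexHull_insert (by simp), convexHull_pair, convexJoin_singleton_left] at h
  simp only [Set.mem_iUnion] at h
  obtain ⟨y, ⟨s, t, hs, ht, hst, rfl⟩, ⟨u, v, hu, hv, huv, rfl⟩⟩ := h
  refine ⟨u, v * s, v * t, hu, mul_nonneg hv hs, mul_nonneg hv ht, ?_, ?_⟩
  · rw [add_assoc, ← mul_add, hst, mul_one, huv]
  · simp [smul_smul, add_assoc]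

theorem triangle_mem {a b c : Pt} {x y z : ℝ} (hx : 0 ≤ x) (hy : 0 ≤ y) (hz : 0 ≤ z)
    (h : x + y + z = 1) : x • a + y • b + z • c ∈ convexHull ℝ ({a, b, c} : Set Pt) := by
  have hc := convex_convexHull ℝ ({a, b, c} : Set Pt)
  have ha : a ∈ convexHull ℝ ({a, b, c} : Set Pt) := subset_convexHull ℝ _ (by simp)
  have hb : b ∈ convexHull ℝ ({a, b, c} : Set Pt) := subset_convexHull ℝ _ (by simp)
  have hcc : c ∈ convexHull ℝ ({a, b, c} : Set Pt) := subset_convexHull ℝ _ (by simp)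
  have := hc.sum_mem (t := Finset.univ) (w := ![x, y, z]) (z := ![a, b, c])
    (by intro i _; fin_cases i <;> simpa) (by simp [Fin.sum_univ_three, h])
    (by intro i _; fin_cases i <;> simpa)
  simpa [Fin.sum_univ_three] using this

theorem inside_signs {a b c p : Pt} (h : p ∈ convexHull ℝ ({a, b, c} : Set Pt))
    (h1 : orient a b p ≠ 0) (h2 : orient b c p ≠ 0) (h3 : orient c a p ≠ 0) :
    (0 < orient a b p ∧ 0 < orient b c p ∧ 0 < orient c a p) ∨
    (orient a b p < 0 ∧ orient b c p < 0 ∧ orient c a p < 0) := by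
  obtain ⟨x, y, z, hx, hy, hz, hs, rfl⟩ := mem_triangle h
  have hx' : x = 1 - y - z := by linarith
  have e1 : orient a b (x • a + y • b + z • c) = z * orient a b c := by
    subst hx'; simp [orient]; ring
  have e2 : orient b c (x • a + y • b + z • c) = x * orient a b c := by
    subst hx'; simp [orient]; ring
  have e3 : orient c a (x • a + y • b + z • c) = y * orient a b c := by
    subst hx'; simp [orient]; ring
  rw [e1] at h1
  rw [e2] at h2
  rw [e3] at h3
  have px := lt_of_le_of_ne hx (Ne.symm (left_ne_zero_of_mul h2))
  have py := lt_of_le_of_ne hy (Ne.symm (left_ne_zero_of_mul h3))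
  have pz := lt_of_le_of_ne hz (Ne.symm (left_ne_zero_of_mul h1))
  rw [e1, e2, e3]
  rcases lt_or_gt_of_ne (right_ne_zero_of_mul h1) with hD | hD
  · right; exact ⟨mul_neg_of_pos_of_neg pz hD, mul_neg_of_pos_of_neg px hD,
      mul_neg_of_pos_of_neg py hD⟩
  · left; exact ⟨mul_pos pz hD, mul_pos px hD, mul_pos py hD⟩

theorem inside_interior {a b c p : Pt} (h1 : 0 < orient a b p) (h2 : 0 < orient b c p)
    (h3 : 0 < orient c a p) : p ∈ interior (convexHull ℝ ({a, b, c} : Set Pt)) := by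
  rw [mem_interior]
  refine ⟨{q | 0 < orient a b q ∧ 0 < orient b c q ∧ 0 < orient c a q}, ?_, ?_, h1, h2, h3⟩
  · rintro q ⟨q1, q2, q3⟩
    have hD : orient a b q + orient b c q + orient c a q = orient a b c := by
      simp [orient]; ring
    have hD0 : 0 < orient a b c := by linarith
    have e : q = (orient b c q / orient a b c) • a + (orient c a q / orient a b c) • b +
        (orient a b q / orient a b c) • c := by
      ext
      · simp only [Prod.fst_add, Prod.smul_fst, smul_eq_mul]
        field_simp
        simp [orient]; ring
      · simp only [Prod.snd_add, Prod.smul_snd, smul_eq_mul]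
        field_simp
        simp [orient]; ring
    rw [e]
    apply triangle_mem
    · positivity
    · positivity
    · positivity
    · rw [← add_div, ← add_div, div_eq_one_iff_eq hD0.ne']; linarith
  · have c1 : ∀ u v : Pt, Continuous fun q => orient u v q := by
      intro u v; unfold orient; fun_prop
    exact (isOpen_lt continuous_const (c1 a b)).inter
      ((isOpen_lt continuous_const (c1 b c)).inter (isOpen_lt continuous_const (c1 c a)))

/-- Carathéodory in the plane for points in general position. -/
theorem hull_triangle {S H : Set Pt} (hS : GenPos S) (hH : H ⊆ S) {p : Pt} (hp : p ∈ S)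
    (hpH : p ∉ H) (h : p ∈ convexHull ℝ H) :
    ∃ x ∈ H, ∃ y ∈ H, ∃ z ∈ H, x ≠ y ∧ x ≠ z ∧ y ≠ z ∧
      p ∈ convexHull ℝ ({x, y, z} : Set Pt) := by
  rw [convexHull_eq_union] at h
  simp only [Set.mem_iUnion] at h
  obtain ⟨t, ht, hai, hpt⟩ := h
  have hcard : t.card ≤ 3 := by
    have := hai.card_le_finrank_succ.trans (Nat.add_le_add_right (Submodule.finrank_le _) 1)
    simpa using this
  interval_cases hc : t.card
  · rw [Finset.card_eq_zero] at hc
    subst hc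
    simp at hpt
  · rw [Finset.card_eq_one] at hc
    obtain ⟨x, rfl⟩ := hc
    simp at hpt
    subst hpt
    exact absurd (ht (by simp)) hpH
  · rw [Finset.card_eq_two] at hc
    obtain ⟨x, y, hxy, rfl⟩ := hc
    have hx : x ∈ H := ht (by simp)
    have hy : y ∈ H := ht (by simp)
    have hpx : x ≠ p := fun e => hpH (e ▸ hx)
    have hpy : y ≠ p := fun e => hpH (e ▸ hy)
    exfalso
    apply hS x (hH hx) y (hH hy) p hp hxy hpx hpy
    apply collinear_of_orient hxy
    rw [Finset.coe_pair, convexHull_pair] at hpt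
    obtain ⟨u, v, hu, hv, huv, rfl⟩ := hpt
    have : u = 1 - v := by linarith
    subst this
    simp [orient]; ring
  · rw [Finset.card_eq_three] at hc
    obtain ⟨x, y, z, hxy, hxz, hyz, rfl⟩ := hc
    refine ⟨x, ht (by simp), y, ht (by simp), z, ht (by simp), hxy, hxz, hyz, ?_⟩
    simpa using hpt

/-- The signotope relations for four points sorted around `o`. -/
theorem flat_of {o a b c d : Pt} (hab : 0 < orient o a b) (hac : 0 < orient o a c)
    (had : 0 < orient o a d) (hbc : 0 < orient o b c) (hbd : 0 < orient o b d)
    (hcd : 0 < orient o c d) (n1 : orient a b c ≠ 0) (n2 : orient a b d ≠ 0)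
    (n3 : orient a c d ≠ 0) (n4 : orient b c d ≠ 0) :
    Flat (0 < orient a b c) (0 < orient a b d) (0 < orient a c d) ∧
    Flat (0 < orient a b c) (0 < orient a b d) (0 < orient b c d) ∧
    Flat (0 < orient a b c) (0 < orient a c d) (0 < orient b c d) ∧
    Flat (0 < orient a b d) (0 < orient a c d) (0 < orient b c d) := by
  have key : ∀ {x y z u v w : ℝ}, 0 < u → 0 < v → 0 < w → x ≠ 0 → z ≠ 0 →
      y * u = z * v + x * w → Flat (0 < x) (0 < y) (0 < z) := by
    intro x y z u v w hu hv hw hx hz h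
    constructor
    · intro h1 h2
      by_contra hy
      have := mul_pos h2 hv
      have := mul_pos h1 hw
      nlinarith [mul_nonneg (sub_nonneg.2 (not_lt.1 hy)) hu.le]
    · intro hy
      by_contra hcon
      push Not at hcon
      have h1 := lt_of_le_of_ne hcon.1 hx
      have h2 := lt_of_le_of_ne hcon.2 hz
      have := mul_pos hy hu
      have := mul_neg_of_neg_of_pos h2 hv
      have := mul_neg_of_neg_of_pos h1 hw
      linarith
  refine ⟨key hac hab had n1 n3 ?_, key hbc hab hbd n1 n4 ?_, key hbc hac hcd n1 n4 ?_,
    key hbd had hcd n2 n4 ?_⟩ <;> simp only [orient] <;> ring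

/-- Combinatorial half of the argument. -/
theorem hole_of_sorted {S : Set Pt} (hS : GenPos S) (P : ℕ → Pt) (hP : ∀ i < 10, P i ∈ S)
    (hinj : ∀ i < 10, ∀ j < 10, P i = P j → i = j)
    (hang : ∀ i j, 0 < i → i < j → j < 10 → 0 < orient (P 0) (P i) (P j))
    (hsep : ∀ p ∈ S, p ∈ convexHull ℝ (P '' {i | i < 10}) → ∃ i < 10, p = P i) :
    HasHole 5 S := by
  by_contra hno
  have hn : ∀ i j k, i < 10 → j < 10 → k < 10 → i ≠ j → i ≠ k → j ≠ k →
      orient (P i) (P j) (P k) ≠ 0 := by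
    intro i j k hi hj hk h1 h2 h3 h0
    have e1 : P i ≠ P j := fun e => h1 (hinj i hi j hj e)
    have e2 : P i ≠ P k := fun e => h2 (hinj i hi k hk e)
    have e3 : P j ≠ P k := fun e => h3 (hinj j hj k hk e)
    exact hS _ (hP i hi) _ (hP j hj) _ (hP k hk) e1 e2 e3 (collinear_of_orient e1 h0)
  have hs : ∀ a b c d, 0 < a → a < b → b < c → c < d → d < 10 →
      Flat (0 < orient (P a) (P b) (P c)) (0 < orient (P a) (P b) (P d))
        (0 < orient (P a) (P c) (P d)) ∧
      Flat (0 < orient (P a) (P b) (P c)) (0 < orient (P a) (P b) (P d))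
        (0 < orient (P b) (P c) (P d)) ∧
      Flat (0 < orient (P a) (P b) (P c)) (0 < orient (P a) (P c) (P d))
        (0 < orient (P b) (P c) (P d)) ∧
      Flat (0 < orient (P a) (P b) (P d)) (0 < orient (P a) (P c) (P d))
        (0 < orient (P b) (P c) (P d)) := by
    intro a b c d h0 h1 h2 h3 h4
    apply flat_of (hang a b (by omega) (by omega) (by omega))
      (hang a c (by omega) (by omega) (by omega)) (hang a d (by omega) (by omega) (by omega))
      (hang b c (by omega) (by omega) (by omega)) (hang b d (by omega) (by omega) (by omega))
      (hang c d (by omega) (by omega) (by omega)) <;>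
    exact hn _ _ _ (by omega) (by omega) (by omega) (by omega) (by omega) (by omega)
  have hs' : ∀ a b c d, a < b → b < c → c < d → d < 10 →
      Flat (0 < orient (P a) (P b) (P c)) (0 < orient (P a) (P b) (P d))
        (0 < orient (P a) (P c) (P d)) ∧
      Flat (0 < orient (P a) (P b) (P d)) (0 < orient (P a) (P c) (P d))
        (0 < orient (P b) (P c) (P d)) := by
    intro a b c d h1 h2 h3 h4
    rcases Nat.eq_zero_or_pos a with rfl | h0
    · have e1 := hang b c (by omega) (by omega) (by omega)
      have e2 := hang b d (by omega) (by omega) (by omega)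
      have e3 := hang c d (by omega) (by omega) (by omega)
      unfold Flat
      tauto
    · have := hs a b c d h0 h1 h2 h3 h4
      exact ⟨this.1, this.2.2.2⟩
  have inNE : ∀ i j k m, i < j → j < k → k < 10 → m < 10 → m ≠ i → m ≠ j → m ≠ k →
      P m ∈ convexHull ℝ ({P i, P j, P k} : Set Pt) →
      NE (fun a b c => 0 < orient (P a) (P b) (P c)) i j k := by
    intro i j k m hij hjk hk hm hmi hmj hmk hmem
    have hsg := inside_signs hmem (hn _ _ _ (by omega) (by omega) hm (by omega) (by omega) (by omega))
      (hn _ _ _ (by omega) (by omega) hm (by omega) (by omega) (by omega))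
      (hn _ _ _ (by omega) (by omega) hm (by omega) (by omega) (by omega))
    rcases lt_trichotomy m i with h | h | h
    · exfalso
      have hf := (hs' m i j k h hij hjk hk).1
      have e1 : orient (P i) (P j) (P m) = orient (P m) (P i) (P j) := by simp only [orient]; ring
      have e2 : orient (P j) (P k) (P m) = orient (P m) (P j) (P k) := by simp only [orient]; ring
      have e3 : orient (P k) (P i) (P m) = - orient (P m) (P i) (P k) := by simp only [orient]; ring
      rw [e1, e2, e3] at hsg
      rcases hsg with ⟨g1, g2, g3⟩ | ⟨g1, g2, g3⟩
      · have := hf.1 g1 g2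
        linarith
      · rcases hf.2 (by linarith) with h | h <;> linarith
    · exact absurd h hmi
    rcases lt_trichotomy m j with h' | h' | h'
    · left
      refine ⟨m, h, h', ?_⟩
      have e1 : orient (P i) (P j) (P m) = - orient (P i) (P m) (P j) := by simp only [orient]; ring
      have e3 : orient (P k) (P i) (P m) = orient (P i) (P m) (P k) := by simp only [orient]; ring
      rw [e1, e3] at hsg
      intro hiff
      rcases hsg with ⟨g1, g2, g3⟩ | ⟨g1, g2, g3⟩
      · have := hiff.2 g3
        linarith
      · have := hiff.1 (by linarith)
        linarith
    · exact absurd h' hmj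
    rcases lt_trichotomy m k with h'' | h'' | h''
    · right
      refine ⟨m, h', h'', ?_⟩
      have e1 : orient (P j) (P k) (P m) = - orient (P j) (P m) (P k) := by simp only [orient]; ring
      have e3 : orient (P k) (P i) (P m) = orient (P i) (P m) (P k) := by simp only [orient]; ring
      rw [e1, e3] at hsg
      intro hiff
      rcases hsg with ⟨g1, g2, g3⟩ | ⟨g1, g2, g3⟩
      · have := hiff.1 g3
        linarith
      · have := hiff.2 (by linarith)
        linarith
    · exact absurd h'' hmk
    · exfalso
      have hf := (hs' i j k m hij hjk h'' hm).2
      have e3 : orient (P k) (P i) (P m) = - orient (P i) (P k) (P m) := by simp only [orient]; ring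
      rw [e3] at hsg
      rcases hsg with ⟨g1, g2, g3⟩ | ⟨g1, g2, g3⟩
      · have := hf.1 g1 g2
        linarith
      · rcases hf.2 (by linarith) with h | h <;> linarith
  apply core (fun a b c => 0 < orient (P a) (P b) (P c)) (fun b c h1 h2 h3 => hang b c h1 h2 h3) hs
  intro a b c d e hab hbc hcd hde he
  by_contra hcon
  apply hno
  have hI : ∀ i ∈ ({a, b, c, d, e} : Finset ℕ), i < 10 := by
    intro i hi
    simp only [Finset.mem_insert, Finset.mem_singleton] at hi
    omega
  have hcon' : ∀ i ∈ ({a, b, c, d, e} : Finset ℕ), ∀ j ∈ ({a, b, c, d, e} : Finset ℕ),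
      ∀ k ∈ ({a, b, c, d, e} : Finset ℕ), i < j → j < k →
      NE (fun a b c => 0 < orient (P a) (P b) (P c)) i j k → False := by
    intro i hi j hj k hk hij hjk hN
    simp only [Finset.mem_insert, Finset.mem_singleton] at hi hj hk
    simp only [not_or] at hcon
    obtain ⟨n1, n2, n3, n4, n5, n6, n7, n8, n9, n10⟩ := hcon
    rcases hi with rfl | rfl | rfl | rfl | rfl <;> rcases hj with rfl | rfl | rfl | rfl | rfl <;>
      first
      | omega
      | (rcases hk with rfl | rfl | rfl | rfl | rfl <;> first | omega | contradiction)
  have hHS : P '' ({a, b, c, d, e} : Finset ℕ) ⊆ S := by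
    rintro _ ⟨i, hi, rfl⟩
    exact hP i (hI i hi)
  have hmain : ∀ p ∈ S, p ∉ convexHull ℝ (P '' ({a, b, c, d, e} : Finset ℕ) \ {p}) := by
    intro p hp hmem
    obtain ⟨m, hm, rfl⟩ := hsep p hp (convexHull_mono (by
      rintro _ ⟨⟨i, hi, rfl⟩, _⟩
      exact ⟨i, hI i hi, rfl⟩) hmem)
    obtain ⟨x, ⟨⟨i, hi, rfl⟩, hi'⟩, y, ⟨⟨j, hj, rfl⟩, hj'⟩, z, ⟨⟨k, hk, rfl⟩, hk'⟩, hxy, hxz, hyz, ht⟩ :=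
      hull_triangle hS (Set.sdiff_subset.trans hHS) hp (by simp) hmem
    have mi : m ≠ i := fun h => hi' (by rw [h]; rfl)
    have mj : m ≠ j := fun h => hj' (by rw [h]; rfl)
    have mk : m ≠ k := fun h => hk' (by rw [h]; rfl)
    have ij : i ≠ j := fun h => hxy (by rw [h])
    have ik : i ≠ k := fun h => hxz (by rw [h])
    have jk : j ≠ k := fun h => hyz (by rw [h])
    have fin : ∀ i ∈ ({a, b, c, d, e} : Finset ℕ), ∀ j ∈ ({a, b, c, d, e} : Finset ℕ),
      ∀ k ∈ ({a, b, c, d, e} : Finset ℕ), i < j → j < k → m ≠ i → m ≠ j → m ≠ k →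
      P m ∈ convexHull ℝ ({P i, P j, P k} : Set Pt) → False := by
      intro i hi j hj k hk hij hjk mi mj mk hmm
      exact hcon' i hi j hj k hk hij hjk (inNE i j k m hij hjk (hI k hk) hm mi mj mk hmm)
    have s1 : ({P i, P j, P k} : Set Pt) = {P i, P k, P j} := by rw [Set.pair_comm]
    have s2 : ({P i, P j, P k} : Set Pt) = {P j, P i, P k} := by rw [Set.insert_comm]
    have s3 : ({P i, P j, P k} : Set Pt) = {P j, P k, P i} := by rw [s2, Set.pair_comm (P i)]
    have s4 : ({P i, P j, P k} : Set Pt) = {P k, P i, P j} := by rw [s1, Set.insert_comm]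
    have s5 : ({P i, P j, P k} : Set Pt) = {P k, P j, P i} := by rw [s4, Set.pair_comm (P i)]
    rcases lt_or_gt_of_ne ij with h1 | h1 <;> rcases lt_or_gt_of_ne ik with h2 | h2 <;>
      rcases lt_or_gt_of_ne jk with h3 | h3
    · exact fin i hi j hj k hk h1 h3 mi mj mk ht
    · exact fin i hi k hk j hj h2 h3 mi mk mj (s1 ▸ ht)
    · omega
    · exact fin k hk i hi j hj h2 h1 mk mi mj (s4 ▸ ht)
    · exact fin j hj i hi k hk h1 h2 mj mi mk (s2 ▸ ht)
    · omega
    · exact fin j hj k hk i hi h3 h2 mj mk mi (s3 ▸ ht)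
    · exact fin k hk j hj i hi h3 h1 mk mj mi (s5 ▸ ht)
  refine ⟨P '' ({a, b, c, d, e} : Finset ℕ), hHS, ?_, ?_, ?_⟩
  · rw [Set.InjOn.ncard_image, Set.ncard_coe_finset]
    · have d1 : a ∉ ({b, c, d, e} : Finset ℕ) := by simp; omega
      have d2 : b ∉ ({c, d, e} : Finset ℕ) := by simp; omega
      have d3 : c ∉ ({d, e} : Finset ℕ) := by simp; omega
      have d4 : d ∉ ({e} : Finset ℕ) := by simp; omega
      rw [Finset.card_insert_of_notMem d1, Finset.card_insert_of_notMem d2,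
        Finset.card_insert_of_notMem d3, Finset.card_insert_of_notMem d4, Finset.card_singleton]
    · intro i hi j hj h
      exact hinj i (hI i hi) j (hI j hj) h
  · intro p hp
    exact hmain p (hHS hp)
  · intro p hp hint
    by_contra hpH
    apply hmain p hp
    rw [Set.sdiff_singleton_eq_self hpH]
    exact interior_subset hint

end Hb
/-! ### Selecting and sorting ten points -/

namespace Hb

/-- Lexicographic order on points. -/
def lexLe (p q : Pt) : Prop := p.1 < q.1 ∨ (p.1 = q.1 ∧ p.2 ≤ q.2)

theorem lexLe_convex (q : Pt) : Convex ℝ {p | lexLe p q} := by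
  intro x hx y hy a b ha hb hab
  simp only [lexLe, Set.mem_setOf_eq, Prod.fst_add, Prod.smul_fst, Prod.snd_add, Prod.smul_snd,
    smul_eq_mul] at *
  rcases ha.eq_or_lt with rfl | ha
  · have : b = 1 := by linarith
    subst this
    simpa using hy
  rcases hb.eq_or_lt with rfl | hb
  · have : a = 1 := by linarith
    subst this
    simpa using hx
  have e : a = 1 - b := by linarith
  have hx1 : x.1 ≤ q.1 := by rcases hx with h | h <;> linarith
  have hy1 : y.1 ≤ q.1 := by rcases hy with h | h <;> linarith
  have m1 := mul_le_mul_of_nonneg_left hx1 ha.le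
  have m2 := mul_le_mul_of_nonneg_left hy1 hb.le
  have eq : a * q.1 + b * q.1 = q.1 := by rw [← add_mul, hab, one_mul]
  have eq2 : a * q.2 + b * q.2 = q.2 := by rw [← add_mul, hab, one_mul]
  rcases hx with hx | ⟨hx, hx'⟩
  · left
    have := mul_lt_mul_of_pos_left hx ha
    linarith
  · rcases hy with hy | ⟨hy, hy'⟩
    · left
      have := mul_lt_mul_of_pos_left hy hb
      linarith
    · right
      rw [hx, hy]
      refine ⟨eq, ?_⟩
      have n1 := mul_le_mul_of_nonneg_left hx' ha.le
      have n2 := mul_le_mul_of_nonneg_left hy' hb.le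
      linarith

/-- Angular key of a point around `o`. -/
def key (o p : Pt) : WithTop ℝ :=
  if p.1 = o.1 then ⊤ else (((p.2 - o.2) / (p.1 - o.1) : ℝ) : WithTop ℝ)

theorem orient_of_key {o p q : Pt} (hp : lexLe o p) (hq : lexLe o q) (hp' : o ≠ p) (hq' : o ≠ q)
    (h : key o p < key o q) : 0 < orient o p q := by
  unfold key at h
  unfold orient
  split_ifs at h with h1 h2 h2
  · exact absurd h (lt_irrefl _)
  · exact absurd h (not_lt_of_ge le_top)
  · have a1 : o.1 < p.1 := by
      rcases hp with h | h
      · exact h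
      · exact absurd h.1.symm h1
    have a2 : o.2 < q.2 := by
      rcases hq with h | h
      · exact absurd h2 h.ne'
      · rcases h.2.lt_or_eq with h3 | h3
        · exact h3
        · exact absurd (Prod.ext h.1 h3) hq'
    rw [h2]
    have := mul_pos (sub_pos.2 a1) (sub_pos.2 a2)
    linarith
  · have a1 : o.1 < p.1 := by
      rcases hp with h | h
      · exact h
      · exact absurd h.1.symm h1
    have a2 : o.1 < q.1 := by
      rcases hq with h | h
      · exact h
      · exact absurd h.1.symm h2
    rw [WithTop.coe_lt_coe, div_lt_div_iff₀ (sub_pos.2 a1) (sub_pos.2 a2)] at h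
    linarith

theorem key_inj {o p q : Pt} (h : key o p = key o q) : orient o p q = 0 := by
  unfold key at h
  unfold orient
  split_ifs at h with h1 h2 h2
  · rw [h1, h2]; ring
  · exact absurd h (by simp)
  · exact absurd h (by simp)
  · rw [WithTop.coe_inj, div_eq_div_iff (sub_ne_zero.2 h1) (sub_ne_zero.2 h2)] at h
    linarith

theorem harborth (S : Set Pt) (hfin : S.Finite) (hS : GenPos S) (hcard : 10 ≤ S.ncard) :
    HasHole 5 S := by
  classical
  -- lexicographic order
  let F : Finset (ℝ ×ₗ ℝ) := hfin.toFinset.map ⟨toLex, toLex.injective⟩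
  have hF : F.card = S.ncard := by
    rw [Finset.card_map, Set.ncard_eq_toFinset_card S hfin]
  have hFmem : ∀ p : Pt, toLex p ∈ F ↔ p ∈ S := by
    intro p
    simp [F]
  let f : Fin S.ncard ↪o ℝ ×ₗ ℝ := F.orderEmbOfFin hF
  have hle : ∀ p q : Pt, toLex p ≤ toLex q → lexLe p q := by
    intro p q h
    rw [Prod.Lex.toLex_le_toLex] at h
    exact h
  have hle' : ∀ p q : Pt, lexLe p q → toLex p ≤ toLex q := by
    intro p q h
    rw [Prod.Lex.toLex_le_toLex]
    exact h
  let Q : Fin 10 → Pt := fun i => ofLex (f (Fin.castLE hcard i))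
  have hQS : ∀ i, Q i ∈ S := by
    intro i
    rw [← hFmem]
    exact F.orderEmbOfFin_mem hF _
  have hQinj : Function.Injective Q := by
    intro i j h
    have := f.injective (ofLex.injective h)
    simpa using this
  have hQmono : ∀ i j, i ≤ j → lexLe (Q i) (Q j) := by
    intro i j h
    apply hle
    exact f.monotone (by simpa using h)
  have hQsep : ∀ p ∈ S, p ∈ convexHull ℝ (Set.range Q) → ∃ i, p = Q i := by
    intro p hp hmem
    have h1 : lexLe p (Q 9) := by
      have : convexHull ℝ (Set.range Q) ⊆ {p | lexLe p (Q 9)} := by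
        apply convexHull_min _ (lexLe_convex _)
        rintro _ ⟨i, rfl⟩
        exact hQmono i 9 (by omega)
      exact this hmem
    have h2 : toLex p ∈ Set.range f := by
      have : Set.range f = F := F.range_orderEmbOfFin hF
      rw [this]
      exact (hFmem p).2 hp
    obtain ⟨k, hk⟩ := h2
    have h3 : f k ≤ f (Fin.castLE hcard 9) := by
      rw [hk]; exact hle' _ _ h1
    have h4 := f.le_iff_le.1 h3
    have h5 : (k : ℕ) < 10 := by
      have : (k : ℕ) ≤ ((Fin.castLE hcard 9 : Fin S.ncard) : ℕ) := h4
      simp at this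
      omega
    refine ⟨⟨k, h5⟩, ?_⟩
    have : Fin.castLE hcard ⟨k, h5⟩ = k := by ext; simp
    simp only [Q, this, hk]
    rfl
  -- angular order around the first point
  have hor : ∀ i j : Fin 10, i ≠ 0 → j ≠ 0 → i ≠ j → orient (Q 0) (Q i) (Q j) ≠ 0 := by
    intro i j hi hj hij h
    have e1 : Q 0 ≠ Q i := fun e => hi (hQinj e).symm
    have e2 : Q 0 ≠ Q j := fun e => hj (hQinj e).symm
    have e3 : Q i ≠ Q j := fun e => hij (hQinj e)
    exact hS _ (hQS 0) _ (hQS i) _ (hQS j) e1 e2 e3 (collinear_of_orient e1 h)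
  let K : Finset (WithTop ℝ) := (Finset.univ.erase (0 : Fin 10)).image fun i => key (Q 0) (Q i)
  have hK : K.card = 9 := by
    rw [Finset.card_image_of_injOn]
    · simp
    · intro i hi j hj h
      by_contra hij
      exact hor i j (by simpa using hi) (by simpa using hj) hij (key_inj h)
  let g : Fin 9 ↪o WithTop ℝ := K.orderEmbOfFin hK
  have hg : ∀ i : Fin 9, ∃ j : Fin 10, j ≠ 0 ∧ key (Q 0) (Q j) = g i := by
    intro i
    have := K.orderEmbOfFin_mem hK i
    simp only [K, Finset.mem_image, Finset.mem_erase, Finset.mem_univ, and_true] at this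
    exact this
  choose σ hσ0 hσ using hg
  let P : ℕ → Pt := fun n => if h : 0 < n ∧ n < 10 then Q (σ ⟨n - 1, by omega⟩) else Q 0
  have hPQ : ∀ n, ∃ i, P n = Q i := by
    intro n
    simp only [P]
    split_ifs
    · exact ⟨_, rfl⟩
    · exact ⟨_, rfl⟩
  have hP0 : P 0 = Q 0 := by simp [P]
  have hPn : ∀ n (h : 0 < n ∧ n < 10), P n = Q (σ ⟨n - 1, by omega⟩) := by
    intro n h
    simp only [P, dif_pos h]
  have hang : ∀ i j, 0 < i → i < j → j < 10 → 0 < orient (P 0) (P i) (P j) := by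
    intro i j hi hij hj
    rw [hP0, hPn i ⟨hi, by omega⟩, hPn j ⟨by omega, hj⟩]
    apply orient_of_key (hQmono _ _ (by omega)) (hQmono _ _ (by omega))
      (fun e => hσ0 _ (hQinj e).symm) (fun e => hσ0 _ (hQinj e).symm)
    rw [hσ, hσ]
    apply g.strictMono
    rw [Fin.mk_lt_mk]
    omega
  apply hole_of_sorted hS P
  · intro i _
    obtain ⟨j, hj⟩ := hPQ i
    rw [hj]; exact hQS j
  · have hlt : ∀ i j, i < j → j < 10 → P i ≠ P j := by
      intro i j hij hj h
      rcases Nat.eq_zero_or_pos i with rfl | hi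
      · rw [hP0, hPn j ⟨hij, hj⟩] at h
        exact hσ0 _ (hQinj h).symm
      · have := hang i j hi hij hj
        rw [h] at this
        simp [orient] at this
        linarith
    intro i hi j hj h
    rcases lt_trichotomy i j with h1 | h1 | h1
    · exact absurd h (hlt i j h1 hj)
    · exact h1
    · exact absurd h.symm (hlt j i h1 hi)
  · exact hang
  · intro p hp hmem
    obtain ⟨i, rfl⟩ := hQsep p hp (convexHull_mono (by
      rintro _ ⟨n, _, rfl⟩
      obtain ⟨j, hj⟩ := hPQ n
      exact ⟨j, hj.symm⟩) hmem)
    by_cases hi : i = 0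
    · exact ⟨0, by norm_num, by rw [hi, hP0]⟩
    · have hkey : key (Q 0) (Q i) ∈ Set.range g := by
        have : Set.range g = K := K.range_orderEmbOfFin hK
        rw [this]
        simp only [K, Finset.coe_image, Set.mem_image]
        exact ⟨i, by simpa using hi, rfl⟩
      obtain ⟨k, hk⟩ := hkey
      refine ⟨k + 1, by omega, ?_⟩
      rw [hPn (k + 1) ⟨by omega, by omega⟩]
      by_contra hne
      have e : (⟨(k : ℕ) + 1 - 1, by omega⟩ : Fin 9) = k := by ext; simp
      rw [e] at hne
      refine hor i (σ k) hi (hσ0 k) (fun h => hne (by rw [← h])) (key_inj ?_)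
      rw [hσ, hk]

end Hb

/-! ### The nine point set -/

namespace Hb

/-- First coordinates of the nine points. -/
def px (i : ℕ) : ℕ := Nat.land (Nat.shiftRight 63009439999 (Nat.mul 4 i)) 15

/-- Second coordinates of the nine points. -/
def py (i : ℕ) : ℕ := Nat.land (Nat.shiftRight 40392044047 (Nat.mul 4 i)) 15

/-- Table of orientations of the triples of points. -/
def posT (a b c : ℕ) : ℕ :=
  Nat.land 1 (Nat.shiftRight 24288778853814445659603775444269192527280714850098801053300591725779027141460574762348389495778725603407002482605331906938871672989520170159981425621182505568970305243889239020680320752245462841025306433735195361280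
    (Nat.add (Nat.mul 81 a) (Nat.add (Nat.mul 9 b) c)))

/-- Table of pairs of crossing segments. -/
def crT : ℕ := 7054091296699420735735077742722422265340219582514422882727276316822038708694734414943730310814577389473174060047991541855404830388559035473817589922998686519213900514539773568282237628163946123675892402840636807202797225855333209412068251457496489373394119177430761246002057508285280182788715126929417067739313798288756311637080158660559714132692711821925297690885181935958890300595838105756539728268851006237172522435740049805090658005957771440044021035618561934480237152965814309112889551425375379415940475582900634568743304355391748000522465076133679591869844870073559607974064677188848272598803994273757402789561608093168659715811238704618144579874234722080232332855010162228332078207795073557032886491191255495199244889324966570303968494242499675573210404591543310233109607449571148714997550340521394230402110964818117282252626859527967948973668378120128834045771353039147948472445116885972224400895018732800645067882003553775250920222901597584802257013144393098643113777433380529124852134150538098044835784759476949619877268693358865041163759364874025231964342124919286369114716078108406832450631749047778181017400761543257847676804662531624084732649933599354270794125149284466806858037106953280663364102434477958939178325236765360390114382870291697408877354829082881939804863674933303026625583901088996692622501601115577626589886436695309141583513313317789530132080382923723716234333002091875100207201287582466050780867048265911919386866870444651851541012220903334400671995548194706904012175945194434328191906430964756174479304621335472067125350162576408405231706980621391075822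3892454044810600232600832512439451896318529248807245027952940786848865820912381381597858725261729077955184996150320218480857898127012547394530435195059915633161603782246444022096266833954506390006697361067994497078839430666056153306143616222322982983717189066591399445660560801097570673576570686816120187101953271286331748016062680088200449264787956711817216

/-- The set (as a bit mask) of segments crossing the segment `a b`. -/
def crM (a b : ℕ) : ℕ := Nat.shiftRight crT (Nat.mul 81 (Nat.add (Nat.mul 9 a) b))

/-- Depth first search through the simple paths. -/
def dfs (s t : ℕ) : ℕ → ℕ → ℕ → ℕ → ℕ → ℕ → ℕ → ℕ → ℕ → Bool
  | 0, p, q, E, _, L, R, A, B =>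
    cond (Nat.beq (Nat.land (crM q s) E) 0)
      (cond (cond (Nat.beq (Nat.add L (Nat.add (posT p q s) (posT q s t))) 3)
          (Nat.ble (Nat.add A (Nat.mul (px q) (py s))) (Nat.add B (Nat.mul (py q) (px s)))) true)
        (cond (Nat.beq (Nat.add R (Nat.add (posT s q p) (posT t s q))) 3)
          (Nat.ble (Nat.add B (Nat.mul (py q) (px s))) (Nat.add A (Nat.mul (px q) (py s)))) true)
        false)
      true
  | n + 1, p, q, E, V, L, R, A, B =>
    cond (cond (Nat.ble 4 L) (Nat.ble 4 R) false) true
      ([0, 1, 2, 3, 4, 5, 6, 7, 8].all fun r =>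
        cond (Nat.beq (Nat.land 1 (Nat.shiftRight V r)) 0)
          (cond (Nat.beq (Nat.land (crM q r) E) 0)
            (dfs s t n q r (Nat.lor E (Nat.shiftLeft 1 (Nat.add (Nat.mul 9 q) r)))
              (Nat.lor V (Nat.shiftLeft 1 r)) (Nat.add L (posT p q r)) (Nat.add R (posT r q p))
              (Nat.add A (Nat.mul (px q) (py r))) (Nat.add B (Nat.mul (py q) (px r))))
            true)
          true)

/-- The search for polygons with `n + 2` vertices with smallest vertex `s`. -/
def dfs0 (n s : ℕ) : Bool :=
  [0, 1, 2, 3, 4, 5, 6, 7, 8].all fun t => cond (Nat.ble t s) true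
    (dfs s t n s t (Nat.shiftLeft 1 (Nat.add (Nat.mul 9 s) t))
      (Nat.lor (Nat.sub (Nat.shiftLeft 2 s) 1) (Nat.shiftLeft 1 t)) 0 0
      (Nat.mul (px s) (py t)) (Nat.mul (py s) (px t)))

theorem dfs_80 : dfs0 6 0 = true := by decide +kernel

theorem dfs_81 : dfs0 6 1 = true := by decide +kernel

theorem dfs_90 : dfs0 7 0 = true := by decide +kernel

/-- Quantification over `{0, …, 8}`. -/
def all9 (f : ℕ → Bool) : Bool := [0, 1, 2, 3, 4, 5, 6, 7, 8].all f

theorem all9_spec {f : ℕ → Bool} (h : all9 f = true) (i : ℕ) (hi : i < 9) : f i = true := by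
  unfold all9 at h
  rw [List.all_eq_true] at h
  exact h i (by simp only [List.mem_cons, List.not_mem_nil]; omega)

/-- The positive part of the orientation. -/
def opl (a b c : ℕ) : ℕ :=
  Nat.add (Nat.mul (px a) (py b)) (Nat.add (Nat.mul (px b) (py c)) (Nat.mul (px c) (py a)))

/-- The negative part of the orientation. -/
def omi (a b c : ℕ) : ℕ :=
  Nat.add (Nat.mul (py a) (px b)) (Nat.add (Nat.mul (py b) (px c)) (Nat.mul (py c) (px a)))

theorem ble_false {a b : ℕ} (h : b < a) : Nat.ble a b = false := by
  rw [Bool.eq_false_iff, ne_eq, Nat.ble_eq]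
  omega

theorem posT_aux : (all9 fun a => all9 fun b => all9 fun c =>
    Nat.beq (posT a b c) (cond (Nat.ble (opl a b c) (omi a b c)) 0 1)) = true := by
  decide +kernel

theorem posT_spec (a b c : ℕ) (ha : a < 9) (hb : b < 9) (hc : c < 9) :
    posT a b c = if omi a b c < opl a b c then 1 else 0 := by
  have h := all9_spec (all9_spec (all9_spec posT_aux a ha) b hb) c hc
  rw [Nat.beq_eq] at h
  rw [h]
  split_ifs with h1
  · rw [ble_false h1, cond_false]
  · rw [Nat.ble_eq_true_of_le (not_lt.1 h1), cond_true]

theorem posT_ne_aux : (all9 fun a => all9 fun b => all9 fun c =>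
    Nat.beq a b || (Nat.beq a c || (Nat.beq b c || !Nat.beq (opl a b c) (omi a b c)))) = true := by
  decide +kernel

theorem posT_ne (a b c : ℕ) (ha : a < 9) (hb : b < 9) (hc : c < 9) (hab : a ≠ b) (hac : a ≠ c)
    (hbc : b ≠ c) : opl a b c ≠ omi a b c := by
  have h := all9_spec (all9_spec (all9_spec posT_ne_aux a ha) b hb) c hc
  simp only [Bool.or_eq_true, Nat.beq_eq, Bool.not_eq_true', hab, hac, hbc,
    false_or] at h
  intro hh
  rw [hh] at h
  simp at h

theorem crM_aux : (all9 fun a => all9 fun b => all9 fun c => all9 fun d =>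
    cond (Nat.beq (Nat.land 1 (Nat.shiftRight (crM a b) (Nat.add (Nat.mul 9 c) d))) 0) true
      (!(Nat.beq a b) && !(Nat.beq a c) && !(Nat.beq a d) && !(Nat.beq b c) && !(Nat.beq b d) &&
        !(Nat.beq c d) && !(Nat.beq (posT a b c) (posT a b d)) &&
        !(Nat.beq (posT c d a) (posT c d b)))) = true := by
  decide +kernel

theorem bit_zero (V r : ℕ) :
    Nat.beq (Nat.land 1 (Nat.shiftRight V r)) 0 = !V.testBit r := by
  have h : V.testBit r = (Nat.land 1 (Nat.shiftRight V r) != 0) := rfl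
  rw [h]
  cases Nat.land 1 (Nat.shiftRight V r) <;> rfl

theorem crM_spec (a b c d : ℕ) (ha : a < 9) (hb : b < 9) (hc : c < 9) (hd : d < 9)
    (hx : (crM a b).testBit (9 * c + d) = true) :
    a ≠ b ∧ a ≠ c ∧ a ≠ d ∧ b ≠ c ∧ b ≠ d ∧ c ≠ d ∧
      posT a b c ≠ posT a b d ∧ posT c d a ≠ posT c d b := by
  have h := all9_spec (all9_spec (all9_spec (all9_spec crM_aux a ha) b hb) c hc) d hd
  rw [bit_zero] at h
  simp only [Nat.add_eq, Nat.mul_eq, hx, Bool.not_true, cond_false, Bool.and_eq_true,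
    Bool.not_eq_true', ← Bool.not_eq_true, Nat.beq_eq, and_assoc] at h
  exact h

theorem shl_one (r : ℕ) : Nat.shiftLeft 1 r = 2 ^ r := Nat.one_shiftLeft r

/-- A closed sequence of indices describing a pseudo-triangle. -/
structure Good (ℓ : ℕ) (F : ℕ → ℕ) : Prop where
  lt : ∀ i, F i < 9
  cr : ∀ i < ℓ, ∀ j < ℓ, (crM (F i) (F (i + 1))).testBit (9 * F j + F (j + 1)) = false
  inj : ∀ i < ℓ, ∀ j < ℓ, F i = F j → i = j
  per0 : F ℓ = F 0
  per1 : F (ℓ + 1) = F 1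
  cnt : (∑ i ∈ Finset.range ℓ, posT (F i) (F (i + 1)) (F (i + 2)) = 3 ∧
      ∑ i ∈ Finset.range ℓ, py (F i) * px (F (i + 1)) <
        ∑ i ∈ Finset.range ℓ, px (F i) * py (F (i + 1))) ∨
    (∑ i ∈ Finset.range ℓ, posT (F (i + 2)) (F (i + 1)) (F i) = 3 ∧
      ∑ i ∈ Finset.range ℓ, px (F i) * py (F (i + 1)) <
        ∑ i ∈ Finset.range ℓ, py (F i) * px (F (i + 1)))

theorem dfs_sound {ℓ : ℕ} {F : ℕ → ℕ} (hF : Good ℓ F) (n : ℕ) : ∀ k E V,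
    n + k + 2 = ℓ →
    (∀ j < ℓ, Nat.land (crM (F j) (F (j + 1))) E = 0) →
    (∀ m, k + 2 ≤ m → m < ℓ → V.testBit (F m) = false) →
    dfs (F 0) (F 1) n (F k) (F (k + 1)) E V
      (∑ i ∈ Finset.range k, posT (F i) (F (i + 1)) (F (i + 2)))
      (∑ i ∈ Finset.range k, posT (F (i + 2)) (F (i + 1)) (F i))
      (∑ i ∈ Finset.range (k + 1), px (F i) * py (F (i + 1)))
      (∑ i ∈ Finset.range (k + 1), py (F i) * px (F (i + 1))) = true → False := by
  induction n with
  | zero =>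
    intro k E V hk hE hV h
    have hl : ℓ = k + 2 := by omega
    subst hl
    have hE' := hE (k + 1) (by omega)
    have p0 := hF.per0
    have p1 := hF.per1
    have hc := hF.cnt
    simp only [Finset.sum_range_succ _ (k + 1), Finset.sum_range_succ _ k] at hc h
    simp only [show k + 1 + 1 = k + 2 from rfl, show k + 1 + 2 = k + 2 + 1 from rfl, p0, p1]
      at hc hE' 
    unfold dfs at h
    rw [hE'] at h
    simp only [Nat.add_eq, Nat.mul_eq, ← add_assoc] at h
    rw [Nat.beq_refl, cond_true] at h
    rcases hc with ⟨c1, c2⟩ | ⟨c1, c2⟩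
    · rw [c1, Nat.beq_refl, cond_true, ble_false c2] at h
      simp at h
    · rw [c1, Nat.beq_refl, cond_true, ble_false c2] at h
      simp [Bool.cond_eq_ite] at h
  | succ n ih =>
    intro k E V hk hE hV h
    unfold dfs at h
    have hm : ∀ a : ℕ → ℕ, (∑ i ∈ Finset.range k, a i) ≤ (∑ i ∈ Finset.range ℓ, a i) := fun a =>
      Finset.sum_le_sum_of_subset (Finset.range_mono (by omega))
    have hm1 := hm fun i => posT (F i) (F (i + 1)) (F (i + 2))
    have hm2 := hm fun i => posT (F (i + 2)) (F (i + 1)) (F i)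
    have hcc : (cond (Nat.ble 4 (∑ i ∈ Finset.range k, posT (F i) (F (i + 1)) (F (i + 2))))
      (Nat.ble 4 (∑ i ∈ Finset.range k, posT (F (i + 2)) (F (i + 1)) (F i))) false) = false := by
      rw [Bool.eq_false_iff]
      intro hh
      simp only [Bool.cond_eq_ite] at hh
      split_ifs at hh with h1
      rw [Nat.ble_eq] at h1 hh
      have := hF.cnt
      omega
    rw [hcc, cond_false, List.all_eq_true] at h
    have h2 := h (F (k + 2)) (by
      have := hF.lt (k + 2)
      simp only [List.mem_cons, List.not_mem_nil]; omega)
    rw [bit_zero, hV (k + 2) le_rfl (by omega)] at h2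
    have hE' := hE (k + 1) (by omega)
    simp only [show k + 1 + 1 = k + 2 from rfl] at hE' 
    rw [hE'] at h2
    simp only [Bool.not_false, cond_true, Nat.beq_refl, Nat.add_eq, Nat.mul_eq] at h2
    refine ih (k + 1) _ _ (by omega) ?_ ?_ (by
      rw [Finset.sum_range_succ _ k, Finset.sum_range_succ _ k, Finset.sum_range_succ _ (k + 1),
        Finset.sum_range_succ _ (k + 1)]
      exact h2)
    · intro j hj
      have e1 := hE j hj
      have e2 := hF.cr j hj (k + 1) (by omega)
      simp only [show k + 1 + 1 = k + 2 from rfl] at e2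
      rw [shl_one]
      change _ &&& (E ||| _) = 0
      change _ &&& E = 0 at e1
      rw [Nat.and_or_distrib_left, e1, Nat.zero_or]
      rw [Nat.and_two_pow, e2]
      simp
    · intro m hm1 hm2
      rw [shl_one]
      change (V ||| _).testBit _ = _
      rw [Nat.testBit_or, hV m (by omega) hm2, Nat.testBit_two_pow]
      simp only [Bool.false_or, decide_eq_false_iff_not]
      intro hh
      have := hF.inj _ (by omega) _ hm2 hh
      omega

theorem dfs0_sound {ℓ : ℕ} {F : ℕ → ℕ} (hF : Good ℓ F) (n : ℕ) (hn : n + 2 = ℓ)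
    (hmin : ∀ i, F 0 ≤ F i) (h : dfs0 n (F 0) = true) : False := by
  unfold dfs0 at h
  rw [List.all_eq_true] at h
  have h1 := h (F 1) (by
      have := hF.lt 1
      simp only [List.mem_cons, List.not_mem_nil]; omega)
  have hgt : ∀ i, 0 < i → i < ℓ → F 0 < F i := fun i hi hil =>
    lt_of_le_of_ne (hmin i) fun hh => by
      have := hF.inj _ (by omega) _ hil hh; omega
  have h2 : Nat.ble (F 1) (F 0) = false := by
    rw [Bool.eq_false_iff, ne_eq, Nat.ble_eq]
    have := hgt 1 (by omega) (by omega)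
    omega
  rw [h2, cond_false] at h1
  refine dfs_sound hF n 0 _ _ (by omega) ?_ ?_ (by
    simpa only [Finset.sum_range_succ, Finset.sum_range_zero, zero_add, Nat.mul_eq] using h1)
  · intro j hj
    have e2 := hF.cr j hj 0 (by omega)
    rw [shl_one]
    change _ &&& _ = 0
    simp only [zero_add] at e2
    rw [Nat.and_two_pow]
    simp only [Nat.add_eq, Nat.mul_eq]
    rw [e2]
    simp
  · intro m hm1 hm2
    rw [shl_one]
    change Nat.testBit (_ ||| _) _ = _
    have e : Nat.sub (Nat.shiftLeft 2 (F 0)) 1 = 2 ^ (F 0 + 1) - 1 := by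
      change (2 <<< F 0) - 1 = _
      rw [Nat.shiftLeft_eq, pow_succ, mul_comm]
    rw [e, Nat.testBit_or, Nat.testBit_two_pow_sub_one, Nat.testBit_two_pow]
    have := hgt m (by omega) hm2
    have h3 : ¬ F 1 = F m := fun hh => by
      have := hF.inj _ (by omega) _ hm2 hh; omega
    simp [h3]; omega

theorem not_good8 {F : ℕ → ℕ} (hF : Good 8 F) (hmin : ∀ i, F 0 ≤ F i) : False := by
  have hc : (Finset.range 8).card ≤ (Finset.Ico (F 0) 9).card :=
    Finset.card_le_card_of_injOn F (fun i _ => by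
      simp only [Finset.coe_Ico, Set.mem_Ico]; exact ⟨hmin i, hF.lt i⟩)
      (fun i hi j hj h => hF.inj i (by simpa using hi) j (by simpa using hj) h)
  rw [Finset.card_range, Nat.card_Ico] at hc
  have : F 0 = 0 ∨ F 0 = 1 := by omega
  rcases this with h | h
  · exact dfs0_sound hF 6 rfl hmin (by rw [h]; exact dfs_80)
  · exact dfs0_sound hF 6 rfl hmin (by rw [h]; exact dfs_81)

theorem not_good9 {F : ℕ → ℕ} (hF : Good 9 F) (hmin : ∀ i, F 0 ≤ F i) : False := by
  have hc : (Finset.range 9).card ≤ (Finset.Ico (F 0) 9).card :=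
    Finset.card_le_card_of_injOn F (fun i _ => by
      simp only [Finset.coe_Ico, Set.mem_Ico]; exact ⟨hmin i, hF.lt i⟩)
      (fun i hi j hj h => hF.inj i (by simpa using hi) j (by simpa using hj) h)
  rw [Finset.card_range, Nat.card_Ico] at hc
  have h : F 0 = 0 := by omega
  exact dfs0_sound hF 7 rfl hmin (by rw [h]; exact dfs_90)

/-- The nine points. -/
def P9 (i : ℕ) : Pt := ((px i : ℝ), (py i : ℝ))

/-- The nine point set. -/
def S9 : Set Pt := P9 '' {i | i < 9}

theorem orient_P9 (a b c : ℕ) :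
    orient (P9 a) (P9 b) (P9 c) = (opl a b c : ℝ) - (omi a b c : ℝ) := by
  simp only [orient, P9, opl, omi, Nat.add_eq, Nat.mul_eq]
  push_cast
  ring

theorem orient_pos_iff {a b c : ℕ} (ha : a < 9) (hb : b < 9) (hc : c < 9) :
    0 < orient (P9 a) (P9 b) (P9 c) ↔ posT a b c = 1 := by
  rw [orient_P9, sub_pos, Nat.cast_lt, posT_spec a b c ha hb hc]
  split_ifs with h <;> simp [h]

theorem orient_ne {a b c : ℕ} (ha : a < 9) (hb : b < 9) (hc : c < 9) (hab : a ≠ b) (hac : a ≠ c)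
    (hbc : b ≠ c) : orient (P9 a) (P9 b) (P9 c) ≠ 0 := by
  rw [orient_P9, sub_ne_zero]
  exact fun h => posT_ne a b c ha hb hc hab hac hbc (Nat.cast_injective h)

theorem P9_inj_aux : (all9 fun a => all9 fun b =>
    cond (Nat.beq (px a) (px b)) (cond (Nat.beq (py a) (py b)) (Nat.beq a b) true) true) = true := by
  decide +kernel

theorem P9_inj {a b : ℕ} (ha : a < 9) (hb : b < 9) (h : P9 a = P9 b) : a = b := by
  have h1 := all9_spec (all9_spec P9_inj_aux a ha) b hb
  simp only [P9, Prod.mk.injEq, Nat.cast_inj] at h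
  rw [h.1, h.2, Nat.beq_refl, Nat.beq_refl, cond_true, cond_true, Nat.beq_eq] at h1
  exact h1

theorem S9_finite : S9.Finite := (Set.finite_lt_nat 9).image _

theorem S9_ncard : S9.ncard = 9 := by
  unfold S9
  have hi : Set.InjOn P9 {i | i < 9} := fun a ha b hb h => P9_inj ha hb h
  rw [hi.ncard_image]
  have : ({i | i < 9} : Set ℕ) = (Finset.range 9 : Set ℕ) := by ext; simp
  rw [this, Set.ncard_coe_finset, Finset.card_range]

theorem S9_genPos : GenPos S9 := by
  rintro _ ⟨a, ha, rfl⟩ _ ⟨b, hb, rfl⟩ _ ⟨c, hc, rfl⟩ hab hac hbc h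
  exact orient_ne ha hb hc (fun h => hab (h ▸ rfl)) (fun h => hac (h ▸ rfl))
    (fun h => hbc (h ▸ rfl)) (orient_of_collinear h)

theorem hole_aux : (all9 fun a => all9 fun b => cond (Nat.ble b a) true <|
    all9 fun c => cond (Nat.ble c b) true <| all9 fun d => cond (Nat.ble d c) true <|
    all9 fun e => cond (Nat.ble e d) true <|
    [a, b, c, d, e].any fun x => [a, b, c, d, e].any fun y => [a, b, c, d, e].any fun z =>
    [0, 1, 2, 3, 4, 5, 6, 7, 8].any fun p =>
      cond (Nat.beq (posT x y p) 1) (cond (Nat.beq (posT y z p) 1) (Nat.beq (posT z x p) 1) false)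
        false) = true := by
  decide +kernel

theorem S9_noHole : ¬ HasHole 5 S9 := by
  rintro ⟨H, hHS, hcard, hconv, hempty⟩
  classical
  set I : Finset ℕ := (Finset.range 9).filter fun i => P9 i ∈ H with hI
  have hHI : H = P9 '' (I : Set ℕ) := by
    ext x
    constructor
    · intro hx
      obtain ⟨i, hi, rfl⟩ := hHS hx
      exact ⟨i, by simp only [hI, Finset.coe_filter, Finset.mem_range]; exact ⟨hi, hx⟩, rfl⟩
    · rintro ⟨i, hi, rfl⟩
      simp only [hI, Finset.coe_filter, Finset.mem_range] at hi
      exact hi.2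
  have hIc : I.card = 5 := by
    rw [← hcard, hHI, Set.InjOn.ncard_image, Set.ncard_coe_finset]
    intro a ha b hb h
    simp only [hI, Finset.coe_filter, Finset.mem_range] at ha hb
    exact P9_inj ha.1 hb.1 h
  set g := I.orderEmbOfFin hIc with hg
  have hgm : ∀ i, g i < 9 ∧ P9 (g i) ∈ H := fun i => by
    have := I.orderEmbOfFin_mem hIc i
    simpa only [hI, Finset.mem_filter, Finset.mem_range] using this
  have hlt : ∀ i j : Fin 5, i < j → g i < g j := fun i j h => g.strictMono h
  have h := all9_spec (all9_spec hole_aux (g 0) (hgm 0).1) (g 1) (hgm 1).1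
  rw [ble_false (hlt 0 1 (by decide)), cond_false] at h
  have h := all9_spec h (g 2) (hgm 2).1
  rw [ble_false (hlt 1 2 (by decide)), cond_false] at h
  have h := all9_spec h (g 3) (hgm 3).1
  rw [ble_false (hlt 2 3 (by decide)), cond_false] at h
  have h := all9_spec h (g 4) (hgm 4).1
  rw [ble_false (hlt 3 4 (by decide)), cond_false] at h
  have hmem : ∀ x ∈ [g 0, g 1, g 2, g 3, g 4], x < 9 ∧ P9 x ∈ H := by
    intro x hx
    simp only [List.mem_cons, List.not_mem_nil, or_false] at hx
    rcases hx with rfl | rfl | rfl | rfl | rfl <;> exact hgm _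
  rw [List.any_eq_true] at h
  obtain ⟨x, hx, h⟩ := h
  rw [List.any_eq_true] at h
  obtain ⟨y, hy, h⟩ := h
  rw [List.any_eq_true] at h
  obtain ⟨z, hz, h⟩ := h
  rw [List.any_eq_true] at h
  obtain ⟨p, hp, h⟩ := h
  have hp9 : p < 9 := by
    simp only [List.mem_cons, List.not_mem_nil, or_false] at hp
    omega
  obtain ⟨hx9, hxH⟩ := hmem x hx
  obtain ⟨hy9, hyH⟩ := hmem y hy
  obtain ⟨hz9, hzH⟩ := hmem z hz
  simp only [Bool.cond_eq_ite, Nat.beq_eq] at h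
  split_ifs at h with h1 h2
  rw [← orient_pos_iff hx9 hy9 hp9] at h1
  rw [← orient_pos_iff hy9 hz9 hp9] at h2
  rw [Nat.beq_eq, ← orient_pos_iff hz9 hx9 hp9] at h
  have hint := inside_interior h1 h2 h
  have hsub : ({P9 x, P9 y, P9 z} : Set Pt) ⊆ H := by
    rintro q (rfl | rfl | rfl) <;> assumption
  have hpH := hempty (P9 p) ⟨p, hp9, rfl⟩ (interior_mono (convexHull_mono hsub) hint)
  have n1 : P9 x ≠ P9 p := fun hh => by rw [hh] at h1; simp [orient] at h1
  have n2 : P9 y ≠ P9 p := fun hh => by rw [hh] at h2; simp [orient] at h2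
  have n3 : P9 z ≠ P9 p := fun hh => by rw [hh] at h; simp [orient] at h
  refine hconv _ hpH (convexHull_mono (s := {P9 x, P9 y, P9 z}) ?_ (interior_subset hint))
  rintro q (rfl | rfl | rfl)
  exacts [⟨hxH, n1⟩, ⟨hyH, n2⟩, ⟨hzH, n3⟩]

theorem segments_meet {a b c d : Pt} (h1 : orient a b c * orient a b d < 0)
    (h2 : orient c d a * orient c d b < 0) : (segment ℝ a b ∩ segment ℝ c d).Nonempty := by
  have key : ∀ x y : ℝ, x * y < 0 → x - y ≠ 0 ∧ 0 ≤ x / (x - y) ∧ 0 ≤ - y / (x - y) := by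
    intro x y h
    rcases mul_neg_iff.1 h with ⟨hx, hy⟩ | ⟨hx, hy⟩
    · exact ⟨by linarith, div_nonneg hx.le (by linarith), div_nonneg (by linarith) (by linarith)⟩
    · exact ⟨by linarith, div_nonneg_of_nonpos hx.le (by linarith),
        div_nonneg_of_nonpos (by linarith) (by linarith)⟩
  obtain ⟨k1, k2, k3⟩ := key _ _ h1
  obtain ⟨l1, l2, l3⟩ := key _ _ h2
  have hD : orient a b c - orient a b d = - (orient c d a - orient c d b) := by
    simp only [orient]; ring
  refine ⟨(- orient c d b / (orient c d a - orient c d b)) • a +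
    (orient c d a / (orient c d a - orient c d b)) • b, ⟨_, _, l3, l2, by field_simp; ring, rfl⟩,
    ⟨_, _, k3, k2, by field_simp; ring, ?_⟩⟩
  rw [hD]
  have e : ∀ z w : Pt, z = w ↔ z.1 = w.1 ∧ z.2 = w.2 := fun z w => Prod.ext_iff
  rw [e]
  simp only [Prod.fst_add, Prod.snd_add, Prod.smul_fst, Prod.smul_snd, smul_eq_mul]
  constructor
  · field_simp
    simp only [orient]
    ring
  · field_simp
    simp only [orient]
    ring

theorem sum_zmod {ℓ : ℕ} [NeZero ℓ] {M : Type*} [AddCommMonoid M] (c : ZMod ℓ) (g : ZMod ℓ → M) :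
    ∑ i, g i = ∑ n ∈ Finset.range ℓ, g (c + n) := by
  rw [← Equiv.sum_comp (Equiv.addLeft c)]
  refine Finset.sum_nbij' (fun i => i.val) (fun n => (n : ZMod ℓ)) ?_ ?_ ?_ ?_ ?_
  · intro i _
    simp [ZMod.val_lt]
  · simp
  · intro i _
    simp
  · intro n hn
    exact ZMod.val_cast_of_lt (by simpa using hn)
  · intro i _
    simp

theorem ncard_count {ℓ : ℕ} [NeZero ℓ] (c : ZMod ℓ) (Q : ZMod ℓ → Prop) (w : ZMod ℓ → ℕ)
    (h : ∀ i, (Q i → w i = 1) ∧ (¬ Q i → w i = 0)) :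
    {i | Q i}.ncard = ∑ n ∈ Finset.range ℓ, w (c + n) := by
  classical
  rw [← sum_zmod c w, Set.ncard_eq_toFinset_card', Set.toFinset_setOf, Finset.card_filter]
  refine Finset.sum_congr rfl fun i _ => ?_
  split_ifs with hq
  · rw [(h i).1 hq]
  · rw [(h i).2 hq]

theorem posT_le {a b c : ℕ} (ha : a < 9) (hb : b < 9) (hc : c < 9) : posT a b c ≤ 1 := by
  rw [posT_spec a b c ha hb hc]
  split_ifs <;> omega

theorem orient_mul_neg {a b c d : ℕ} (ha : a < 9) (hb : b < 9) (hc : c < 9) (hd : d < 9)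
    (hab : a ≠ b) (hac : a ≠ c) (hbc : b ≠ c) (had : a ≠ d) (hbd : b ≠ d)
    (h : posT a b c ≠ posT a b d) :
    orient (P9 a) (P9 b) (P9 c) * orient (P9 a) (P9 b) (P9 d) < 0 := by
  have n1 := orient_ne ha hb hc hab hac hbc
  have n2 := orient_ne ha hb hd hab had hbd
  have i1 := orient_pos_iff ha hb hc
  have i2 := orient_pos_iff ha hb hd
  have l1 := posT_le ha hb hc
  have l2 := posT_le ha hb hd
  rw [mul_neg_iff]
  rcases lt_or_gt_of_ne n1 with s1 | s1 <;> rcases lt_or_gt_of_ne n2 with s2 | s2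
  · have := mt i1.2 s1.not_gt
    have := mt i2.2 s2.not_gt
    omega
  · exact Or.inr ⟨s1, s2⟩
  · exact Or.inl ⟨s1, s2⟩
  · have := i1.1 s1
    have := i2.1 s2
    omega

theorem no_pseudo {ℓ : ℕ} (hl : 8 ≤ ℓ) (v : ZMod ℓ → Pt) (hv : Set.range v ⊆ S9)
    (hp : IsPseudoTriangle ℓ v) : False := by
  obtain ⟨hsim, hvt, hcard⟩ := hp
  have hnz : ℓ ≠ 0 := by omega
  haveI : NeZero ℓ := ⟨hnz⟩
  have hl9 : ℓ ≤ 9 := by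
    have h1 := Set.ncard_le_ncard hv S9_finite
    rw [S9_ncard, ← Set.image_univ, Set.ncard_image_of_injective _ hsim.inj, Set.ncard_univ,
      Nat.card_zmod] at h1
    exact h1
  have hex : ∀ i, ∃ k < 9, P9 k = v i := fun i => hv ⟨i, rfl⟩
  choose f hf hfv using hex
  have finj : Function.Injective f := fun i j h => hsim.inj (by rw [← hfv i, ← hfv j, h])
  obtain ⟨c, hc⟩ := Finite.exists_min f
  set F : ℕ → ℕ := fun n => f (c + n) with hF
  have hmin : ∀ i, F 0 ≤ F i := fun i => by simpa [hF] using hc (c + i)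
  have hvo : ∀ i, vtxCross ℓ v i = orient (P9 (f (i - 1))) (P9 (f i)) (P9 (f (i + 1))) := by
    intro i
    rw [hfv, hfv, hfv]
    simp only [vtxCross, cross2, orient, Prod.fst_sub, Prod.snd_sub]
    ring
  have harea : signedArea ℓ v =
      ((∑ i ∈ Finset.range ℓ, px (F i) * py (F (i + 1)) : ℕ) : ℝ) -
      ((∑ i ∈ Finset.range ℓ, py (F i) * px (F (i + 1)) : ℕ) : ℝ) := by
    rw [signedArea, dif_neg hnz, sum_zmod c]
    push_cast
    rw [← Finset.sum_sub_distrib]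
    refine Finset.sum_congr rfl fun n _ => ?_
    rw [← hfv, ← hfv]
    simp only [cross2, P9, hF, Nat.cast_add, Nat.cast_one, add_assoc]
  have hrev : ∀ a b d : ℕ, orient (P9 d) (P9 b) (P9 a) = - orient (P9 a) (P9 b) (P9 d) := by
    intro a b d
    simp only [orient]; ring
  have good : Good ℓ F := by
    refine ⟨fun i => hf _, ?_, ?_, ?_, ?_, ?_⟩
    · intro i _ j _
      rw [Bool.eq_false_iff]
      intro hx
      obtain ⟨e1, e2, e3, e4, e5, e6, e7, e8⟩ := crM_spec _ _ _ _ (hf _) (hf _) (hf _) (hf _) hx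
      have m1 := orient_mul_neg (hf _) (hf _) (hf _) (hf _) e1 e2 e4 e3 e5 e7
      have m2 := orient_mul_neg (hf _) (hf _) (hf _) (hf _) e6 e2.symm e3.symm e4.symm e5.symm e8
      have hne := segments_meet m1 m2
      simp only [hF, hfv, Nat.cast_add, Nat.cast_one, ← add_assoc] at hne
      rw [hsim.nonadj (c + i) (c + j)] at hne
      · exact Set.not_nonempty_empty hne
      · intro hh; apply e2; simp only [hF, hh]
      · intro hh; apply e3; simp only [hF, hh, Nat.cast_add, Nat.cast_one, add_assoc]
      · intro hh; apply e4; simp only [hF, hh, Nat.cast_add, Nat.cast_one, add_assoc]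
    · intro i hi j hj h
      have h1 := add_left_cancel (finj h)
      rw [ZMod.natCast_eq_natCast_iff', Nat.mod_eq_of_lt hi, Nat.mod_eq_of_lt hj] at h1
      exact h1
    · simp [hF]
    · simp [hF]
    · rcases lt_trichotomy (signedArea ℓ v) 0 with ha | ha | ha
      · right
        constructor
        · rw [← hcard, ncard_count (c + 1) _ fun i => posT (f (i + 1)) (f i) (f (i - 1))]
          · refine Finset.sum_congr rfl fun n _ => ?_
            have q1 : c + ((n + 2 : ℕ) : ZMod ℓ) = c + 1 + n + 1 := by push_cast; ring
            have q2 : c + ((n + 1 : ℕ) : ZMod ℓ) = c + 1 + n := by push_cast; ring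
            have q3 : c + (n : ZMod ℓ) = c + 1 + n - 1 := by ring
            simp only [hF]
            rw [q1, q2, ← q3]
          · intro i
            have o1 := orient_pos_iff (hf (i + 1)) (hf i) (hf (i - 1))
            have o2 := posT_le (hf (i + 1)) (hf i) (hf (i - 1))
            have o3 : IsConvexVtx ℓ v i ↔ posT (f (i + 1)) (f i) (f (i - 1)) = 1 := by
              rw [← o1, IsConvexVtx, hrev, ← hvo, neg_pos]
              constructor
              · intro hh
                by_contra hn
                exact absurd hh (not_lt.2 (mul_nonpos_of_nonneg_of_nonpos (not_lt.1 hn) ha.le))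
              · intro hh
                exact mul_pos_of_neg_of_neg hh ha
            rw [o3]
            omega
        · have := harea ▸ ha
          rw [sub_neg, Nat.cast_lt] at this
          exact this
      · exfalso
        have : {i : ZMod ℓ | IsConvexVtx ℓ v i} = ∅ := by
          ext i; simp [IsConvexVtx, ha]
        rw [this, Set.ncard_empty] at hcard
        omega
      · left
        constructor
        · rw [← hcard, ncard_count (c + 1) _ fun i => posT (f (i - 1)) (f i) (f (i + 1))]
          · refine Finset.sum_congr rfl fun n _ => ?_
            have q1 : c + ((n + 2 : ℕ) : ZMod ℓ) = c + 1 + n + 1 := by push_cast; ring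
            have q2 : c + ((n + 1 : ℕ) : ZMod ℓ) = c + 1 + n := by push_cast; ring
            have q3 : c + (n : ZMod ℓ) = c + 1 + n - 1 := by ring
            simp only [hF]
            rw [q1, q2, ← q3]
          · intro i
            have o1 := orient_pos_iff (hf (i - 1)) (hf i) (hf (i + 1))
            have o2 := posT_le (hf (i - 1)) (hf i) (hf (i + 1))
            have o3 : IsConvexVtx ℓ v i ↔ posT (f (i - 1)) (f i) (f (i + 1)) = 1 := by
              rw [← o1, IsConvexVtx, ← hvo]
              exact mul_pos_iff_of_pos_right ha
            rw [o3]
            omega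
        · have := harea ▸ ha
          rw [sub_pos, Nat.cast_lt] at this
          exact this
  have : ℓ = 8 ∨ ℓ = 9 := by omega
  rcases this with rfl | rfl
  · exact not_good8 good hmin
  · exact not_good9 good hmin

end Hb

/-- there is a set of 9 points in general position with no 5-hole and
no empty `ℓ`-pseudo-triangle for any `ℓ ≥ 8`; consequently `E(5,ℓ) = 10` for `ℓ ≥ 8`. -/
theorem statement_11 :
    (∃ S : Set Pt, S.Finite ∧ S.ncard = 9 ∧ GenPos S ∧ ¬ HasHole 5 S ∧
      ∀ ℓ : ℕ, 8 ≤ ℓ → ¬ HasEmptyPseudoTriangle ℓ S) ∧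
    (∀ ℓ : ℕ, 8 ≤ ℓ →
      IsLeast {n : ℕ | ∀ S : Set Pt, S.Finite → GenPos S → n ≤ S.ncard →
        HasHole 5 S ∨ HasEmptyPseudoTriangle ℓ S} 10) := by
  refine ⟨⟨Hb.S9, Hb.S9_finite, Hb.S9_ncard, Hb.S9_genPos, Hb.S9_noHole, ?_⟩, ?_⟩
  · rintro ℓ hl ⟨v, hv, hp, -⟩
    exact Hb.no_pseudo hl v hv hp
  · intro ℓ hl
    constructor
    · intro S hfin hS hcard
      exact Or.inl (Hb.harborth S hfin hS hcard)
    · intro n hn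
      by_contra hlt
      rcases hn Hb.S9 Hb.S9_finite Hb.S9_genPos (by rw [Hb.S9_ncard]; omega) with h | h
      · exact Hb.S9_noHole h
      · obtain ⟨v, hv, hp, -⟩ := h
        exact Hb.no_pseudo hl v hv hp
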